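/- arXiv:1108.0723 — 8 statements merged into one kernel-verified Lean document; each statement's English description precedes it below -/
import Mathlib

section
/- For every C₀ > 0 there is a constant C > 0 such that for all K ≥ 2, every admissible weight w of level K with |w(x)| ≤ C₀ for all x, and all reals α, β > 0 with α ≤ K/100 or β ≤ K/100, one has |S(α, β)| ≤ C·exp(−K/2). -/
open Complex Real MeasureTheory Set

noncomputable def e (x : ℝ) : ℂ := Complex.exp (2 * Real.pi * Complex.I * x)

noncomputable def besselJ (n : ℕ) (x : ℝ) : ℂ :=
  ∫ t in (-(1:ℝ)/2)..(1/2), e (n * t) * Complex.exp (-(Complex.I * x * Real.sin (2 * Real.pi * t)))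

def Admissible (K : ℝ) (C : ℕ → ℝ) (w : ℝ → ℝ) : Prop :=
  ContDiff ℝ (⊤ : ℕ∞) w ∧ tsupport w ⊆ Set.Icc K (2 * K) ∧
    ∀ (j : ℕ) (x : ℝ), |iteratedDeriv j w x| ≤ C j * K ^ (-(j : ℤ))

noncomputable def Ssum (w : ℝ → ℝ) (α β : ℝ) : ℂ :=
  ∑' k : ℕ, if Odd k then
    Complex.I ^ k * besselJ k (4 * Real.pi * α) * besselJ (2 * k - 1) (4 * Real.pi * β) * (w k : ℂ)
  else 0


theorem besselJ_eq_circleIntegral (n : ℕ) (x : ℝ) :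
    besselJ n x = (2 * Real.pi * Complex.I : ℂ)⁻¹ • ∮ z in C(0, 1),
      (z - 0)⁻¹ • (z ^ n * Complex.exp (-(x / 2 * (z - z⁻¹)))) := by
  set F : ℝ → ℂ := fun θ => Complex.exp (n * (θ * Complex.I)) *
    Complex.exp (-(Complex.I * x * Real.sin θ)) with hF
  have hper : Function.Periodic F (2 * Real.pi) := by
    intro θ
    have h1 : Complex.exp (n * (((θ + 2 * Real.pi : ℝ) : ℂ) * Complex.I))
        = Complex.exp (n * (θ * Complex.I)) := by
      rw [Complex.exp_nat_mul, Complex.exp_nat_mul]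
      push_cast
      rw [add_mul, Complex.exp_add, Complex.exp_two_pi_mul_I, mul_one]
    simp only [hF, h1, Real.sin_add_two_pi]
  have hJ : besselJ n x = (2 * Real.pi : ℂ)⁻¹ * ∫ θ in (0 : ℝ)..(2 * Real.pi), F θ := by
    have h2 : besselJ n x = ∫ t in (-(1 : ℝ) / 2)..(1 / 2), F (2 * Real.pi * t) := by
      unfold besselJ e
      refine intervalIntegral.integral_congr fun t _ => ?_
      simp only [hF]
      congr 2
      push_cast
      ring
    have h3 := hper.intervalIntegral_add_eq (-Real.pi) 0
    rw [zero_add, show -Real.pi + 2 * Real.pi = Real.pi by ring] at h3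
    rw [h2, intervalIntegral.integral_comp_mul_left (fun θ => F θ) (by positivity), ← h3,
      show 2 * Real.pi * (-(1 : ℝ) / 2) = -Real.pi by ring,
      show 2 * Real.pi * (1 / 2) = Real.pi by ring, Complex.real_smul]
    push_cast
    rfl
  have hC : (∮ z in C(0, 1), (z - 0)⁻¹ • (z ^ n * Complex.exp (-(x / 2 * (z - z⁻¹)))))
      = Complex.I * ∫ θ in (0 : ℝ)..(2 * Real.pi), F θ := by
    rw [circleIntegral, ← intervalIntegral.integral_const_mul]
    refine intervalIntegral.integral_congr fun θ _ => ?_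
    have hz : circleMap 0 1 θ = Complex.exp (θ * Complex.I) := by simp [circleMap]
    have hs : (Real.sin θ : ℂ) = (Complex.exp (-(θ * Complex.I)) - Complex.exp (θ * Complex.I))
        * Complex.I / 2 := by
      rw [Complex.ofReal_sin, Complex.sin, neg_mul]
    simp only [hF, deriv_circleMap, hz, smul_eq_mul, sub_zero, ← Complex.exp_nat_mul, hs,
      ← Complex.exp_neg]
    have hne : Complex.exp (θ * Complex.I) * Complex.exp (-(θ * Complex.I)) = 1 := by
      rw [← Complex.exp_add, add_neg_cancel, Complex.exp_zero]
    have he : -(x / 2 * (Complex.exp (θ * Complex.I) - Complex.exp (-(θ * Complex.I))))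
        = -(Complex.I * x * ((Complex.exp (-(θ * Complex.I)) - Complex.exp (θ * Complex.I))
          * Complex.I / 2)) := by
      linear_combination (x / 2 * (Complex.exp (-(θ * Complex.I)) - Complex.exp (θ * Complex.I)))
        * Complex.I_mul_I
    rw [he]
    linear_combination (Complex.I * (Complex.exp (n * (θ * Complex.I)) *
      Complex.exp (-(Complex.I * x * ((Complex.exp (-(θ * Complex.I)) -
        Complex.exp (θ * Complex.I)) * Complex.I / 2))))) * hne
  rw [hJ, hC, smul_eq_mul]
  have : (Real.pi : ℂ) ≠ 0 := by exact_mod_cast Real.pi_ne_zero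
  field_simp

theorem norm_besselJ_le_one (n : ℕ) (x : ℝ) : ‖besselJ n x‖ ≤ 1 := by
  have h := intervalIntegral.norm_integral_le_of_norm_le_const (a := -(1 : ℝ) / 2) (b := 1 / 2)
    (C := 1)
    (f := fun t : ℝ => e (n * t) *
      Complex.exp (-(Complex.I * x * Real.sin (2 * Real.pi * t)))) (by
      intro t _
      rw [e, norm_mul, Complex.norm_exp, Complex.norm_exp, ← Real.exp_add]
      simp [-Complex.ofReal_sin])
  rwa [show |(1 : ℝ) / 2 - -1 / 2| = 1 by norm_num, mul_one] at h

/-- Shifting the contour of integration from the unit circle to a circle of radius `r ≤ 1`. -/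
theorem norm_besselJ_le_pow_mul_exp (n : ℕ) {x r : ℝ} (hx : 0 ≤ x) (hr : 0 < r) (hr1 : r ≤ 1) :
    ‖besselJ n x‖ ≤ r ^ n * Real.exp (x / 2 * (r + r⁻¹)) := by
  have hd : ∀ z : ℂ, z ≠ 0 →
      DifferentiableAt ℂ (fun z : ℂ => z ^ n * Complex.exp (-(x / 2 * (z - z⁻¹)))) z := by
    intro z hz
    fun_prop (disch := exact hz)
  have hne : ∀ z : ℂ, z ∉ Metric.ball (0 : ℂ) r → z ≠ 0 := by
    rintro z hz rfl
    exact hz (Metric.mem_ball_self hr)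
  rw [besselJ_eq_circleIntegral,
    Complex.circleIntegral_sub_center_inv_smul_eq_of_differentiable_on_annulus_off_countable
      hr hr1 countable_empty
      (fun z hz => (hd z (hne z hz.2)).continuousAt.continuousWithinAt)
      (fun z hz => hd z (hne z fun h => hz.1.2 (Metric.ball_subset_closedBall h)))]
  have h := circleIntegral.norm_two_pi_i_inv_smul_integral_le_of_norm_le_const
    (c := (0 : ℂ)) (R := r) (C := r⁻¹ * (r ^ n * Real.exp (x / 2 * (r + r⁻¹))))
    (f := fun z : ℂ => (z - 0)⁻¹ • (z ^ n * Complex.exp (-(x / 2 * (z - z⁻¹))))) hr.le (by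
      intro z hz
      have hz' : ‖z‖ = r := by simpa using hz
      rw [sub_zero, norm_smul, norm_inv, hz', norm_mul, norm_pow, hz', Complex.norm_exp]
      gcongr
      calc (-(x / 2 * (z - z⁻¹)) : ℂ).re ≤ ‖(-(x / 2 * (z - z⁻¹)) : ℂ)‖ := Complex.re_le_norm _
        _ = x / 2 * ‖z - z⁻¹‖ := by
          rw [norm_neg, norm_mul, norm_div, Complex.norm_real, Real.norm_of_nonneg hx]
          simp
        _ ≤ x / 2 * (r + r⁻¹) := by
          gcongr
          refine (norm_sub_le _ _).trans ?_
          rw [norm_inv, hz'])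
  rwa [mul_inv_cancel_left₀ hr.ne'] at h

theorem norm_besselJ_le_exp_neg (n : ℕ) {a : ℝ} (ha : 0 ≤ a) (han : a ≤ n / 100) :
    ‖besselJ n (4 * Real.pi * a)‖ ≤ Real.exp (-n) := by
  refine (norm_besselJ_le_pow_mul_exp n (r := 1 / 4) (by positivity) (by norm_num)
    (by norm_num)).trans ?_
  have h4 : (1 / 4 : ℝ) ≤ Real.exp (-(4 / 3)) := by
    rw [Real.exp_neg, one_div]
    gcongr
    have h1 : Real.exp (4 / 3) ^ 3 = Real.exp 1 ^ 4 := by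
      rw [← Real.exp_nat_mul, ← Real.exp_nat_mul]
      norm_num
    have h2 : Real.exp 1 ^ 4 ≤ 4 ^ 3 :=
      (pow_le_pow_left₀ (Real.exp_pos 1).le Real.exp_one_lt_d9.le 4).trans (by norm_num)
    exact le_of_pow_le_pow_left₀ three_ne_zero (by norm_num) (h1.trans_le h2)
  calc (1 / 4 : ℝ) ^ n * Real.exp (4 * Real.pi * a / 2 * (1 / 4 + (1 / 4)⁻¹))
      ≤ Real.exp (-(4 / 3)) ^ n * Real.exp (n / 3) := by
        gcongr
        have : Real.pi * a ≤ 3.15 * (n / 100) :=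
          mul_le_mul Real.pi_lt_d2.le han ha (by norm_num)
        have hn : (0 : ℝ) ≤ n := n.cast_nonneg
        nlinarith
    _ = Real.exp (-n) := by
        rw [← Real.exp_nat_mul, ← Real.exp_add]
        ring_nf

theorem norm_besselJ_mul_besselJ_le {k : ℕ} (hk : 1 ≤ k) {a b : ℝ} (ha : 0 ≤ a) (hb : 0 ≤ b)
    (h : a ≤ k / 100 ∨ b ≤ k / 100) :
    ‖besselJ k (4 * Real.pi * a)‖ * ‖besselJ (2 * k - 1) (4 * Real.pi * b)‖ ≤ Real.exp (-k) := by
  rcases h with h | h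
  · simpa using mul_le_mul (norm_besselJ_le_exp_neg k ha h)
      (norm_besselJ_le_one (2 * k - 1) (4 * Real.pi * b)) (norm_nonneg _) (Real.exp_pos _).le
  · have hkn : (k : ℝ) ≤ ((2 * k - 1 : ℕ) : ℝ) := by
      exact_mod_cast (by omega : k ≤ 2 * k - 1)
    have h1 : ‖besselJ (2 * k - 1) (4 * Real.pi * b)‖ ≤ Real.exp (-k) :=
      (norm_besselJ_le_exp_neg (2 * k - 1) hb (h.trans (by gcongr))).trans
        (Real.exp_le_exp.2 (neg_le_neg hkn))
    simpa using mul_le_mul (norm_besselJ_le_one k (4 * Real.pi * a)) h1 (norm_nonneg _) zero_le_one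

theorem stmt1 (C₀ : ℝ) (hC₀ : 0 < C₀) :
    ∃ C : ℝ, 0 < C ∧ ∀ K : ℝ, 2 ≤ K → ∀ w : ℝ → ℝ,
      (∃ Cs : ℕ → ℝ, (∀ j, 0 < Cs j) ∧ Admissible K Cs w) →
      (∀ x : ℝ, |w x| ≤ C₀) →
      ∀ α β : ℝ, 0 < α → 0 < β → (α ≤ K / 100 ∨ β ≤ K / 100) →
      ‖Ssum w α β‖ ≤ C * Real.exp (-K / 2) := by
  have hsum : Summable fun k : ℕ => Real.exp (k * (-(1 / 2))) :=
    Real.summable_exp_nat_mul_iff.2 (by norm_num)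
  refine ⟨C₀ * ∑' k : ℕ, Real.exp (k * (-(1 / 2))),
    mul_pos hC₀ (hsum.tsum_pos (fun _ => (Real.exp_pos _).le) 0 (Real.exp_pos _)), ?_⟩
  rintro K - w ⟨Cs, -, -, hsupp, -⟩ hw α β hα hβ hαβ
  have hs := (hsum.hasSum.mul_left C₀).mul_right (Real.exp (-K / 2))
  refine tsum_of_norm_bounded hs fun k => ?_
  split_ifs with hodd
  · by_cases hk : w k = 0
    · rw [hk, Complex.ofReal_zero, mul_zero, norm_zero]
      positivity
    · have hKk : K ≤ k := (hsupp (subset_tsupport w hk)).1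
      have hJ := norm_besselJ_mul_besselJ_le hodd.pos hα.le hβ.le
        (hαβ.imp (fun h => h.trans (by gcongr)) (fun h => h.trans (by gcongr)))
      rw [norm_mul, norm_mul, norm_mul, norm_pow, Complex.norm_I, one_pow, one_mul,
        Complex.norm_real, Real.norm_eq_abs]
      calc _ ≤ Real.exp (-k) * C₀ := by
            gcongr
            exact hw k
        _ ≤ (Real.exp (k * (-(1 / 2))) * Real.exp (-K / 2)) * C₀ := by
            rw [← Real.exp_add]
            gcongr
            linarith
        _ = _ := by ring
  · rw [norm_zero]
    positivity
end

section
/- Let ε ∈ (0, 1/10), let (C_j)_{j≥0} be positive constants, and let A₀ > 0. Then there exist C > 0 and K₀ ≥ 1 such that for all K ≥ K₀, every admissible weight w of level K with constants (C_j), and all reals α, β with K/100 ≤ α ≤ A₀·K^{2+ε}, K/100 ≤ β ≤ A₀·K^{1+ε}, and β/(4α) ≥ 1, one has |S(α, β)| ≤ C·K^{−1}. -/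
open Complex Real MeasureTheory Set

/-- The Bessel function of integer order. -/
noncomputable def besselInt (x : ℝ) (n : ℤ) : ℂ :=
  ∫ t in (-(1:ℝ)/2)..(1/2), e (n * t) * Complex.exp (-(Complex.I * x * Real.sin (2 * Real.pi * t)))

lemma besselInt_natCast (x : ℝ) (n : ℕ) : besselInt x n = besselJ n x := by
  simp [besselInt, besselJ]

lemma sum_norm_sq_besselInt_le (x : ℝ) (F : Finset ℤ) : ∑ n ∈ F, ‖besselInt x n‖ ^ 2 ≤ 1 := by
  have hab : (-(1:ℝ)/2) < 1/2 := by norm_num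
  set f : ℝ → ℂ := fun t => Complex.exp (-(Complex.I * x * Real.sin (2 * Real.pi * t))) with hf
  have hnorm : ∀ t, ‖f t‖ = 1 := by
    intro t
    have : f t = Complex.exp (((-(x * Real.sin (2 * Real.pi * t)) : ℝ) : ℂ) * Complex.I) := by
      simp only [hf]; congr 1; push_cast; ring
    rw [this, Complex.norm_exp_ofReal_mul_I]
  have hcont : Continuous f := by
    simp only [hf]; fun_prop
  have hL2 : MemLp f 2 (volume.restrict (Ioc (-(1:ℝ)/2) (1/2))) :=
    MemLp.of_bound hcont.aestronglyMeasurable 1 (Filter.Eventually.of_forall fun t => (hnorm t).le)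
  have h := hasSum_sq_fourierCoeffOn hab hL2
  have hval : ((1/2 : ℝ) - -(1:ℝ)/2)⁻¹ • ∫ t in (-(1:ℝ)/2)..(1/2), ‖f t‖ ^ 2 = 1 := by
    simp only [hnorm]; norm_num
  rw [hval] at h
  have hcoeff : ∀ n : ℤ, besselInt x n = fourierCoeffOn hab f (-n) := by
    intro n
    rw [fourierCoeffOn_eq_integral, besselInt]
    have h1 : (1 / ((1/2 : ℝ) - -(1:ℝ)/2)) = 1 := by norm_num
    rw [h1, one_smul]
    refine intervalIntegral.integral_congr fun t _ => ?_
    simp only [hf, e, neg_neg, smul_eq_mul]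
    rw [fourier_coe_apply]
    congr 2
    push_cast
    ring
  calc ∑ n ∈ F, ‖besselInt x n‖ ^ 2
      = ∑ n ∈ F.map (Equiv.neg ℤ).toEmbedding, ‖fourierCoeffOn hab f n‖ ^ 2 := by
        simp [hcoeff]
    _ ≤ 1 := sum_le_hasSum _ (fun _ _ => by positivity) h

lemma besselInt_recurrence {x : ℝ} (hx : x ≠ 0) (n : ℤ) :
    ((2 / x : ℝ) : ℂ) * n * besselInt x n = besselInt x (n + 1) + besselInt x (n - 1) := by
  set G : ℝ → ℂ := fun t =>
    e (n * t) * Complex.exp (-(Complex.I * x * Real.sin (2 * Real.pi * t))) with hG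
  set u : ℤ → ℝ → ℂ := fun m t =>
    e (m * t) * Complex.exp (-(Complex.I * x * Real.sin (2 * Real.pi * t))) with hu
  have hint : ∀ m, IntervalIntegrable (u m) volume (-(1:ℝ)/2) (1/2) := by
    intro m
    apply Continuous.intervalIntegrable
    simp only [hu, e]; fun_prop
  have hxC : (x : ℂ) ≠ 0 := by exact_mod_cast hx
  have hderiv : ∀ t, HasDerivAt G (2 * Real.pi * Complex.I * n * u n t
      - Real.pi * Complex.I * x * (u (n + 1) t + u (n - 1) t)) t := by
    intro t
    have h1 : HasDerivAt (fun t : ℝ => (2 * Real.pi * Complex.I * ((n * t : ℝ) : ℂ)))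
        (2 * Real.pi * Complex.I * ((n * 1 : ℝ) : ℂ)) t :=
      (((hasDerivAt_id t).const_mul (n : ℝ)).ofReal_comp).const_mul _
    have h2 : HasDerivAt (fun t : ℝ => -(Complex.I * x * ((Real.sin (2 * Real.pi * t) : ℝ) : ℂ)))
        (-(Complex.I * x * ((Real.cos (2 * Real.pi * t) * (2 * Real.pi * 1) : ℝ) : ℂ))) t :=
      (((((hasDerivAt_id t).const_mul (2 * Real.pi)).sin).ofReal_comp).const_mul _).neg
    have h3 := h1.cexp.mul h2.cexp
    refine h3.congr_deriv ?_
    simp only [hu, e]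
    have e1 : Complex.exp (2 * Real.pi * Complex.I * (((n + 1 : ℤ) : ℝ) * t : ℝ)) =
        Complex.exp (2 * Real.pi * Complex.I * ((n * t : ℝ) : ℂ)) *
          Complex.exp (2 * Real.pi * t * Complex.I) := by
      rw [← Complex.exp_add]; congr 1; push_cast; ring
    have e2 : Complex.exp (2 * Real.pi * Complex.I * (((n - 1 : ℤ) : ℝ) * t : ℝ)) =
        Complex.exp (2 * Real.pi * Complex.I * ((n * t : ℝ) : ℂ)) *
          Complex.exp (-(2 * Real.pi * t) * Complex.I) := by
      rw [← Complex.exp_add]; congr 1; push_cast; ring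
    have e3 := Complex.two_cos (2 * Real.pi * t)
    rw [e1, e2]
    push_cast
    linear_combination (-Real.pi * Complex.I * x *
      Complex.exp (2 * Real.pi * Complex.I * ((n * t : ℂ))) *
      Complex.exp (-(Complex.I * x * Complex.sin (2 * Real.pi * t)))) * e3
  have hI := intervalIntegral.integral_eq_sub_of_hasDerivAt (a := -(1:ℝ)/2) (b := 1/2)
    (fun t _ => hderiv t)
    (((hint n).const_mul _).sub (((hint (n+1)).add (hint (n-1))).const_mul _))
  have hper : G (1/2) = G (-(1:ℝ)/2) := by
    have s1 : (2 * Real.pi * (1/2) : ℝ) = Real.pi := by ring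
    have s2 : (2 * Real.pi * (-1/2) : ℝ) = -Real.pi := by ring
    have s3 : e (n * (1/2)) = e (n * (-1/2)) :=
      Complex.exp_eq_exp_iff_exists_int.2 ⟨n, by push_cast; ring⟩
    simp only [hG, s1, s2, s3, Real.sin_neg, Real.sin_pi, neg_zero]
  rw [hper, sub_self, intervalIntegral.integral_sub ((hint n).const_mul _)
    (((hint (n+1)).add (hint (n-1))).const_mul _), intervalIntegral.integral_const_mul,
    intervalIntegral.integral_const_mul, intervalIntegral.integral_add (hint _) (hint _)] at hI
  change 2 * Real.pi * Complex.I * n * besselInt x n -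
    Real.pi * Complex.I * x * (besselInt x (n + 1) + besselInt x (n - 1)) = 0 at hI
  have hp : (Real.pi * Complex.I * x : ℂ) ≠ 0 := by
    simp [Real.pi_ne_zero, hxC]
  apply mul_left_cancel₀ hp
  have hx2 : (x : ℂ) * ((2 / x : ℝ) : ℂ) = 2 := by
    push_cast; field_simp
  linear_combination hI + Real.pi * Complex.I * n * besselInt x n * hx2

/-- The character `k ↦ i ^ k` restricted to odd integers. -/
noncomputable def oddChar (k : ℤ) : ℂ := if Odd k then Complex.I ^ k else 0

lemma oddChar_add_two (k : ℤ) : oddChar (k + 2) = -oddChar k := by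
  have h : Odd (k + 2) ↔ Odd k := by
    simp [parity_simps]
  by_cases hk : Odd k
  · have : Complex.I ^ (k + 2) = Complex.I ^ k * Complex.I ^ (2 : ℕ) := by
      rw [zpow_add₀ Complex.I_ne_zero]; rfl
    simp [oddChar, h, hk, this]
  · simp [oddChar, h, hk]

lemma norm_oddChar_le (k : ℤ) : ‖oddChar k‖ ≤ 1 := by
  unfold oddChar; split_ifs <;> simp

/-- The bilinear sum of shifts of two sequences `a` and `b`, the second sampled at double speed,
against the weight `f` and the character `oddChar`. -/
noncomputable def twistedSum (a b : ℤ → ℂ) (f : ℤ → ℝ) (i j : ℤ) : ℂ :=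
  ∑' k : ℤ, (f k : ℂ) * (oddChar k * a (k + i) * b (2 * k + j))

section TwistedSum

variable {a b : ℤ → ℂ} {f g : ℤ → ℝ}

lemma summable_twistedSum (hf : f.HasFiniteSupport) (i j : ℤ) :
    Summable fun k : ℤ => (f k : ℂ) * (oddChar k * a (k + i) * b (2 * k + j)) := by
  refine summable_of_hasFiniteSupport (Set.Finite.subset hf fun k hk => ?_)
  contrapose! hk
  simp [Function.notMem_support.1 hk]

lemma twistedSum_add (hf : f.HasFiniteSupport) (hg : g.HasFiniteSupport) (i j : ℤ) :
    twistedSum a b (fun k => f k + g k) i j = twistedSum a b f i j + twistedSum a b g i j := by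
  unfold twistedSum
  rw [← (summable_twistedSum hf i j).tsum_add (summable_twistedSum hg i j)]
  exact tsum_congr fun k => by push_cast; ring

lemma twistedSum_const_mul (c : ℝ) (i j : ℤ) :
    twistedSum a b (fun k => c * f k) i j = c * twistedSum a b f i j := by
  unfold twistedSum
  rw [← tsum_mul_left]
  exact tsum_congr fun k => by push_cast; ring

lemma twistedSum_left_recurrence {ξ : ℝ}
    (ha : ∀ n : ℤ, (ξ : ℂ) * n * a n = a (n + 1) + a (n - 1))
    (hf : f.HasFiniteSupport) (i j : ℤ) :
    twistedSum a b (fun k => ξ * k * f k) i j =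
      twistedSum a b f (i + 1) j + twistedSum a b f (i - 1) j - ξ * i * twistedSum a b f i j := by
  unfold twistedSum
  rw [← (summable_twistedSum hf _ j).tsum_add (summable_twistedSum hf _ j), ← tsum_mul_left,
    ← ((summable_twistedSum hf _ j).add (summable_twistedSum hf _ j)).tsum_sub
      ((summable_twistedSum hf _ j).mul_left _)]
  refine tsum_congr fun k => ?_
  have h := ha (k + i)
  rw [add_sub_assoc, add_assoc] at h
  push_cast at h ⊢
  linear_combination (f k : ℂ) * oddChar k * b (2 * k + j) * h

lemma twistedSum_right_recurrence {η : ℝ}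
    (hb : ∀ n : ℤ, (η : ℂ) * n * b n = b (n + 1) + b (n - 1))
    (hf : f.HasFiniteSupport) (i j : ℤ) :
    twistedSum a b (fun k => 2 * η * k * f k) i j =
      twistedSum a b f i (j + 1) + twistedSum a b f i (j - 1) - η * j * twistedSum a b f i j := by
  unfold twistedSum
  rw [← (summable_twistedSum hf i _).tsum_add (summable_twistedSum hf i _), ← tsum_mul_left,
    ← ((summable_twistedSum hf i _).add (summable_twistedSum hf i _)).tsum_sub
      ((summable_twistedSum hf i _).mul_left _)]
  refine tsum_congr fun k => ?_
  have h := hb (2 * k + j)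
  rw [add_sub_assoc, add_assoc] at h
  push_cast at h ⊢
  linear_combination (f k : ℂ) * oddChar k * a (k + i) * h

lemma twistedSum_shift (i j : ℤ) :
    twistedSum a b (fun k => f (k + 2)) i j = -twistedSum a b f (i - 2) (j - 4) := by
  unfold twistedSum
  rw [← (Equiv.addRight (2 : ℤ)).tsum_eq (fun k : ℤ =>
    (f k : ℂ) * (oddChar k * a (k + (i - 2)) * b (2 * k + (j - 4)))), ← tsum_neg]
  refine tsum_congr fun k => ?_
  simp only [Equiv.coe_addRight, oddChar_add_two]
  rw [show k + 2 + (i - 2) = k + i by ring, show 2 * (k + 2) + (j - 4) = 2 * k + j by ring]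
  ring

lemma hasFiniteSupport_comp_add_two (hf : f.HasFiniteSupport) :
    (fun k => f (k + 2)).HasFiniteSupport :=
  Set.Finite.preimage (f := fun k : ℤ => k + 2) (add_left_injective 2).injOn hf

lemma hasFiniteSupport_diff (hf : f.HasFiniteSupport) :
    (fun k => f (k + 2) - f k).HasFiniteSupport :=
  Set.Finite.subset ((hasFiniteSupport_comp_add_two hf).union hf) (Function.support_sub _ _)

lemma twistedSum_diff (hf : f.HasFiniteSupport) (i j : ℤ) :
    twistedSum a b (fun k => f (k + 2) - f k) i j =
      -twistedSum a b f (i - 2) (j - 4) - twistedSum a b f i j := by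
  have h := twistedSum_add (a := a) (b := b) (hasFiniteSupport_diff hf) hf i j
  simp only [sub_add_cancel] at h
  rw [twistedSum_shift] at h
  rw [h]; ring

lemma norm_twistedSum_le (ha : ∀ F : Finset ℤ, ∑ n ∈ F, ‖a n‖ ^ 2 ≤ 1)
    (hb : ∀ F : Finset ℤ, ∑ n ∈ F, ‖b n‖ ^ 2 ≤ 1) (hf : f.HasFiniteSupport) {M : ℝ}
    (hM : ∀ k, |f k| ≤ M) (i j : ℤ) : ‖twistedSum a b f i j‖ ≤ M := by
  have hM0 : 0 ≤ M := (abs_nonneg _).trans (hM 0)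
  have hf' : (Function.support f).Finite := hf
  have hsupp : ∀ k ∉ hf'.toFinset,
      (f k : ℂ) * (oddChar k * a (k + i) * b (2 * k + j)) = 0 := by
    intro k hk
    rw [Set.Finite.mem_toFinset, Function.notMem_support] at hk
    simp [hk]
  unfold twistedSum
  rw [tsum_eq_sum hsupp]
  set F := hf'.toFinset
  have hA : ∑ k ∈ F, ‖a (k + i)‖ ^ 2 ≤ 1 := by
    have := ha (F.map (addRightEmbedding i))
    simpa using this
  have hB : ∑ k ∈ F, ‖b (2 * k + j)‖ ^ 2 ≤ 1 := by
    have := hb (F.map ⟨fun k => 2 * k + j, fun x y h => by simpa using h⟩)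
    rw [Finset.sum_map] at this
    exact this
  calc _ ≤ ∑ k ∈ F, ‖(f k : ℂ) * (oddChar k * a (k + i) * b (2 * k + j))‖ := norm_sum_le _ _
    _ ≤ ∑ k ∈ F, M * ((‖a (k + i)‖ ^ 2 + ‖b (2 * k + j)‖ ^ 2) / 2) := by
        refine Finset.sum_le_sum fun k _ => ?_
        rw [norm_mul, norm_mul, norm_mul, Complex.norm_real, Real.norm_eq_abs]
        have h1 := norm_oddChar_le k
        have h2 := two_mul_le_add_sq ‖a (k + i)‖ ‖b (2 * k + j)‖
        have h3 : ‖oddChar k‖ * ‖a (k + i)‖ * ‖b (2 * k + j)‖ ≤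
            1 * ‖a (k + i)‖ * ‖b (2 * k + j)‖ := by gcongr
        have h4 := hM k
        gcongr
        linarith
    _ = M * ((∑ k ∈ F, ‖a (k + i)‖ ^ 2 + ∑ k ∈ F, ‖b (2 * k + j)‖ ^ 2) / 2) := by
        rw [← Finset.mul_sum, ← Finset.sum_div, Finset.sum_add_distrib]
    _ ≤ M * 1 := by gcongr; linarith
    _ = M := mul_one M

end TwistedSum

lemma norm_add_sub_le_of_le {u v w : ℂ} {p q r : ℝ} (hu : ‖u‖ ≤ p) (hv : ‖v‖ ≤ q) (hw : ‖w‖ ≤ r) :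
    ‖u + v - w‖ ≤ p + q + r :=
  (norm_sub_le _ _).trans (add_le_add ((norm_add_le _ _).trans (add_le_add hu hv)) hw)

/-- Iterates of the recurrence `G (n + 1) j = G n (j + 1) + G n (j - 1) - η j G n j` are binomial
combinations of `G 0` up to an error of relative size `η`. -/
lemma norm_iterate_sub_le {G : ℕ → ℤ → ℂ} {η ρ N : ℝ} {R : ℤ} (hη : 0 ≤ η)
    (hρ : η * (R + 4) ≤ ρ) (hρ1 : ρ ≤ 1)
    (hG : ∀ n j, G (n + 1) j = G n (j + 1) + G n (j - 1) - η * j * G n j)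
    (hN : ∀ j : ℤ, |j| ≤ R + 4 → ‖G 0 j‖ ≤ N) {j : ℤ} (hj : |j| ≤ R) :
    ‖G 2 j - (G 0 (j + 2) + 2 * G 0 j + G 0 (j - 2))‖ ≤ 5 * ρ * N ∧
    ‖G 4 j - (G 0 (j + 4) + 4 * G 0 (j + 2) + 6 * G 0 j + 4 * G 0 (j - 2) + G 0 (j - 4))‖
      ≤ 65 * ρ * N := by
  have hN0 : 0 ≤ N := (norm_nonneg _).trans (hN j (by omega))
  have hmul : ∀ (n : ℕ) (j : ℤ) (M : ℝ), |j| ≤ R + 4 → ‖G n j‖ ≤ M →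
      ‖(η : ℂ) * j * G n j‖ ≤ ρ * M := by
    intro n j M hj hM
    have h1 : ‖(η : ℂ) * j‖ ≤ ρ := by
      rw [norm_mul, Complex.norm_real, Real.norm_eq_abs, abs_of_nonneg hη, Complex.norm_intCast]
      have : ((|j| : ℤ) : ℝ) ≤ R + 4 := by exact_mod_cast hj
      rw [Int.cast_abs] at this
      exact (mul_le_mul_of_nonneg_left this hη).trans hρ
    rw [norm_mul]
    exact mul_le_mul h1 hM (norm_nonneg _) ((norm_nonneg _).trans h1)
  have hstep : ∀ (n : ℕ) (m : ℤ) (M : ℝ), m ≤ R + 3 → 0 ≤ M →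
      (∀ j : ℤ, |j| ≤ m + 1 → ‖G n j‖ ≤ M) → ∀ j : ℤ, |j| ≤ m → ‖G (n + 1) j‖ ≤ 3 * M := by
    intro n m M hm hM0 hM j hj
    rw [hG]
    refine (norm_add_sub_le_of_le (hM (j + 1) (by rw [abs_le] at hj ⊢; omega))
        (hM (j - 1) (by rw [abs_le] at hj ⊢; omega))
      (hmul n j M (by omega) (hM j (by omega)))).trans ?_
    nlinarith
  have h1 := hstep 0 (R + 3) N (by omega) hN0 (fun j hj => hN j (by omega))
  have h2 := hstep 1 (R + 2) _ (by omega) (by positivity) (fun j hj => h1 j (by omega))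
  have h3 := hstep 2 (R + 1) _ (by omega) (by positivity) (fun j hj => h2 j (by omega))
  have e1 : ∀ j : ℤ, |j| ≤ R + 3 → ‖G 1 j - (G 0 (j + 1) + G 0 (j - 1))‖ ≤ ρ * N := by
    intro j hj
    have : G 1 j - (G 0 (j + 1) + G 0 (j - 1)) = -(η * j * G 0 j) := by rw [hG 0]; ring
    rw [this, norm_neg]
    exact hmul 0 j N (by omega) (hN j (by omega))
  have e2 : ∀ j : ℤ, |j| ≤ R + 2 →
      ‖G 2 j - (G 0 (j + 2) + 2 * G 0 j + G 0 (j - 2))‖ ≤ 5 * ρ * N := by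
    intro j hj
    have : G 2 j - (G 0 (j + 2) + 2 * G 0 j + G 0 (j - 2)) =
        (G 1 (j + 1) - (G 0 (j + 1 + 1) + G 0 (j + 1 - 1))) +
        (G 1 (j - 1) - (G 0 (j - 1 + 1) + G 0 (j - 1 - 1))) - η * j * G 1 j := by
      rw [hG 1]; ring_nf
    rw [this]
    refine (norm_add_sub_le_of_le (e1 _ (by rw [abs_le] at hj ⊢; omega))
        (e1 _ (by rw [abs_le] at hj ⊢; omega))
      (hmul 1 j _ (by omega) (h1 j (by omega)))).trans (le_of_eq (by ring))
  have e3 : ∀ j : ℤ, |j| ≤ R + 1 →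
      ‖G 3 j - (G 0 (j + 3) + 3 * G 0 (j + 1) + 3 * G 0 (j - 1) + G 0 (j - 3))‖
        ≤ 19 * ρ * N := by
    intro j hj
    have : G 3 j - (G 0 (j + 3) + 3 * G 0 (j + 1) + 3 * G 0 (j - 1) + G 0 (j - 3)) =
        (G 2 (j + 1) - (G 0 (j + 1 + 2) + 2 * G 0 (j + 1) + G 0 (j + 1 - 2))) +
        (G 2 (j - 1) - (G 0 (j - 1 + 2) + 2 * G 0 (j - 1) + G 0 (j - 1 - 2))) -
          η * j * G 2 j := by
      rw [hG 2]; ring_nf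
    rw [this]
    refine (norm_add_sub_le_of_le (e2 _ (by rw [abs_le] at hj ⊢; omega))
        (e2 _ (by rw [abs_le] at hj ⊢; omega))
      (hmul 2 j _ (by omega) (h2 j (by omega)))).trans (le_of_eq (by ring))
  refine ⟨e2 j (by omega), ?_⟩
  have : G 4 j - (G 0 (j + 4) + 4 * G 0 (j + 2) + 6 * G 0 j + 4 * G 0 (j - 2) + G 0 (j - 4)) =
      (G 3 (j + 1) - (G 0 (j + 1 + 3) + 3 * G 0 (j + 1 + 1) + 3 * G 0 (j + 1 - 1)
        + G 0 (j + 1 - 3))) +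
      (G 3 (j - 1) - (G 0 (j - 1 + 3) + 3 * G 0 (j - 1 + 1) + 3 * G 0 (j - 1 - 1)
        + G 0 (j - 1 - 3))) - η * j * G 3 j := by
    rw [hG 3]; ring_nf
  rw [this]
  refine (norm_add_sub_le_of_le (e3 _ (by rw [abs_le] at hj ⊢; omega))
        (e3 _ (by rw [abs_le] at hj ⊢; omega))
    (hmul 3 j _ (by omega) (h3 j (by omega)))).trans (le_of_eq (by ring))

/-- The multiplier measuring the failure of stationarity of the two recurrences. -/
def phaseGap (ξ η : ℝ) (k : ℤ) : ℝ := (ξ * k) ^ 2 - 4 * (2 * η * k) ^ 2 + (2 * η * k) ^ 4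

lemma norm_twistedSum_phaseGap_mul_le {a b : ℤ → ℂ} {g : ℤ → ℝ} {ξ η ρ N₁ N₂ : ℝ} {R : ℤ}
    (ha : ∀ n : ℤ, (ξ : ℂ) * n * a n = a (n + 1) + a (n - 1))
    (hb : ∀ n : ℤ, (η : ℂ) * n * b n = b (n + 1) + b (n - 1))
    (hξ : 0 ≤ ξ) (hη : 0 ≤ η) (hξρ : ξ * (R + 4) ≤ ρ) (hηρ : η * (R + 4) ≤ ρ) (hρ : ρ ≤ 1)
    (hg : g.HasFiniteSupport)
    (hN₁ : ∀ i j : ℤ, |i| ≤ R + 4 → |j| ≤ R + 4 → ‖twistedSum a b g i j‖ ≤ N₁)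
    (hN₂ : ∀ i j : ℤ, |i| ≤ R + 4 → |j| ≤ R + 4 →
      ‖twistedSum a b (fun k => g (k + 2) - g k) i j‖ ≤ N₂)
    {i j : ℤ} (hi : |i| ≤ R) (hj : |j| ≤ R) :
    ‖twistedSum a b (fun k => phaseGap ξ η k * g k) i j‖ ≤ 2 * N₂ + 90 * ρ * N₁ := by
  have hfin : ∀ (c : ℤ → ℝ), (fun k => c k * g k).HasFiniteSupport := fun c =>
    Set.Finite.subset hg (Function.support_mul_subset_right _ _)
  set A : ℕ → ℤ → ℂ := fun n i => twistedSum a b (fun k => (ξ * k) ^ n * g k) i j with hA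
  set B : ℕ → ℤ → ℂ := fun n j => twistedSum a b (fun k => (2 * η * k) ^ n * g k) i j with hB
  have hA0 : ∀ i, A 0 i = twistedSum a b g i j := by intro i; simp [hA]
  have hB0 : ∀ j, B 0 j = twistedSum a b g i j := by intro j; simp [hB]
  have hAs : ∀ n i, A (n + 1) i = A n (i + 1) + A n (i - 1) - ξ * i * A n i := by
    intro n i
    simp only [hA]
    rw [← twistedSum_left_recurrence ha (hfin fun k => (ξ * k) ^ n)]
    congr 1; ext k; ring
  have hBs : ∀ n j, B (n + 1) j = B n (j + 1) + B n (j - 1) - η * j * B n j := by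
    intro n j
    simp only [hB]
    rw [← twistedSum_right_recurrence hb (hfin fun k => (2 * η * k) ^ n)]
    congr 1; ext k; ring
  obtain ⟨hA2, -⟩ := norm_iterate_sub_le hξ hξρ hρ hAs
    (fun i' hi' => by rw [hA0]; exact hN₁ i' j hi' (by omega)) hi
  obtain ⟨hB2, hB4⟩ := norm_iterate_sub_le hη hηρ hρ hBs
    (fun j' hj' => by rw [hB0]; exact hN₁ i j' (by omega) hj') hj
  have hsplit : twistedSum a b (fun k => phaseGap ξ η k * g k) i j = A 2 i + (-4) * B 2 j + B 4 j := by
    have h1 := twistedSum_const_mul (a := a) (b := b) (f := fun k => (2 * η * k) ^ 2 * g k) (-4) i j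
    have h2 := twistedSum_add (a := a) (b := b) (hfin fun k => (ξ * k) ^ 2)
      (hfin fun k => -4 * (2 * η * k) ^ 2) i j
    have h3 := twistedSum_add (a := a) (b := b)
      (hfin fun k => (ξ * k) ^ 2 + -4 * (2 * η * k) ^ 2) (hfin fun k => (2 * η * k) ^ 4) i j
    have e1 : (fun k : ℤ => phaseGap ξ η k * g k) = fun k : ℤ =>
        ((ξ * k) ^ 2 + -4 * (2 * η * k) ^ 2) * g k + (2 * η * k) ^ 4 * g k := by
      ext k; unfold phaseGap; ring
    have e2 : (fun k : ℤ => ((ξ * k) ^ 2 + -4 * (2 * η * k) ^ 2) * g k) = fun k : ℤ =>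
        (ξ * k) ^ 2 * g k + -4 * (2 * η * k) ^ 2 * g k := by ext k; ring
    have e3 : (fun k : ℤ => -4 * (2 * η * k) ^ 2 * g k) = fun k : ℤ =>
        -4 * ((2 * η * k) ^ 2 * g k) := by ext k; ring
    rw [e1, h3, e2, h2, e3, h1]
    push_cast; rfl
  have hd1 := twistedSum_diff (a := a) (b := b) hg i (j + 4)
  have hd2 := twistedSum_diff (a := a) (b := b) hg (i + 2) j
  rw [add_sub_cancel_right] at hd1 hd2
  have hmain : A 2 i + (-4) * B 2 j + B 4 j =
      (A 2 i - (A 0 (i + 2) + 2 * A 0 i + A 0 (i - 2)))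
      - 4 * (B 2 j - (B 0 (j + 2) + 2 * B 0 j + B 0 (j - 2)))
      + (B 4 j - (B 0 (j + 4) + 4 * B 0 (j + 2) + 6 * B 0 j + 4 * B 0 (j - 2) + B 0 (j - 4)))
      + (-twistedSum a b (fun k => g (k + 2) - g k) i (j + 4)
        - twistedSum a b (fun k => g (k + 2) - g k) (i + 2) j) := by
    rw [hd1, hd2]
    simp only [hA0, hB0]
    ring
  rw [hsplit, hmain]
  refine (norm_add_le _ _).trans ?_
  have hb1 := norm_sub_le (-twistedSum a b (fun k => g (k + 2) - g k) i (j + 4))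
    (twistedSum a b (fun k => g (k + 2) - g k) (i + 2) j)
  rw [norm_neg] at hb1
  have hc1 := hN₂ i (j + 4) (by omega) (by rw [abs_le] at hj ⊢; omega)
  have hc2 := hN₂ (i + 2) j (by rw [abs_le] at hi ⊢; omega) (by omega)
  have hb2 : ‖(4 : ℂ) * (B 2 j - (B 0 (j + 2) + 2 * B 0 j + B 0 (j - 2)))‖ ≤ 4 * (5 * ρ * N₁) := by
    rw [norm_mul]; norm_num; linarith
  have hb3 := (norm_add_le _ _).trans (add_le_add ((norm_sub_le _ _).trans (add_le_add hA2 hb2)) hB4)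
  linarith

/-- `IsSymbol k₀ K r M f` says that on `[k₀, ∞)` the `s`-th iterated step-two difference of `f` is
bounded by `M * K ^ (-s)` for every `s ≤ r`. -/
def IsSymbol (k₀ : ℤ) (K : ℝ) : ℕ → ℝ → (ℤ → ℝ) → Prop
  | 0, M, f => ∀ k, k₀ ≤ k → |f k| ≤ M
  | r + 1, M, f => (∀ k, k₀ ≤ k → |f k| ≤ M) ∧ IsSymbol k₀ K r (M / K) (fun k => f (k + 2) - f k)

namespace IsSymbol

variable {k₀ : ℤ} {K M N : ℝ} {r : ℕ} {f g : ℤ → ℝ}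

lemma abs_le (h : IsSymbol k₀ K r M f) : ∀ k, k₀ ≤ k → |f k| ≤ M := by
  cases r with
  | zero => exact h
  | succ r => exact h.1

lemma nonneg (h : IsSymbol k₀ K r M f) : 0 ≤ M := (abs_nonneg _).trans (h.abs_le k₀ le_rfl)

lemma mono (hK : 0 < K) (hMN : M ≤ N) (h : IsSymbol k₀ K r M f) : IsSymbol k₀ K r N f := by
  induction r generalizing M N f with
  | zero => exact fun k hk => (h k hk).trans hMN
  | succ r ih => exact ⟨fun k hk => (h.1 k hk).trans hMN, ih (by gcongr) h.2⟩

lemma of_succ (h : IsSymbol k₀ K (r + 1) M f) : IsSymbol k₀ K r M f := by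
  induction r generalizing M f with
  | zero => exact h.1
  | succ r ih => exact ⟨h.1, ih h.2⟩

lemma shift (h : IsSymbol k₀ K r M f) : IsSymbol k₀ K r M (fun k => f (k + 2)) := by
  induction r generalizing M f with
  | zero => exact fun k hk => h _ (by omega)
  | succ r ih => exact ⟨fun k hk => h.1 _ (by omega), ih h.2⟩

lemma add (hf : IsSymbol k₀ K r M f) (hg : IsSymbol k₀ K r N g) :
    IsSymbol k₀ K r (M + N) (fun k => f k + g k) := by
  induction r generalizing M N f g with
  | zero => exact fun k hk => (abs_add_le _ _).trans (add_le_add (hf k hk) (hg k hk))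
  | succ r ih =>
    refine ⟨fun k hk => (abs_add_le _ _).trans (add_le_add (hf.1 k hk) (hg.1 k hk)), ?_⟩
    have h := ih hf.2 hg.2
    rw [← add_div] at h
    convert h using 2
    ring

lemma mul (hf : IsSymbol k₀ K r M f) (hg : IsSymbol k₀ K r N g) :
    IsSymbol k₀ K r (2 ^ r * (M * N)) (fun k => f k * g k) := by
  have hM := hf.nonneg
  have hN := hg.nonneg
  induction r generalizing M N f g with
  | zero =>
    intro k hk
    rw [abs_mul, pow_zero, one_mul]
    exact mul_le_mul (hf k hk) (hg k hk) (abs_nonneg _) hM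
  | succ r ih =>
    refine ⟨fun k hk => ?_, ?_⟩
    · rw [abs_mul]
      calc |f k| * |g k| ≤ M * N := mul_le_mul (hf.1 k hk) (hg.1 k hk) (abs_nonneg _) hM
        _ ≤ 2 ^ (r + 1) * (M * N) :=
          le_mul_of_one_le_left (by positivity) (one_le_pow₀ one_le_two)
    · have h1 := ih hf.2 hg.of_succ.shift hf.2.nonneg hN
      have h2 := ih hf.of_succ hg.2 hM hg.2.nonneg
      have h := h1.add h2
      convert h using 2
      · ring
      · ring

end IsSymbol

lemma isSymbol_of_contDiff {w : ℝ → ℝ} {k₀ : ℤ} {K : ℝ} {C : ℕ → ℝ} (hK : 0 < K)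
    (hC : ∀ j, 0 < C j) (hw : ContDiff ℝ (⊤ : ℕ∞) w)
    (hb : ∀ (j : ℕ) (x : ℝ), |iteratedDeriv j w x| ≤ C j * K ^ (-(j : ℤ))) :
    IsSymbol k₀ K 2 (C 0 + 2 * C 1 + 4 * C 2) (fun k => w k) := by
  have h0 := hC 0
  have h1 := hC 1
  have h2 := hC 2
  have hd0 : Differentiable ℝ w := hw.differentiable (by simp)
  have hd1 : Differentiable ℝ (deriv w) := by
    have := hw.differentiable_iteratedDeriv 1 (by norm_cast)
    rwa [iteratedDeriv_one] at this
  have b0 : ∀ x, |w x| ≤ C 0 := fun x => by simpa using hb 0 x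
  have b1 : ∀ x, |deriv w x| ≤ C 1 / K := fun x => by
    simpa [iteratedDeriv_one, div_eq_mul_inv] using hb 1 x
  have b2 : ∀ x, |deriv (deriv w) x| ≤ C 2 / K / K := fun x => by
    have := hb 2 x
    rw [iteratedDeriv_succ, iteratedDeriv_one] at this
    refine this.trans (le_of_eq ?_)
    rw [div_div, div_eq_mul_inv, ← pow_two]
    norm_cast
  have hmv : ∀ (u : ℝ → ℝ) (c : ℝ), Differentiable ℝ u → (∀ x, |deriv u x| ≤ c) →
      ∀ x, |u (x + 2) - u x| ≤ c * 2 := by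
    intro u c hu hc x
    have := convex_univ.norm_image_sub_le_of_norm_deriv_le (𝕜 := ℝ) (f := u) (C := c)
      (x := x) (y := x + 2) (fun x _ => hu x) (fun x _ => hc x) (Set.mem_univ _) (Set.mem_univ _)
    simpa using this
  have m1 := hmv w _ hd0 b1
  have hd3 : Differentiable ℝ (fun x => w (x + 2) - w x) :=
    (hd0.comp (differentiable_id.add_const 2)).sub hd0
  have m2 := hmv (fun x => w (x + 2) - w x) (C 2 / K / K * 2) hd3 (fun x => by
    have : HasDerivAt (fun x => w (x + 2) - w x) (deriv w (x + 2) - deriv w x) x :=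
      ((hd0 (x + 2)).hasDerivAt.comp_add_const x 2).sub (hd0 x).hasDerivAt
    rw [this.deriv]
    exact hmv (deriv w) _ hd1 b2 x)
  refine ⟨fun k _ => (b0 k).trans (by linarith), fun k _ => ?_, fun k _ => ?_⟩
  · have := m1 k
    push_cast
    refine this.trans ?_
    rw [div_mul_eq_mul_div]
    gcongr
    linarith
  · have := m2 k
    push_cast
    refine this.trans ?_
    rw [div_mul_eq_mul_div, div_mul_eq_mul_div, div_mul_eq_mul_div, div_mul_eq_mul_div]
    gcongr
    linarith

lemma abs_inv_diff_le {K H D₀ D₁ D₂ : ℝ} (hK1 : 1 ≤ K) (p₀ : 0 < D₀) (l₀ : D₀ ≤ D₁)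
    (l₁ : D₁ ≤ D₂) (d1 : (D₁ - D₀) * K ≤ 160 * D₀) (d2' : 0 ≤ D₂ - 2 * D₁ + D₀)
    (d2 : (D₂ - 2 * D₁ + D₀) * K ^ 2 ≤ 2000 * D₀) (q₁ : D₁⁻¹ ≤ H) :
    |D₁⁻¹ - D₀⁻¹| ≤ 160 * H / K ∧ |D₂⁻¹ - D₁⁻¹ - (D₁⁻¹ - D₀⁻¹)| ≤ 373200 * H / K / K := by
  have hK0 : 0 < K := by linarith
  have p₁ : 0 < D₁ := p₀.trans_le l₀
  have p₂ : 0 < D₂ := p₁.trans_le l₁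
  set δ := D₁ - D₀ with hδ
  set θ := D₂ - 2 * D₁ + D₀ with hθ
  have hδ0 : 0 ≤ δ := sub_nonneg.2 l₀
  have f1 : D₁⁻¹ - D₀⁻¹ = -(δ / (D₀ * D₁)) := by rw [hδ]; field_simp; ring
  have f2 : D₂⁻¹ - D₁⁻¹ - (D₁⁻¹ - D₀⁻¹) =
      (2 * δ ^ 2 + δ * θ - D₀ * θ) / (D₀ * D₁ * D₂) := by
    rw [hδ, hθ]; field_simp; ring
  constructor
  · rw [f1, abs_neg, abs_of_nonneg (by positivity), le_div_iff₀ hK0]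
    calc δ / (D₀ * D₁) * K = δ * K / (D₀ * D₁) := by ring
      _ ≤ 160 * D₀ / (D₀ * D₁) := by gcongr
      _ = 160 * D₁⁻¹ := by field_simp
      _ ≤ 160 * H := by gcongr
  · rw [f2, abs_div, abs_of_pos (a := D₀ * D₁ * D₂) (by positivity), le_div_iff₀ hK0,
      le_div_iff₀ hK0]
    have hn : |2 * δ ^ 2 + δ * θ - D₀ * θ| * K ^ 2 ≤ 373200 * D₀ ^ 2 := by
      have g1 : |2 * δ ^ 2 + δ * θ - D₀ * θ| ≤ 2 * δ ^ 2 + δ * θ + D₀ * θ := by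
        have n1 : 0 ≤ δ * θ := mul_nonneg hδ0 d2'
        have n2 : 0 ≤ D₀ * θ := mul_nonneg p₀.le d2'
        have n3 : 0 ≤ δ ^ 2 := sq_nonneg δ
        rw [abs_le]
        constructor <;> linarith
      have g2 : (δ * K) ^ 2 ≤ (160 * D₀) ^ 2 := by gcongr
      have g3 : δ * (θ * K ^ 2) ≤ (160 * D₀) * (2000 * D₀) := by
        exact mul_le_mul ((le_mul_of_one_le_right hδ0 hK1).trans d1) d2 (by positivity) (by positivity)
      have g4 : D₀ * (θ * K ^ 2) ≤ D₀ * (2000 * D₀) := by gcongr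
      calc _ ≤ (2 * δ ^ 2 + δ * θ + D₀ * θ) * K ^ 2 := by gcongr
        _ = 2 * (δ * K) ^ 2 + δ * (θ * K ^ 2) + D₀ * (θ * K ^ 2) := by ring
        _ ≤ 2 * (160 * D₀) ^ 2 + (160 * D₀) * (2000 * D₀) + D₀ * (2000 * D₀) := by gcongr
        _ = 373200 * D₀ ^ 2 := by ring
    calc |2 * δ ^ 2 + δ * θ - D₀ * θ| / (D₀ * D₁ * D₂) * K * K
        = |2 * δ ^ 2 + δ * θ - D₀ * θ| * K ^ 2 / (D₀ * D₁ * D₂) := by ring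
      _ ≤ 373200 * D₀ ^ 2 / (D₀ * D₁ * D₂) := by gcongr
      _ ≤ 373200 * D₀ ^ 2 / (D₀ * D₀ * D₁) := by gcongr
      _ = 373200 * D₁⁻¹ := by field_simp
      _ ≤ 373200 * H := by gcongr

lemma isSymbol_inv_phaseGap {ξ η K : ℝ} {k₀ : ℤ} (hη : 0 < η) (hξ : 4 * η ≤ ξ) (hK : 2 ≤ K)
    (hk₀ : K / 2 ≤ k₀) :
    IsSymbol k₀ K 2 (373200 * (1 / (η * K) ^ 4)) (fun k => (phaseGap ξ η k)⁻¹) := by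
  set A := ξ ^ 2 - 16 * η ^ 2 with hA
  set B := 16 * η ^ 4 with hB
  have hA0 : 0 ≤ A := by rw [hA]; nlinarith
  have hB0 : 0 < B := by rw [hB]; positivity
  have hD : ∀ k : ℤ, phaseGap ξ η k = A * k ^ 2 + B * k ^ 4 := by
    intro k; rw [hA, hB, phaseGap]; ring
  set H := 1 / (η * K) ^ 4 with hH
  have hH0 : 0 < H := by positivity
  have key : ∀ t : ℝ, K / 2 ≤ t →
      0 < A * t ^ 2 + B * t ^ 4 ∧ (A * t ^ 2 + B * t ^ 4)⁻¹ ≤ H ∧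
      A * t ^ 2 + B * t ^ 4 ≤ A * (t + 2) ^ 2 + B * (t + 2) ^ 4 := by
    intro t ht
    have ht1 : 1 ≤ t := by linarith
    refine ⟨by positivity, ?_, ?_⟩
    · rw [hH, ← one_div]
      apply one_div_le_one_div_of_le (by positivity)
      have : (K / 2) ^ 4 ≤ t ^ 4 := by gcongr
      calc (η * K) ^ 4 = B * (K / 2) ^ 4 := by rw [hB]; ring
        _ ≤ B * t ^ 4 := by gcongr
        _ ≤ _ := by nlinarith [sq_nonneg t, mul_nonneg hA0 (sq_nonneg t)]
    · gcongr <;> linarith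
  have main : ∀ t : ℝ, K / 2 ≤ t → ∀ D₀ D₁ D₂ : ℝ, D₀ = A * t ^ 2 + B * t ^ 4 →
      D₁ = A * (t + 2) ^ 2 + B * (t + 2) ^ 4 → D₂ = A * (t + 4) ^ 2 + B * (t + 4) ^ 4 →
      |D₁⁻¹ - D₀⁻¹| ≤ 160 * H / K ∧ |D₂⁻¹ - D₁⁻¹ - (D₁⁻¹ - D₀⁻¹)| ≤ 373200 * H / K / K := by
    intro t ht D₀ D₁ D₂ e₀ e₁ e₂
    have ht1 : 1 ≤ t := by linarith
    have hK0 : 0 < K := by linarith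
    obtain ⟨p₀, q₀, l₀⟩ := key t ht
    obtain ⟨p₁, q₁, l₁⟩ := key (t + 2) (by linarith)
    rw [show t + 2 + 2 = t + 4 by ring] at l₁
    rw [← e₀] at p₀ q₀
    rw [← e₀, ← e₁] at l₀
    rw [← e₁] at p₁ q₁
    rw [← e₁, ← e₂] at l₁
    have t2 : 1 ≤ t ^ 2 := one_le_pow₀ ht1
    have t21 : t ≤ t ^ 2 := by nlinarith
    have t32 : t ^ 2 ≤ t ^ 3 := pow_le_pow_right₀ ht1 (by norm_num)
    have t43 : t ^ 3 ≤ t ^ 4 := pow_le_pow_right₀ ht1 (by norm_num)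
    have d1 : (D₁ - D₀) * K ≤ 160 * D₀ := by
      have h1 : (D₁ - D₀) * K ≤ (D₁ - D₀) * (2 * t) := by
        apply mul_le_mul_of_nonneg_left <;> linarith
      have h2 : (D₁ - D₀) * (2 * t) = A * (8 * t ^ 2 + 8 * t) +
          B * (16 * t ^ 4 + 48 * t ^ 3 + 64 * t ^ 2 + 32 * t) := by rw [e₀, e₁]; ring
      have h3 : A * (8 * t ^ 2 + 8 * t) ≤ A * (160 * t ^ 2) := by gcongr; linarith
      have h4 : B * (16 * t ^ 4 + 48 * t ^ 3 + 64 * t ^ 2 + 32 * t) ≤ B * (160 * t ^ 4) := by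
        gcongr; linarith
      rw [e₀] at h1 h2 ⊢; linarith
    have d2 : (D₂ - 2 * D₁ + D₀) * K ^ 2 ≤ 2000 * D₀ := by
      have h0 : D₂ - 2 * D₁ + D₀ = A * 8 + B * (48 * t ^ 2 + 192 * t + 224) := by
        rw [e₀, e₁, e₂]; ring
      have h1 : (D₂ - 2 * D₁ + D₀) * K ^ 2 ≤ (D₂ - 2 * D₁ + D₀) * (2 * t) ^ 2 := by
        apply mul_le_mul_of_nonneg_left
        · gcongr; linarith
        · rw [h0]; positivity
      have h2 : (D₂ - 2 * D₁ + D₀) * (2 * t) ^ 2 = A * (32 * t ^ 2) +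
          B * (192 * t ^ 4 + 768 * t ^ 3 + 896 * t ^ 2) := by rw [h0]; ring
      have h3 : A * (32 * t ^ 2) ≤ A * (2000 * t ^ 2) := by gcongr; linarith
      have h4 : B * (192 * t ^ 4 + 768 * t ^ 3 + 896 * t ^ 2) ≤ B * (2000 * t ^ 4) := by
        gcongr; linarith
      rw [e₀] at h1 h2 ⊢; linarith
    have d2' : 0 ≤ D₂ - 2 * D₁ + D₀ := by
      have : D₂ - 2 * D₁ + D₀ = A * 8 + B * (48 * t ^ 2 + 192 * t + 224) := by
        rw [e₀, e₁, e₂]; ring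
      rw [this]; positivity
    exact abs_inv_diff_le (by linarith) p₀ l₀ l₁ d1 d2' d2 q₁
  have hk : ∀ k : ℤ, k₀ ≤ k → K / 2 ≤ k := fun k hk => hk₀.trans (by exact_mod_cast hk)
  have hK0 : 0 < K := by linarith
  refine ⟨fun k h => ?_, fun k h => ?_, fun k h => ?_⟩
  · obtain ⟨p, q, -⟩ := key k (hk k h)
    simp only [hD]
    rw [abs_of_pos (inv_pos.2 p)]
    linarith
  · have := (main k (hk k h) _ _ _ rfl rfl rfl).1
    simp only [hD]
    push_cast
    refine this.trans ?_
    gcongr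
    norm_num
  · have := (main k (hk k h) _ _ _ rfl rfl rfl).2
    simp only [hD]
    push_cast
    rw [show (k : ℝ) + 2 + 2 = k + 4 by ring]
    exact this

lemma phaseGap_pos {ξ η : ℝ} {k : ℤ} (hη : 0 < η) (hξ : 4 * η ≤ ξ) (hk : 0 < k) :
    0 < phaseGap ξ η k := by
  have hk' : (0 : ℝ) < k := by exact_mod_cast hk
  have : phaseGap ξ η k = (ξ ^ 2 - 16 * η ^ 2) * k ^ 2 + 16 * η ^ 4 * k ^ 4 := by
    rw [phaseGap]; ring
  have h : 0 ≤ ξ ^ 2 - 16 * η ^ 2 := by nlinarith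
  rw [this]; positivity

section Cancellation

variable {a b : ℤ → ℂ} {ξ η K H M : ℝ} {k₀ : ℤ} {f : ℤ → ℝ}

lemma norm_twistedSum_le_of_isSymbol_one
    (ha : ∀ n : ℤ, (ξ : ℂ) * n * a n = a (n + 1) + a (n - 1))
    (hb : ∀ n : ℤ, (η : ℂ) * n * b n = b (n + 1) + b (n - 1))
    (ha2 : ∀ F : Finset ℤ, ∑ n ∈ F, ‖a n‖ ^ 2 ≤ 1) (hb2 : ∀ F : Finset ℤ, ∑ n ∈ F, ‖b n‖ ^ 2 ≤ 1)
    (hη : 0 < η) (hξ : 4 * η ≤ ξ) (hξK : ξ ≤ 16 / K) (hK : 144 ≤ K) (hk₀ : 0 < k₀)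
    (hH : IsSymbol k₀ K 1 H (fun k => (phaseGap ξ η k)⁻¹))
    (hf : IsSymbol k₀ K 1 M f) (hfin : f.HasFiniteSupport) (hf0 : ∀ k, k < k₀ + 2 → f k = 0)
    {i j : ℤ} (hi : |i| ≤ 5) (hj : |j| ≤ 5) :
    ‖twistedSum a b f i j‖ ≤ 26000 * (M * H) / K := by
  have hK0 : 0 < K := by linarith
  have hMH : 0 ≤ M * H := mul_nonneg hf.nonneg hH.nonneg
  set g : ℤ → ℝ := fun k => f k * (phaseGap ξ η k)⁻¹ with hg
  have hgS : IsSymbol k₀ K 1 (2 ^ 1 * (M * H)) g := hf.mul hH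
  have hg0 : ∀ k, k < k₀ + 2 → g k = 0 := fun k hk => by simp [hg, hf0 k hk]
  have hgfin : g.HasFiniteSupport := Set.Finite.subset hfin (Function.support_mul_subset_left _ _)
  have hfg : f = fun k => phaseGap ξ η k * g k := by
    ext k
    rcases lt_or_ge k (k₀ + 2) with hk | hk
    · simp [hf0 k hk, hg0 k hk]
    · have := (phaseGap_pos hη hξ (by omega : 0 < k)).ne'
      simp only [hg]
      field_simp
  have hρ : ξ * ((5 : ℤ) + 4) ≤ 144 / K := by
    push_cast
    calc ξ * (5 + 4) ≤ 16 / K * (5 + 4) := by gcongr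
      _ = 144 / K := by ring
  have hρη : η * ((5 : ℤ) + 4) ≤ 144 / K := by
    refine le_trans ?_ hρ
    gcongr
    linarith
  have hb0 : ∀ k, |g k| ≤ 2 * (M * H) := by
    intro k
    rcases lt_or_ge k (k₀ + 2) with hk | hk
    · rw [hg0 k hk, abs_zero]; positivity
    · simpa using hgS.1 k (by omega)
  have hb1 : ∀ k, |g (k + 2) - g k| ≤ 2 * (M * H) / K := by
    intro k
    rcases lt_or_ge k k₀ with hk | hk
    · rw [hg0 k (by omega), hg0 (k + 2) (by omega), sub_zero, abs_zero]; positivity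
    · simpa using hgS.2 k hk
  rw [hfg]
  refine (norm_twistedSum_phaseGap_mul_le ha hb (by linarith) hη.le hρ hρη
    ((div_le_one hK0).2 hK) hgfin
    (fun i j _ _ => norm_twistedSum_le ha2 hb2 hgfin hb0 i j)
    (fun i j _ _ => norm_twistedSum_le ha2 hb2 (hasFiniteSupport_diff hgfin) hb1 i j) hi hj).trans ?_
  calc 2 * (2 * (M * H) / K) + 90 * (144 / K) * (2 * (M * H)) = 25924 * (M * H) / K := by ring
    _ ≤ _ := by gcongr; norm_num

lemma norm_twistedSum_le_of_isSymbol_two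
    (ha : ∀ n : ℤ, (ξ : ℂ) * n * a n = a (n + 1) + a (n - 1))
    (hb : ∀ n : ℤ, (η : ℂ) * n * b n = b (n + 1) + b (n - 1))
    (ha2 : ∀ F : Finset ℤ, ∑ n ∈ F, ‖a n‖ ^ 2 ≤ 1) (hb2 : ∀ F : Finset ℤ, ∑ n ∈ F, ‖b n‖ ^ 2 ≤ 1)
    (hη : 0 < η) (hξ : 4 * η ≤ ξ) (hξK : ξ ≤ 16 / K) (hK : 144 ≤ K) (hk₀ : 0 < k₀)
    (hH : IsSymbol k₀ K 2 H (fun k => (phaseGap ξ η k)⁻¹))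
    (hf : IsSymbol k₀ K 2 M f) (hfin : f.HasFiniteSupport) (hf0 : ∀ k, k < k₀ + 4 → f k = 0)
    {i j : ℤ} (hi : |i| ≤ 1) (hj : |j| ≤ 1) :
    ‖twistedSum a b f i j‖ ≤ 2000000000 * (M * H ^ 2) / K ^ 2 := by
  have hK0 : 0 < K := by linarith
  have hM0 := hf.nonneg
  have hH0 := hH.nonneg
  set g : ℤ → ℝ := fun k => f k * (phaseGap ξ η k)⁻¹ with hg
  have hgS : IsSymbol k₀ K 2 (2 ^ 2 * (M * H)) g := hf.mul hH
  have hg0 : ∀ k, k < k₀ + 4 → g k = 0 := fun k hk => by simp [hg, hf0 k hk]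
  have hgfin : g.HasFiniteSupport := Set.Finite.subset hfin (Function.support_mul_subset_left _ _)
  have hfg : f = fun k => phaseGap ξ η k * g k := by
    ext k
    rcases lt_or_ge k (k₀ + 4) with hk | hk
    · simp [hf0 k hk, hg0 k hk]
    · have := (phaseGap_pos hη hξ (by omega : 0 < k)).ne'
      simp only [hg]
      field_simp
  have hρ : ξ * ((1 : ℤ) + 4) ≤ 144 / K := by
    push_cast
    calc ξ * (1 + 4) ≤ 16 / K * (1 + 4) := by gcongr
      _ = 80 / K := by ring
      _ ≤ 144 / K := by gcongr; norm_num
  have hρη : η * ((1 : ℤ) + 4) ≤ 144 / K := by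
    refine le_trans ?_ hρ
    gcongr
    linarith
  have hN₁ : ∀ i j : ℤ, |i| ≤ 1 + 4 → |j| ≤ 1 + 4 → ‖twistedSum a b g i j‖ ≤
      26000 * ((2 ^ 2 * (M * H)) * H) / K := fun i j hi hj =>
    norm_twistedSum_le_of_isSymbol_one ha hb ha2 hb2 hη hξ hξK hK hk₀ hH.of_succ hgS.of_succ hgfin
      (fun k hk => hg0 k (by omega)) hi hj
  have hN₂ : ∀ i j : ℤ, |i| ≤ 1 + 4 → |j| ≤ 1 + 4 →
      ‖twistedSum a b (fun k => g (k + 2) - g k) i j‖ ≤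
      26000 * ((2 ^ 2 * (M * H)) / K * H) / K := fun i j hi hj =>
    norm_twistedSum_le_of_isSymbol_one ha hb ha2 hb2 hη hξ hξK hK hk₀ hH.of_succ hgS.2
      (hasFiniteSupport_diff hgfin)
      (fun k hk => by rw [hg0 k (by omega), hg0 (k + 2) (by omega), sub_zero]) hi hj
  rw [hfg]
  refine (norm_twistedSum_phaseGap_mul_le ha hb (by linarith) hη.le hρ hρη
    ((div_le_one hK0).2 hK) hgfin hN₁ hN₂ hi hj).trans ?_
  calc 2 * (26000 * ((2 ^ 2 * (M * H)) / K * H) / K) +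
        90 * (144 / K) * (26000 * ((2 ^ 2 * (M * H)) * H) / K)
      = 1348048000 * (M * H ^ 2) / K ^ 2 := by field_simp; ring
    _ ≤ _ := by gcongr; norm_num

end Cancellation

lemma Ssum_eq_twistedSum {w : ℝ → ℝ} (hw : ∀ x ≤ 0, w x = 0) (α β : ℝ) :
    Ssum w α β = twistedSum (besselInt (4 * Real.pi * α)) (besselInt (4 * Real.pi * β))
      (fun k => w k) 0 (-1) := by
  unfold Ssum twistedSum
  rw [← (Nat.cast_injective (R := ℤ)).tsum_eq]
  · refine tsum_congr fun k => ?_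
    by_cases hk : Odd k
    · have h1 : 1 ≤ k := hk.pos
      have h2 : ((2 * k - 1 : ℕ) : ℤ) = 2 * (k : ℤ) + -1 := by omega
      have h3 : Odd (k : ℤ) := by exact_mod_cast hk
      rw [← besselInt_natCast, ← besselInt_natCast, h2]
      simp only [hk, oddChar, h3, if_true, add_zero, zpow_natCast, Int.cast_natCast]
      ring
    · have h3 : ¬ Odd (k : ℤ) := by exact_mod_cast hk
      simp [hk, oddChar, h3]
  · intro k hk
    by_contra hneg
    apply hk
    have : k ≤ 0 := by
      by_contra h
      exact hneg ⟨k.toNat, by simp; omega⟩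
    have h0 : w k = 0 := hw _ (by exact_mod_cast this)
    simp [h0]

theorem stmt2 (ε : ℝ) (hε : ε ∈ Set.Ioo (0:ℝ) (1/10)) (C : ℕ → ℝ) (hC : ∀ j, 0 < C j)
    (A₀ : ℝ) (hA₀ : 0 < A₀) :
    ∃ (Cb K₀ : ℝ), 0 < Cb ∧ 1 ≤ K₀ ∧
      ∀ K : ℝ, K₀ ≤ K → ∀ w : ℝ → ℝ, Admissible K C w →
      ∀ α β : ℝ, K / 100 ≤ α → α ≤ A₀ * K ^ (2 + ε) → K / 100 ≤ β → β ≤ A₀ * K ^ (1 + ε) →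
      (1 : ℝ) ≤ β / (4 * α) →
      ‖Ssum w α β‖ ≤ Cb * K⁻¹ := by
  set M₀ := C 0 + 2 * C 1 + 4 * C 2 with hM₀
  have hM₀pos : 0 < M₀ := by
    have h0 := hC 0
    have h1 := hC 1
    have h2 := hC 2
    positivity
  refine ⟨2000000000 * (M₀ * (373200 * (2 * Real.pi * A₀) ^ 4) ^ 2), 144, by positivity, by norm_num,
    fun K hK w hw α β hα _ hβ hβ' hαβ => ?_⟩
  obtain ⟨hsmooth, hsupp, hbound⟩ := hw
  have hK0 : 0 < K := by linarith
  have hα0 : 0 < α := by linarith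
  have hβ0 : 0 < β := by linarith
  have hpi := Real.pi_gt_d2
  rw [one_le_div (by positivity)] at hαβ
  have hw0 : ∀ x, w x ≠ 0 → K ≤ x ∧ x ≤ 2 * K := fun x hx => hsupp (subset_tsupport w hx)
  have hw0' : ∀ x < K, w x = 0 := fun x hx => by
    by_contra h
    linarith [(hw0 x h).1]
  rw [Ssum_eq_twistedSum fun x hx => hw0' x (by linarith)]
  set x := 4 * Real.pi * α with hx
  set y := 4 * Real.pi * β with hy
  have hx0 : 0 < x := by positivity
  have hy0 : 0 < y := by positivity
  have hxy : 4 * x ≤ y := by rw [hx, hy]; nlinarith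
  set k₀ : ℤ := ⌈K / 2⌉ with hk₀
  have hk₀K : K / 2 ≤ k₀ := Int.le_ceil _
  have hk₀K' : (k₀ : ℝ) < K / 2 + 1 := Int.ceil_lt_add_one _
  have hk₀pos : 0 < k₀ := Int.ceil_pos.2 (by positivity)
  have hξη : 4 * (2 / y) ≤ 2 / x := by
    rw [← mul_div_assoc, div_le_div_iff₀ hy0 hx0]
    linarith
  have hξK : 2 / x ≤ 16 / K := by
    rw [div_le_div_iff₀ hx0 hK0, hx]
    nlinarith
  have hfin : (fun k : ℤ => w k).HasFiniteSupport := by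
    refine Set.Finite.subset (Set.finite_Icc ⌈K⌉ ⌊2 * K⌋) fun k hk => ?_
    obtain ⟨h1, h2⟩ := hw0 k hk
    exact ⟨Int.ceil_le.2 h1, Int.le_floor.2 h2⟩
  have hzero : ∀ k : ℤ, k < k₀ + 4 → w k = 0 := fun k hk => by
    apply hw0'
    have : (k : ℝ) < k₀ + 4 := by exact_mod_cast hk
    linarith
  refine (norm_twistedSum_le_of_isSymbol_two (i := 0) (j := -1)
    (besselInt_recurrence hx0.ne') (besselInt_recurrence hy0.ne')
    (sum_norm_sq_besselInt_le x) (sum_norm_sq_besselInt_le y) (by positivity) hξη hξK hK hk₀pos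
    (isSymbol_inv_phaseGap (by positivity) hξη (by linarith) hk₀K)
    (isSymbol_of_contDiff hK0 hC hsmooth hbound) hfin hzero (by norm_num) (by norm_num)).trans ?_
  have hy_le : 1 / (2 / y * K) ≤ 2 * Real.pi * A₀ * K ^ ε := by
    have h1 : 1 / (2 / y * K) = 2 * Real.pi * β / K := by rw [hy]; field_simp; ring
    rw [h1, div_le_iff₀ hK0]
    calc 2 * Real.pi * β ≤ 2 * Real.pi * (A₀ * K ^ (1 + ε)) := by gcongr
      _ = 2 * Real.pi * A₀ * K ^ ε * K := by
        rw [add_comm, Real.rpow_add_one hK0.ne']; ring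
  have hH : 1 / (2 / y * K) ^ 4 ≤ (2 * Real.pi * A₀) ^ 4 * (K ^ ε) ^ 4 := by
    rw [← mul_pow, ← one_div_pow]
    gcongr
  have hKε : (K ^ ε) ^ 8 ≤ K := by
    rw [← Real.rpow_natCast, ← Real.rpow_mul hK0.le]
    calc K ^ (ε * (8 : ℕ)) ≤ K ^ (1 : ℝ) :=
          Real.rpow_le_rpow_of_exponent_le (by linarith) (by push_cast; linarith [hε.2])
      _ = K := Real.rpow_one K
  calc 2000000000 * (M₀ * (373200 * (1 / (2 / y * K) ^ 4)) ^ 2) / K ^ 2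
      ≤ 2000000000 * (M₀ * (373200 * ((2 * Real.pi * A₀) ^ 4 * (K ^ ε) ^ 4)) ^ 2) / K ^ 2 := by
        gcongr
    _ = 2000000000 * (M₀ * (373200 * (2 * Real.pi * A₀) ^ 4) ^ 2) * (K ^ ε) ^ 8 / K ^ 2 := by ring
    _ ≤ 2000000000 * (M₀ * (373200 * (2 * Real.pi * A₀) ^ 4) ^ 2) * K / K ^ 2 := by gcongr
    _ = 2000000000 * (M₀ * (373200 * (2 * Real.pi * A₀) ^ 4) ^ 2) * K⁻¹ := by field_simp
end

section
/- For every positive integer n, Σ_{h=1,…,n, gcd(h,n)=1} Σ_{a=0}^{n−1} e(h·a²/n) equals φ(n)·√n if n is a perfect square, and equals 0 otherwise, where φ is Euler's totient function. -/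
open Complex Real

/-- The quadratic Gauss sum modulo `n` at `h`, divided by `n`. -/
noncomputable def normalizedGaussSum (n h : ℕ) : ℂ :=
  (∑ a ∈ Finset.range n, e ((h * a ^ 2 : ℕ) / (n : ℝ))) / n

lemma e_natCast_div (n k : ℕ) : e ((k : ℝ) / n) = Complex.exp (2 * Real.pi * Complex.I / n) ^ k := by
  rw [e, ← Complex.exp_nat_mul]
  congr 1
  push_cast
  ring

lemma e_natCast_div_add_mul {n : ℕ} (hn : n ≠ 0) (k l : ℕ) :
    e (((k + n * l : ℕ) : ℝ) / n) = e ((k : ℝ) / n) := by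
  rw [e_natCast_div, e_natCast_div, pow_add, pow_mul,
    (Complex.isPrimitiveRoot_exp n hn).pow_eq_one, one_pow, mul_one]

lemma sum_e_natCast_div {n : ℕ} (hn : n ≠ 0) (k : ℕ) :
    ∑ h ∈ Finset.Icc 1 n, e ((h * k : ℕ) / (n : ℝ)) = if n ∣ k then (n : ℂ) else 0 := by
  have hζ := Complex.isPrimitiveRoot_exp n hn
  set x := Complex.exp (2 * Real.pi * Complex.I / n) ^ k with hx
  have hterm (h : ℕ) : e ((h * k : ℕ) / (n : ℝ)) = x ^ h := by
    rw [e_natCast_div, hx, ← pow_mul, mul_comm h k]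
  have hxn : x ^ n = 1 := by rw [hx, ← pow_mul, mul_comm k n, pow_mul, hζ.pow_eq_one, one_pow]
  simp_rw [hterm]
  split_ifs with hk
  · have hx1 : x = 1 := hζ.pow_eq_one_iff_dvd k |>.mpr hk
    simp [hx1]
  · have hx1 : x ≠ 1 := fun h ↦ hk (hζ.pow_eq_one_iff_dvd k |>.mp h)
    have hgeom : ∑ h ∈ Finset.range n, x ^ h = 0 := by
      rw [geom_sum_eq hx1, hxn, sub_self, zero_div]
    rw [← Finset.Ico_add_one_right_eq_Icc, Finset.sum_Ico_eq_sum_range, Nat.add_sub_cancel]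
    simp_rw [pow_add]
    rw [← Finset.mul_sum, hgeom, mul_zero]

lemma sum_range_mul_of_periodic {M : Type*} [AddCommMonoid M] {f : ℕ → M} {m : ℕ}
    (hf : Function.Periodic f m) (d : ℕ) :
    ∑ a ∈ Finset.range (d * m), f a = d • ∑ a ∈ Finset.range m, f a := by
  induction d with
  | zero => simp
  | succ d ih =>
    rw [Nat.succ_mul, Finset.sum_range_add, ih, succ_nsmul]
    congr 1
    refine Finset.sum_congr rfl fun a _ ↦ ?_
    rw [add_comm]
    exact hf.nat_mul d a

lemma normalizedGaussSum_mul {d m : ℕ} (hd : d ≠ 0) (hm : m ≠ 0) (h : ℕ) :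
    normalizedGaussSum (d * m) (d * h) = normalizedGaussSum m h := by
  have hdR : (d : ℝ) ≠ 0 := mod_cast hd
  have hdC : (d : ℂ) ≠ 0 := mod_cast hd
  have hterm (a : ℕ) : e ((d * h * a ^ 2 : ℕ) / ((d * m : ℕ) : ℝ)) =
      e ((h * a ^ 2 : ℕ) / (m : ℝ)) := by
    rw [mul_assoc, Nat.cast_mul, Nat.cast_mul d m, mul_div_mul_left _ _ hdR]
  have hper : Function.Periodic (fun a : ℕ ↦ e ((h * a ^ 2 : ℕ) / (m : ℝ))) m := fun a ↦ by
    dsimp only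
    rw [← e_natCast_div_add_mul hm (h * a ^ 2) (h * (2 * a + m))]
    congr 3
    ring
  simp_rw [normalizedGaussSum, hterm]
  rw [sum_range_mul_of_periodic hper, nsmul_eq_mul, Nat.cast_mul, mul_div_mul_left _ _ hdC]

lemma sum_Icc_eq_sum_divisors_coprime {M : Type*} [AddCommMonoid M] {n : ℕ} (hn : n ≠ 0)
    (f : ℕ → M) :
    ∑ h ∈ Finset.Icc 1 n, f h = ∑ m ∈ n.divisors,
      ∑ h ∈ (Finset.Icc 1 m).filter (fun h ↦ Nat.gcd h m = 1), f (n / m * h) := by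
  rw [Finset.sum_sigma']
  refine Finset.sum_bij' (fun h _ ↦ ⟨n / Nat.gcd h n, h / Nat.gcd h n⟩)
    (fun p _ ↦ n / p.1 * p.2) ?_ ?_ ?_ ?_ ?_
  · intro h hh
    have hg : 0 < Nat.gcd h n := Nat.gcd_pos_of_pos_right _ (Nat.pos_of_ne_zero hn)
    rw [Finset.mem_Icc] at hh
    simp only [Finset.mem_sigma, Nat.mem_divisors, Finset.mem_filter, Finset.mem_Icc]
    exact ⟨⟨Nat.div_dvd_of_dvd (Nat.gcd_dvd_right h n), hn⟩,
      ⟨Nat.div_pos (Nat.gcd_le_left n hh.1) hg, Nat.div_le_div_right hh.2⟩,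
      Nat.coprime_div_gcd_div_gcd hg⟩
  · rintro ⟨m, h⟩ hp
    simp only [Finset.mem_sigma, Nat.mem_divisors, Finset.mem_filter, Finset.mem_Icc] at hp ⊢
    obtain ⟨⟨⟨d, rfl⟩, -⟩, ⟨h1, h2⟩, -⟩ := hp
    have hm : 0 < m := by lia
    have hd : 0 < d := Nat.pos_of_ne_zero (right_ne_zero_of_mul hn)
    rw [Nat.mul_div_cancel_left _ hm]
    exact ⟨Nat.mul_pos hd h1, by rw [mul_comm m]; exact Nat.mul_le_mul_left d h2⟩
  · intro h hh
    dsimp only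
    rw [Nat.div_div_self (Nat.gcd_dvd_right h n) hn, Nat.mul_div_cancel' (Nat.gcd_dvd_left h n)]
  · rintro ⟨m, h⟩ hp
    simp only [Finset.mem_sigma, Nat.mem_divisors, Finset.mem_filter, Finset.mem_Icc] at hp
    obtain ⟨⟨⟨d, rfl⟩, -⟩, ⟨h1, h2⟩, hc⟩ := hp
    have hm : 0 < m := by lia
    have hd : 0 < d := Nat.pos_of_ne_zero (right_ne_zero_of_mul hn)
    have hg : Nat.gcd (d * h) (m * d) = d := by
      rw [mul_comm m, Nat.gcd_mul_left, hc, mul_one]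
    dsimp only
    rw [Nat.mul_div_cancel_left _ hm, hg, Nat.mul_div_cancel _ hd, Nat.mul_div_cancel_left _ hd]
  · intro h hh
    dsimp only
    rw [Nat.div_div_self (Nat.gcd_dvd_right h n) hn, Nat.mul_div_cancel' (Nat.gcd_dvd_left h n)]

lemma sq_dvd_mul_sq_iff_of_squarefree {r s k : ℕ} (hr : Squarefree r) (hs : s ≠ 0) :
    k ^ 2 ∣ r * s ^ 2 ↔ k ∣ s := by
  refine ⟨fun h ↦ ?_, fun h ↦ (pow_dvd_pow_of_dvd h 2).mul_left r⟩
  obtain ⟨g, k', s', hg, hc, rfl, rfl⟩ :=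
    Nat.exists_coprime' (Nat.gcd_pos_of_pos_right k (Nat.pos_of_ne_zero hs))
  rw [mul_pow, mul_pow, ← mul_assoc] at h
  have h' := (Nat.dvd_of_mul_dvd_mul_right (pow_pos hg 2) h)
  have hk := hr k' (by rw [← sq]; exact (hc.pow 2 2).dvd_of_dvd_mul_right h')
  rw [Nat.isUnit_iff.mp hk, one_mul]
  exact Nat.dvd_mul_left g s'

lemma mul_sq_dvd_sq_iff_of_squarefree {r s a : ℕ} (hr : Squarefree r) (hs : s ≠ 0) :
    r * s ^ 2 ∣ a ^ 2 ↔ r * s ∣ a := by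
  refine ⟨fun h ↦ ?_, fun h ↦ ?_⟩
  · obtain ⟨b, rfl⟩ := (Nat.pow_dvd_pow_iff two_ne_zero).mp ((Nat.dvd_mul_left _ r).trans h)
    rw [mul_pow, mul_comm (s ^ 2)] at h
    have := Nat.dvd_of_mul_dvd_mul_right (pow_pos (Nat.pos_of_ne_zero hs) 2) h
    rw [mul_comm s]
    exact Nat.mul_dvd_mul_right ((hr.dvd_pow_iff_dvd two_ne_zero).mp this) s
  · refine Dvd.dvd.trans ⟨r, ?_⟩ (pow_dvd_pow_of_dvd h 2)
    ring

lemma card_filter_dvd_sq {r s : ℕ} (hr : Squarefree r) (hs : s ≠ 0) :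
    ((Finset.range (r * s ^ 2)).filter (fun a ↦ r * s ^ 2 ∣ a ^ 2)).card = s := by
  have hrs : 0 < r * s := Nat.mul_pos (Nat.pos_of_ne_zero hr.ne_zero) (Nat.pos_of_ne_zero hs)
  have himage : (Finset.range (r * s ^ 2)).filter (fun a ↦ r * s ^ 2 ∣ a ^ 2) =
      (Finset.range s).image (r * s * ·) := by
    ext a
    rw [Finset.mem_filter, mul_sq_dvd_sq_iff_of_squarefree hr hs, Finset.mem_range,
      Finset.mem_image, sq, ← mul_assoc]
    constructor
    · rintro ⟨ha, b, rfl⟩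
      exact ⟨b, Finset.mem_range.mpr (Nat.lt_of_mul_lt_mul_left ha), rfl⟩
    · rintro ⟨b, hb, rfl⟩
      exact ⟨Nat.mul_lt_mul_of_pos_left (Finset.mem_range.mp hb) hrs, Nat.dvd_mul_right _ _⟩
  rw [himage, Finset.card_image_of_injective _ (mul_right_injective₀ hrs.ne'),
    Finset.card_range]

lemma sum_normalizedGaussSum {n : ℕ} (hn : n ≠ 0) :
    ∑ h ∈ Finset.Icc 1 n, normalizedGaussSum n h =
      ((Finset.range n).filter (fun a ↦ n ∣ a ^ 2)).card := by
  have hnC : (n : ℂ) ≠ 0 := mod_cast hn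
  simp_rw [normalizedGaussSum]
  rw [← Finset.sum_div, Finset.sum_comm]
  simp_rw [sum_e_natCast_div hn]
  rw [← Finset.sum_filter, Finset.sum_const, nsmul_eq_mul, mul_div_cancel_right₀ _ hnC]

lemma sum_divisors_sum_coprime_normalizedGaussSum {n : ℕ} (hn : n ≠ 0) :
    ∑ m ∈ n.divisors, ∑ h ∈ (Finset.Icc 1 m).filter (fun h ↦ Nat.gcd h m = 1),
      normalizedGaussSum m h = ((Finset.range n).filter (fun a ↦ n ∣ a ^ 2)).card := by
  rw [← sum_normalizedGaussSum hn, sum_Icc_eq_sum_divisors_coprime hn]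
  refine Finset.sum_congr rfl fun m hm ↦ Finset.sum_congr rfl fun h _ ↦ ?_
  obtain ⟨d, rfl⟩ := Nat.dvd_of_mem_divisors hm
  have hm0 := left_ne_zero_of_mul hn
  rw [Nat.mul_div_cancel_left _ (Nat.pos_of_ne_zero hm0), mul_comm m,
    normalizedGaussSum_mul (right_ne_zero_of_mul hn) hm0]

lemma sum_divisors_totient_sqrt {n : ℕ} (hn : n ≠ 0) :
    ∑ m ∈ n.divisors, (if IsSquare m then Nat.totient (Nat.sqrt m) else 0) =
      ((Finset.range n).filter (fun a ↦ n ∣ a ^ 2)).card := by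
  obtain ⟨r, s, rfl, hr⟩ := Nat.sq_mul_squarefree n
  rw [mul_comm] at hn ⊢
  have hs : s ≠ 0 := by rintro rfl; simp at hn
  rw [card_filter_dvd_sq hr hs, ← Finset.sum_filter]
  conv_rhs => rw [← Nat.sum_totient s]
  symm
  refine Finset.sum_bij' (fun k _ ↦ k ^ 2) (fun m _ ↦ Nat.sqrt m) ?_ ?_ ?_ ?_ ?_
  · intro k hk
    rw [Finset.mem_filter, Nat.mem_divisors, sq_dvd_mul_sq_iff_of_squarefree hr hs]
    exact ⟨⟨Nat.dvd_of_mem_divisors hk, hn⟩, IsSquare.sq k⟩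
  · intro m hm
    rw [Finset.mem_filter, Nat.mem_divisors, isSquare_iff_exists_sq] at hm
    obtain ⟨⟨hd, -⟩, k, rfl⟩ := hm
    rw [sq_dvd_mul_sq_iff_of_squarefree hr hs] at hd
    simpa [Nat.sqrt_eq', hs] using hd
  · intro k _
    exact Nat.sqrt_eq' k
  · intro m hm
    obtain ⟨k, rfl⟩ := (isSquare_iff_exists_sq m).mp (Finset.mem_filter.mp hm).2
    simp only [Nat.sqrt_eq']
  · intro k _
    rw [Nat.sqrt_eq']

lemma sum_coprime_normalizedGaussSum {n : ℕ} (hn : 0 < n) :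
    ∑ h ∈ (Finset.Icc 1 n).filter (fun h ↦ Nat.gcd h n = 1), normalizedGaussSum n h =
      ((if IsSquare n then Nat.totient (Nat.sqrt n) else 0 : ℕ) : ℂ) := by
  have hG := (ArithmeticFunction.sum_eq_iff_sum_mul_moebius_eq (R := ℂ)).mp
    (fun n (hn : 0 < n) ↦ sum_divisors_sum_coprime_normalizedGaussSum hn.ne') n hn
  rw [← hG]
  refine (ArithmeticFunction.sum_eq_iff_sum_mul_moebius_eq (R := ℂ)
    (f := fun m ↦ ((if IsSquare m then Nat.totient (Nat.sqrt m) else 0 : ℕ) : ℂ))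
    (g := fun m ↦ (((Finset.range m).filter (fun a ↦ m ∣ a ^ 2)).card : ℂ))).mp
    (fun n (hn : 0 < n) ↦ ?_) n hn
  rw [← sum_divisors_totient_sqrt hn.ne', Nat.cast_sum]

lemma totient_sq (k : ℕ) : Nat.totient (k ^ 2) = k * Nat.totient k := by
  rcases Nat.eq_zero_or_pos k with rfl | hk
  · simp
  have h := Nat.totient_gcd_mul_totient_mul k k
  rw [Nat.gcd_self, mul_assoc] at h
  rw [sq, Nat.eq_of_mul_eq_mul_left (Nat.totient_pos.mpr hk) h, mul_comm]

theorem stmt4 (n : ℕ) (hn : 0 < n) :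
    (∑ h ∈ (Finset.Icc 1 n).filter (fun h => Nat.gcd h n = 1),
        ∑ a ∈ Finset.range n, e ((h * a ^ 2 : ℕ) / (n : ℝ)))
      = if IsSquare n then ((Nat.totient n : ℝ) * Real.sqrt n : ℝ) else 0 := by
  have hnC : (n : ℂ) ≠ 0 := mod_cast hn.ne'
  have key := sum_coprime_normalizedGaussSum hn
  simp_rw [normalizedGaussSum] at key
  rw [← Finset.sum_div, div_eq_iff hnC] at key
  rw [key]
  split_ifs with hsq
  · obtain ⟨k, rfl⟩ := (isSquare_iff_exists_sq n).mp hsq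
    rw [Nat.sqrt_eq', totient_sq]
    push_cast
    rw [Real.sqrt_sq k.cast_nonneg, Complex.ofReal_natCast]
    ring
  · simp
end

section
/- For every positive integer n, every integer u with gcd(u, n) = 1, and every integer r, one has Σ_{a=0}^{n−1} S(a²u², r²; n)·e(2aru/n) = Σ_{h=1,…,n, gcd(h,n)=1} Σ_{a=0}^{n−1} e(h·a²/n). In particular the left-hand side does not depend on u or r. -/
open Complex Real

/-- The Kloosterman sum `S(m, n; c) = ∑_{a ∈ (ℤ/cℤ)ˣ} e((ma + n a⁻¹)/c)`. -/
noncomputable def kloos (m n : ℤ) (c : ℕ) : ℂ :=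
  ∑ a ∈ Finset.range c, if Nat.gcd a c = 1 then
    e (((m * (a : ℤ) + n * (((a : ZMod c)⁻¹).val : ℤ) : ℤ) : ℝ) / (c : ℝ)) else 0

lemma e_int_div (n : ℕ) [NeZero n] (j : ℤ) :
    e ((j : ℝ) / (n : ℝ)) = ZMod.stdAddChar (j : ZMod n) := by
  rw [ZMod.stdAddChar_coe, e]
  congr 1
  push_cast
  ring

lemma sum_range_zmod {M : Type*} [AddCommMonoid M] (n : ℕ) [NeZero n] (f : ZMod n → M) :
    ∑ a ∈ Finset.range n, f (a : ZMod n) = ∑ x : ZMod n, f x := by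
  refine Finset.sum_bij' (fun a _ => (a : ZMod n)) (fun x _ => x.val) (by simp)
    (fun x _ => Finset.mem_range.2 x.val_lt) (fun a ha => ?_) (by simp) (by simp)
  exact ZMod.val_cast_of_lt (Finset.mem_range.1 ha)

lemma sum_Icc_one_zmod {M : Type*} [AddCommMonoid M] (n : ℕ) [NeZero n] (f : ZMod n → M) :
    ∑ a ∈ Finset.Icc 1 n, f (a : ZMod n) = ∑ x : ZMod n, f x := by
  rw [← Finset.Ico_add_one_right_eq_Icc, Finset.sum_Ico_eq_sum_range, Nat.add_sub_cancel,
    ← Equiv.sum_comp (Equiv.addLeft (1 : ZMod n)) f, ← sum_range_zmod]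
  simp

lemma sum_ite_isUnit {R M : Type*} [Monoid R] [Fintype R] [DecidableEq R]
    [DecidablePred (IsUnit : R → Prop)] [AddCommMonoid M] (f : R → M) :
    (∑ x : R, if IsUnit x then f x else 0) = ∑ v : Rˣ, f v := by
  rw [← Finset.sum_filter]
  symm
  refine Finset.sum_bij (fun v _ => (v : R)) (by simp) (fun _ _ _ _ h => Units.ext h)
    (fun x hx => ?_) (by simp)
  obtain ⟨v, rfl⟩ := (Finset.mem_filter.1 hx).2
  exact ⟨v, by simp, rfl⟩

lemma kloos_eq_sum_units (m k : ℤ) (n : ℕ) [NeZero n] :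
    kloos m k n = ∑ v : (ZMod n)ˣ,
      ZMod.stdAddChar ((m : ZMod n) * (v : ZMod n) + (k : ZMod n) * ((v⁻¹ : (ZMod n)ˣ) : ZMod n)) := by
  classical
  simp only [← ZMod.inv_coe_unit]
  rw [← sum_ite_isUnit (fun x : ZMod n => (ZMod.stdAddChar ((m : ZMod n) * x + (k : ZMod n) * x⁻¹) : ℂ)),
    ← sum_range_zmod, kloos]
  refine Finset.sum_congr rfl fun a _ => ?_
  rw [e_int_div]
  simp [ZMod.isUnit_iff_coprime, Nat.Coprime]

theorem stmt5 (n : ℕ) (hn : 0 < n) (u : ℤ) (hu : Int.gcd u n = 1) (r : ℤ) :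
    ∑ a ∈ Finset.range n, kloos ((a : ℤ) ^ 2 * u ^ 2) (r ^ 2) n *
        e (((2 * (a : ℤ) * r * u : ℤ) : ℝ) / (n : ℝ))
      = ∑ h ∈ (Finset.Icc 1 n).filter (fun h => Nat.gcd h n = 1),
          ∑ a ∈ Finset.range n, e ((h * a ^ 2 : ℕ) / (n : ℝ)) := by
  classical
  have : NeZero n := ⟨hn.ne'⟩
  obtain ⟨w, hw⟩ : IsUnit (u : ZMod n) :=
    (ZMod.coe_int_isUnit_iff_isCoprime u n).2 (Int.isCoprime_iff_gcd_eq_one.2 hu).symm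
  have gauss : ∀ h : ℕ, ∑ a ∈ Finset.range n, e ((h * a ^ 2 : ℕ) / (n : ℝ)) =
      ∑ x : ZMod n, ZMod.stdAddChar ((h : ZMod n) * x ^ 2) := fun h => by
    rw [← sum_range_zmod]
    refine Finset.sum_congr rfl fun a _ => ?_
    have key := e_int_div n (h * a ^ 2)
    push_cast at key ⊢
    exact key
  have rhs : ∑ h ∈ (Finset.Icc 1 n).filter (fun h => Nat.gcd h n = 1),
      ∑ a ∈ Finset.range n, e ((h * a ^ 2 : ℕ) / (n : ℝ)) =
      ∑ v : (ZMod n)ˣ, ∑ x : ZMod n, ZMod.stdAddChar ((v : ZMod n) * x ^ 2) := by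
    rw [← sum_ite_isUnit (fun y : ZMod n => ∑ x : ZMod n, (ZMod.stdAddChar (y * x ^ 2) : ℂ)),
      ← sum_Icc_one_zmod, Finset.sum_filter]
    refine Finset.sum_congr rfl fun h _ => ?_
    simp only [gauss, ZMod.isUnit_iff_coprime, Nat.Coprime]
  rw [rhs, ← Equiv.sum_comp (Equiv.inv (ZMod n)ˣ)]
  simp only [kloos_eq_sum_units, e_int_div, Finset.sum_mul, ← AddChar.map_add_eq_mul]
  rw [Finset.sum_comm]
  refine Finset.sum_congr rfl fun v _ => ?_
  rw [← Equiv.sum_comp ((Units.mulLeft (v * w)).trans (Equiv.addRight (r : ZMod n))),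
    ← sum_range_zmod]
  refine Finset.sum_congr rfl fun a _ => ?_
  have hv : ((v⁻¹ : (ZMod n)ˣ) : ZMod n) * v = 1 := v.inv_mul
  congr 1
  simp only [Equiv.trans_apply, Units.mulLeft_apply, Equiv.coe_addRight, Equiv.inv_apply,
    Units.val_mul, hw]
  push_cast
  linear_combination
    (-((v : ZMod n) * u ^ 2 * (a : ZMod n) ^ 2) - 2 * u * a * r) * hv
end

section
/- Let w : ℝ → ℝ be smooth with compact support contained in the positive reals, and let α, β > 0. With ŵ(t) = ∫_ℝ w(x)·e(−xt) dx and I_σ(u) = ∫_ℝ e(σ·2α·cos(2π(2u−t)))·ŵ(−t) dt for σ ∈ {+1, −1}, one has S(α, β) = (1/2)·Σ_{σ∈{+1,−1}} σ·∫_{−1/2}^{1/2} e(−2β·sin(2πu))·e(−u)·I_σ(u) du. -/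
open Complex Real MeasureTheory Set

noncomputable def whatw (w : ℝ → ℝ) (t : ℝ) : ℂ := ∫ x : ℝ, (w x : ℂ) * e (-(x * t))

noncomputable def Ifun (w : ℝ → ℝ) (α σ u : ℝ) : ℂ :=
  ∫ t : ℝ, e (σ * (2 * α) * Real.cos (2 * Real.pi * (2 * u - t))) * whatw w (-t)

theorem e_add (x y : ℝ) : e (x + y) = e x * e y := by
  simp only [e, ← Complex.exp_add]
  push_cast
  ring_nf

theorem e_eq_exp (x : ℝ) : e x = Complex.exp ((2 * Real.pi * x : ℝ) * Complex.I) := by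
  simp only [e]
  push_cast
  ring_nf

theorem norm_e (x : ℝ) : ‖e x‖ = 1 := by
  rw [e_eq_exp, Complex.norm_exp_ofReal_mul_I]

theorem continuous_e : Continuous e := by
  unfold e
  fun_prop

theorem e_nat_mul (n : ℕ) (x : ℝ) : e (n * x) = e x ^ n := by
  simp only [e, ← Complex.exp_nat_mul]
  push_cast
  ring_nf

theorem e_one : e 1 = 1 := by
  simp [e, Complex.exp_two_pi_mul_I]

theorem e_one_div_four : e (1 / 4) = Complex.I := by
  rw [e_eq_exp, show 2 * Real.pi * (1 / 4) = Real.pi / 2 by ring]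
  push_cast
  exact Complex.exp_pi_div_two_mul_I

theorem e_neg_one_div_four : e (-(1 / 4)) = -Complex.I := by
  rw [e_eq_exp, show 2 * Real.pi * (-(1 / 4)) = -(Real.pi / 2) by ring]
  push_cast
  rw [← neg_div]
  exact Complex.exp_neg_pi_div_two_mul_I

theorem periodic_e_nat_mul (n : ℕ) : Function.Periodic (fun t : ℝ => e (n * t)) 1 := fun t => by
  simp only [e_nat_mul, e_add, e_one, mul_one]

theorem integral_comp_add_eq_of_periodic {f : ℝ → ℂ} (hf : Function.Periodic f 1) (c : ℝ) :
    ∫ t in (0 : ℝ)..1, f (t + c) = ∫ t in (0 : ℝ)..1, f t := by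
  rw [intervalIntegral.integral_comp_add_right, add_comm (1 : ℝ) c, zero_add,
    hf.intervalIntegral_add_eq c 0, zero_add]

theorem integral_symm_eq_of_periodic {f : ℝ → ℂ} (hf : Function.Periodic f 1) :
    ∫ t in (-(1 : ℝ) / 2)..(1 / 2), f t = ∫ t in (0 : ℝ)..1, f t := by
  have h := hf.intervalIntegral_add_eq (-(1 : ℝ) / 2) 0
  norm_num at h ⊢
  exact h

/-- Bessel's integral, moved to an arbitrary period. -/
theorem besselJ_eq_integral_shift (n : ℕ) (x c : ℝ) :
    besselJ n x = ∫ t in (0 : ℝ)..1,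
      e (n * (t + c)) * Complex.exp (-(Complex.I * x * Real.sin (2 * Real.pi * (t + c)))) := by
  have hper : Function.Periodic (fun t : ℝ =>
      e (n * t) * Complex.exp (-(Complex.I * x * Real.sin (2 * Real.pi * t)))) 1 := fun t => by
    have h := periodic_e_nat_mul n t
    simp only at h ⊢
    rw [h, mul_add, mul_one, Real.sin_add_two_pi]
  rw [besselJ, integral_symm_eq_of_periodic hper, ← integral_comp_add_eq_of_periodic hper c]

theorem integral_e_cos_mul_e (n : ℕ) (α : ℝ) :
    ∫ t in (0 : ℝ)..1, e (1 * (2 * α) * Real.cos (2 * Real.pi * t)) * e (n * t) =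
      Complex.I ^ n * besselJ n (4 * Real.pi * α) := by
  rw [besselJ_eq_integral_shift n _ (-(1 / 4)), ← intervalIntegral.integral_const_mul]
  refine intervalIntegral.integral_congr fun t _ => ?_
  have hI : Complex.I ^ n * (-Complex.I) ^ n = 1 := by
    rw [← mul_pow, mul_neg, Complex.I_mul_I, neg_neg, one_pow]
  have hs : Real.sin (2 * Real.pi * (t + -(1 / 4))) = -Real.cos (2 * Real.pi * t) := by
    rw [← Real.sin_sub_pi_div_two]
    ring_nf
  have he : e (1 * (2 * α) * Real.cos (2 * Real.pi * t)) = Complex.exp (-(Complex.I *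
      (4 * Real.pi * α : ℝ) * Real.sin (2 * Real.pi * (t + -(1 / 4))))) := by
    rw [hs, e]
    push_cast
    ring_nf
  rw [← he, mul_add, e_add, e_nat_mul n (-(1 / 4)), e_neg_one_div_four]
  linear_combination -(e (1 * (2 * α) * Real.cos (2 * Real.pi * t)) * e (n * t)) * hI

theorem integral_e_neg_cos_mul_e (n : ℕ) (α : ℝ) :
    ∫ t in (0 : ℝ)..1, e (-1 * (2 * α) * Real.cos (2 * Real.pi * t)) * e (n * t) =
      (-1) ^ n * Complex.I ^ n * besselJ n (4 * Real.pi * α) := by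
  rw [besselJ_eq_integral_shift n _ (1 / 4), ← intervalIntegral.integral_const_mul]
  refine intervalIntegral.integral_congr fun t _ => ?_
  have hI : (-1) ^ n * Complex.I ^ n * Complex.I ^ n = 1 := by
    rw [← mul_pow, ← mul_pow, mul_assoc, Complex.I_mul_I, neg_mul_neg, one_mul, one_pow]
  have hs : Real.sin (2 * Real.pi * (t + 1 / 4)) = Real.cos (2 * Real.pi * t) := by
    rw [← Real.sin_add_pi_div_two]
    ring_nf
  have he : e (-1 * (2 * α) * Real.cos (2 * Real.pi * t)) = Complex.exp (-(Complex.I *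
      (4 * Real.pi * α : ℝ) * Real.sin (2 * Real.pi * (t + 1 / 4)))) := by
    rw [hs, e]
    push_cast
    ring_nf
  rw [← he, mul_add, e_add, e_nat_mul n (1 / 4), e_one_div_four]
  linear_combination -(e (-1 * (2 * α) * Real.cos (2 * Real.pi * t)) * e (n * t)) * hI

theorem integral_e_sin_mul_e (k : ℕ) (hk : 1 ≤ k) (β : ℝ) :
    ∫ u in (-(1 : ℝ) / 2)..(1 / 2),
        e (-(2 * β * Real.sin (2 * Real.pi * u))) * e (-u) * e (k * (2 * u)) =
      besselJ (2 * k - 1) (4 * Real.pi * β) := by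
  rw [besselJ]
  refine intervalIntegral.integral_congr fun u _ => ?_
  simp only [e, ← Complex.exp_add]
  push_cast [show 1 ≤ 2 * k by omega]
  ring_nf

theorem exists_schwartzMap_fourier_whatw {w : ℝ → ℝ} (hw : ContDiff ℝ (⊤ : ℕ∞) w)
    (hcs : HasCompactSupport w) :
    ∃ g : SchwartzMap ℝ ℂ, (∀ t, g t = whatw w (-t)) ∧
      ∀ x, FourierTransform.fourier g x = (w x : ℂ) := by
  have hcs' : HasCompactSupport fun x => (w x : ℂ) := hcs.comp_left Complex.ofReal_zero
  have hw' : ContDiff ℝ (⊤ : ℕ∞) fun x => (w x : ℂ) := Complex.ofRealCLM.contDiff.comp hw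
  refine ⟨FourierTransformInv.fourierInv (hcs'.toSchwartzMap hw'), fun t => ?_, fun x => ?_⟩
  · rw [SchwartzMap.fourierInv_coe, Real.fourierInv_eq', whatw]
    refine integral_congr_ae (.of_forall fun x => ?_)
    simp only [e_eq_exp, smul_eq_mul, RCLike.inner_apply, conj_trivial]
    rw [mul_comm]
    congr 1
    push_cast
    ring_nf
  · rw [FourierTransform.fourier_fourierInv_eq]
    rfl

/-- Poisson summation for the translates of the inverse Fourier transform of `w`. -/
theorem tsum_whatw_neg_add_int {w : ℝ → ℝ} (hw : ContDiff ℝ (⊤ : ℕ∞) w)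
    (hcs : HasCompactSupport w) (s : ℝ) :
    ∑' n : ℤ, whatw w (-(s + n)) = ∑' k : ℤ, (w k : ℂ) * e (k * s) := by
  obtain ⟨g, hg, hgF⟩ := exists_schwartzMap_fourier_whatw hw hcs
  have h := SchwartzMap.tsum_eq_tsum_fourier g s
  simp only [hg, hgF, fourier_coe_apply] at h
  rw [h]
  refine tsum_congr fun k => ?_
  rw [e]
  push_cast
  ring_nf

theorem integrable_whatw_neg {w : ℝ → ℝ} (hw : ContDiff ℝ (⊤ : ℕ∞) w)
    (hcs : HasCompactSupport w) : Integrable fun t => whatw w (-t) := by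
  obtain ⟨g, hg, -⟩ := exists_schwartzMap_fourier_whatw hw hcs
  simpa only [hg] using (show Integrable (fun t => g t) from g.integrable)

/-- Unfolding: pairing a periodic function with the inverse Fourier transform of `w` gives a sum
over its Fourier coefficients weighted by `w`. -/
theorem integral_periodic_mul_whatw {w : ℝ → ℝ} (hw : ContDiff ℝ (⊤ : ℕ∞) w)
    (hcs : HasCompactSupport w) {N : ℕ} (hN : ∀ k : ℤ, k ∉ (Finset.range N).map Nat.castEmbedding →
      w k = 0) {F : ℝ → ℂ} (hF : Continuous F) (hper : Function.Periodic F 1)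
    {C : ℝ} (hC : ∀ t, ‖F t‖ ≤ C) :
    ∫ t, F t * whatw w (-t) =
      ∑ k ∈ Finset.range N, (w k : ℂ) * ∫ t in (0 : ℝ)..1, F t * e (k * t) := by
  have hint : Integrable fun t => F t * whatw w (-t) :=
    (integrable_whatw_neg hw hcs).bdd_mul hF.aestronglyMeasurable (.of_forall hC)
  have hFn (t : ℝ) (n : ℤ) : F (t + n) = F t := by
    simpa using hper.int_mul n t
  have hsum : HasSum (fun n : ℤ => ∫ t in (0 : ℝ)..1, F (t + n) * whatw w (-(t + n)))
      (∫ t in (0 : ℝ)..1, ∑' n : ℤ, F (t + n) * whatw w (-(t + n))) := by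
    simp only [intervalIntegral.integral_of_le zero_le_one]
    refine hasSum_integral_of_summable_integral_norm
      (fun n => (hint.comp_add_right (n : ℝ)).integrableOn) ?_
    have h := hint.norm.hasSum_intervalIntegral_comp_add_int.summable
    simpa only [intervalIntegral.integral_of_le zero_le_one] using h
  rw [hint.hasSum_intervalIntegral_comp_add_int.unique hsum]
  have hterm (t : ℝ) : ∑' n : ℤ, F (t + n) * whatw w (-(t + n)) =
      ∑ k ∈ Finset.range N, (w k : ℂ) * (F t * e (k * t)) := by
    simp only [hFn]
    rw [tsum_mul_left, tsum_whatw_neg_add_int hw hcs,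
      tsum_eq_sum (s := (Finset.range N).map Nat.castEmbedding) (fun k hk => by simp [hN k hk]),
      Finset.sum_map, Finset.mul_sum]
    refine Finset.sum_congr rfl fun k _ => ?_
    simp only [Nat.castEmbedding_apply, Int.cast_natCast]
    ring
  simp only [hterm]
  rw [intervalIntegral.integral_finsetSum]
  · simp only [intervalIntegral.integral_const_mul]
  · intro k _
    refine Continuous.intervalIntegrable ?_ _ _
    have := continuous_e
    fun_prop

theorem Ifun_eq_sum {w : ℝ → ℝ} (hw : ContDiff ℝ (⊤ : ℕ∞) w)
    (hcs : HasCompactSupport w) {N : ℕ} (hN : ∀ k : ℤ, k ∉ (Finset.range N).map Nat.castEmbedding →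
      w k = 0) (α σ u : ℝ) :
    Ifun w α σ u = ∑ k ∈ Finset.range N, (w k : ℂ) * (e (k * (2 * u)) *
      ∫ t in (0 : ℝ)..1, e (σ * (2 * α) * Real.cos (2 * Real.pi * t)) * e (k * t)) := by
  have he := continuous_e
  rw [Ifun, integral_periodic_mul_whatw hw hcs hN (C := 1) (by fun_prop) _
    (fun t => (norm_e _).le)]
  · refine Finset.sum_congr rfl fun k _ => ?_
    congr 1
    have hper : Function.Periodic (fun t : ℝ =>
        e (σ * (2 * α) * Real.cos (2 * Real.pi * (2 * u - t))) * e (k * t)) 1 := fun t => by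
      have h := periodic_e_nat_mul k t
      simp only at h ⊢
      rw [h, ← sub_sub, mul_sub _ _ (1 : ℝ), mul_one, Real.cos_sub_two_pi]
    rw [← integral_comp_add_eq_of_periodic hper (2 * u), ← intervalIntegral.integral_const_mul]
    refine intervalIntegral.integral_congr fun t _ => ?_
    rw [sub_add_cancel_right, mul_neg, Real.cos_neg, mul_add, e_add]
    ring
  · intro t
    simp only
    rw [← sub_sub, mul_sub _ _ (1 : ℝ), mul_one, Real.cos_sub_two_pi]

theorem integral_mul_Ifun_eq_sum {w : ℝ → ℝ} (hw : ContDiff ℝ (⊤ : ℕ∞) w)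
    (hcs : HasCompactSupport w) {N : ℕ} (hN : ∀ k : ℤ, k ∉ (Finset.range N).map Nat.castEmbedding →
      w k = 0) (h0 : w 0 = 0) (α β σ : ℝ) :
    ∫ u in (-(1 : ℝ) / 2)..(1 / 2),
        e (-(2 * β * Real.sin (2 * Real.pi * u))) * e (-u) * Ifun w α σ u =
      ∑ k ∈ Finset.range N, (w k : ℂ) * besselJ (2 * k - 1) (4 * Real.pi * β) *
        ∫ t in (0 : ℝ)..1, e (σ * (2 * α) * Real.cos (2 * Real.pi * t)) * e (k * t) := by
  have he := continuous_e
  simp only [Ifun_eq_sum hw hcs hN, Finset.mul_sum]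
  rw [intervalIntegral.integral_finsetSum
    (fun k _ => Continuous.intervalIntegrable (by fun_prop) _ _)]
  refine Finset.sum_congr rfl fun k _ => ?_
  rcases Nat.eq_zero_or_pos k with rfl | hk
  · simp [h0]
  generalize ∫ t in (0 : ℝ)..1, e (σ * (2 * α) * Real.cos (2 * Real.pi * t)) * e (k * t) = A
  rw [← integral_e_sin_mul_e k hk β, ← intervalIntegral.integral_const_mul,
    ← intervalIntegral.integral_mul_const]
  refine intervalIntegral.integral_congr fun u _ => ?_
  ring

theorem stmt6 (w : ℝ → ℝ) (hw : ContDiff ℝ (⊤ : ℕ∞) w) (hcs : HasCompactSupport w)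
    (hsupp : Function.support w ⊆ Set.Ioi 0) (α β : ℝ) (hα : 0 < α) (hβ : 0 < β) :
    Ssum w α β = (1 / 2 : ℂ) *
      ((∫ u in (-(1:ℝ)/2)..(1/2), e (-(2 * β * Real.sin (2 * Real.pi * u))) * e (-u) * Ifun w α 1 u)
       - ∫ u in (-(1:ℝ)/2)..(1/2), e (-(2 * β * Real.sin (2 * Real.pi * u))) * e (-u) * Ifun w α (-1) u) := by
  obtain ⟨R, hR⟩ := hcs.isCompact.isBounded.subset_closedBall 0
  obtain ⟨N, hRN⟩ := exists_nat_gt R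
  have hpos (x : ℝ) (hx : x ≤ 0) : w x = 0 := by
    by_contra h
    exact absurd (hsupp h) (not_lt.mpr hx)
  have hlarge (x : ℝ) (hx : (N : ℝ) ≤ x) : w x = 0 := by
    by_contra h
    have h1 := hR (subset_tsupport w h)
    rw [mem_closedBall_zero_iff, Real.norm_eq_abs] at h1
    linarith [le_abs_self x]
  have hN (k : ℤ) (hk : k ∉ (Finset.range N).map Nat.castEmbedding) : w k = 0 := by
    rcases le_or_gt k 0 with h | h
    · exact hpos _ (by exact_mod_cast h)
    · lift k to ℕ using h.le
      refine hlarge _ ?_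
      simp only [Finset.mem_map, Finset.mem_range, Nat.castEmbedding_apply, Nat.cast_inj,
        exists_eq_right, not_lt] at hk
      exact_mod_cast hk
  rw [integral_mul_Ifun_eq_sum hw hcs hN (hpos 0 le_rfl),
    integral_mul_Ifun_eq_sum hw hcs hN (hpos 0 le_rfl), Ssum,
    tsum_eq_sum (s := Finset.range N), ← Finset.sum_sub_distrib, Finset.mul_sum]
  · refine Finset.sum_congr rfl fun k _ => ?_
    rw [integral_e_cos_mul_e, integral_e_neg_cos_mul_e]
    split_ifs with hk
    · rw [hk.neg_one_pow]
      ring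
    · rw [(Nat.not_odd_iff_even.mp hk).neg_one_pow]
      ring
  · intro k hk
    rw [hlarge k (by exact_mod_cast not_lt.mp (Finset.mem_range.not.mp hk))]
    simp
end

section
/- Let ε ∈ (0, 1/2) and let (C_j)_{j≥0} be positive constants. Then there exist C > 0 and K₀ ≥ 1 such that for all K ≥ K₀, every admissible weight w of level K with constants (C_j), every sign σ ∈ {+1, −1}, every real α with K^{2−ε} ≤ α ≤ K^{2+ε}, and every u ∈ ℝ with |sin(4πu)| ≥ K^{−1+ε}, one has |I_σ(u)| ≤ C·K^{−1+ε}, where I_σ(u) = ∫_ℝ e(σ·2α·cos(2π(2u−t)))·ŵ(−t) dt and ŵ(t) = ∫_ℝ w(x)·e(−xt) dx. -/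
open Complex Real MeasureTheory Set

/-- The two-sided Laplace transform `∫ w(x) exp(2πixz) dx`, extending `t ↦ ŵ(-t)` to complex `z`. -/
noncomputable def laplaceTransform (w : ℝ → ℝ) (z : ℂ) : ℂ :=
  ∫ x : ℝ, (w x : ℂ) * Complex.exp (2 * Real.pi * Complex.I * z * x)

/-- The entire extension of the oscillating factor `t ↦ e(s cos(2π(2u - t)))`. -/
noncomputable def cosPhase (s u : ℝ) (z : ℂ) : ℂ :=
  Complex.exp (2 * Real.pi * Complex.I * s * Complex.cos (2 * Real.pi * (2 * u - z)))

lemma integrable_ofReal_mul_exp {g : ℝ → ℝ} (hg : Continuous g) (hs : HasCompactSupport g)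
    (c : ℂ) : Integrable (fun x : ℝ => (g x : ℂ) * Complex.exp (c * x)) := by
  apply Continuous.integrable_of_hasCompactSupport (by fun_prop)
  exact (hs.comp_left (g := fun y : ℝ => (y : ℂ)) (by simp)).mul_right

/-- Repeated integration by parts against an exponential. -/
lemma pow_mul_integral_ofReal_mul_exp (c : ℂ) (n : ℕ) {g : ℝ → ℝ} (hg : ContDiff ℝ (⊤ : ℕ∞) g)
    (hs : HasCompactSupport g) :
    c ^ n * ∫ x : ℝ, (g x : ℂ) * Complex.exp (c * x) =
      (-1) ^ n * ∫ x : ℝ, ((iteratedDeriv n g x : ℝ) : ℂ) * Complex.exp (c * x) := by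
  induction n generalizing g with
  | zero => simp
  | succ n ih =>
    have hg' : ContDiff ℝ (⊤ : ℕ∞) (deriv g) :=
      (contDiff_infty_iff_deriv.1 hg).2
    have hdiff : Differentiable ℝ g := hg.differentiable (by simp)
    have key : ∫ x : ℝ, (g x : ℂ) * (Complex.exp (c * x) * c) =
        -∫ x : ℝ, ((deriv g x : ℝ) : ℂ) * Complex.exp (c * x) := by
      refine integral_mul_deriv_eq_deriv_mul_of_integrable
        (fun x _ => (hdiff x).hasDerivAt.ofReal_comp) (fun x _ => ?_) ?_ ?_ ?_
      · have h : HasDerivAt (fun y : ℝ => c * (y : ℂ)) c x := by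
          simpa using ((hasDerivAt_id x).ofReal_comp).const_mul c
        exact h.cexp
      · have := (integrable_ofReal_mul_exp hg.continuous hs c).mul_const c
        simpa [mul_assoc, Pi.mul_def] using this
      · exact integrable_ofReal_mul_exp hg'.continuous hs.deriv c
      · exact integrable_ofReal_mul_exp hg.continuous hs c
    have key' : c * ∫ x : ℝ, (g x : ℂ) * Complex.exp (c * x) =
        -∫ x : ℝ, ((deriv g x : ℝ) : ℂ) * Complex.exp (c * x) := by
      rw [← key, ← integral_const_mul]
      congr 1
      ext x
      ring
    rw [pow_succ, mul_assoc, key', mul_neg, ih hg' hs.deriv, ← iteratedDeriv_succ', pow_succ]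
    ring

lemma tsupport_iteratedDeriv_subset (n : ℕ) (g : ℝ → ℝ) :
    tsupport (iteratedDeriv n g) ⊆ tsupport g := by
  induction n with
  | zero => simp
  | succ n ih =>
    rw [iteratedDeriv_succ]
    exact tsupport_deriv_subset.trans ih

lemma Admissible.hasCompactSupport {K : ℝ} {C : ℕ → ℝ} {w : ℝ → ℝ} (hw : Admissible K C w) :
    HasCompactSupport w :=
  isCompact_Icc.of_isClosed_subset (isClosed_tsupport w) hw.2.1

lemma differentiable_laplaceTransform {w : ℝ → ℝ} (hw : Continuous w)
    (hs : HasCompactSupport w) : Differentiable ℂ (laplaceTransform w) := by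
  intro z₀
  set bound : ℝ → ℝ := fun x =>
    |w x| * (Real.exp (2 * Real.pi * (‖z₀‖ + 1) * |x|) * (2 * Real.pi * |x|)) with hbound
  have hbi : Integrable bound := by
    apply Continuous.integrable_of_hasCompactSupport (by fun_prop)
    exact (hs.comp_left (g := fun y : ℝ => |y|) (by simp)).mul_right
  refine (hasDerivAt_integral_of_dominated_loc_of_deriv_le (𝕜 := ℂ)
    (F := fun z (x : ℝ) => (w x : ℂ) * Complex.exp (2 * Real.pi * Complex.I * z * x))
    (F' := fun z (x : ℝ) => (w x : ℂ) *
      (Complex.exp (2 * Real.pi * Complex.I * z * x) * (2 * Real.pi * Complex.I * x)))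
    (bound := bound) (Metric.ball_mem_nhds z₀ one_pos) ?_ ?_ ?_ ?_ hbi ?_).2.differentiableAt
  · exact Filter.Eventually.of_forall fun z =>
      Continuous.aestronglyMeasurable (by fun_prop)
  · exact integrable_ofReal_mul_exp hw hs _
  · exact Continuous.aestronglyMeasurable (by fun_prop)
  · refine Filter.Eventually.of_forall fun x z hz => ?_
    have hz' : ‖z‖ ≤ ‖z₀‖ + 1 := by
      have h1 : ‖z - z₀‖ < 1 := by simpa [dist_eq_norm] using hz
      have h2 := norm_sub_norm_le z z₀
      linarith
    rw [norm_mul, norm_mul, Complex.norm_real, Real.norm_eq_abs]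
    have h3 : ‖(2 * Real.pi * Complex.I * x : ℂ)‖ = 2 * Real.pi * |x| := by
      simp [abs_of_pos Real.pi_pos]
    have h4 : ‖Complex.exp (2 * Real.pi * Complex.I * z * x)‖ ≤
        Real.exp (2 * Real.pi * (‖z₀‖ + 1) * |x|) := by
      refine (Complex.norm_exp_le_exp_norm _).trans (Real.exp_le_exp.2 ?_)
      have : ‖(2 * Real.pi * Complex.I * z * x : ℂ)‖ = 2 * Real.pi * ‖z‖ * |x| := by
        simp [abs_of_pos Real.pi_pos]
      rw [this]
      gcongr
    rw [h3, hbound]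
    dsimp only
    gcongr
  · refine Filter.Eventually.of_forall fun x z _ => ?_
    have h : HasDerivAt (fun z : ℂ => 2 * Real.pi * Complex.I * z * x)
        (2 * Real.pi * Complex.I * x) z := by
      simpa using (((hasDerivAt_id z).const_mul (2 * Real.pi * Complex.I : ℂ)).mul_const (x : ℂ))
    exact h.cexp.const_mul _

lemma differentiable_cosPhase (s u : ℝ) : Differentiable ℂ (cosPhase s u) := by
  unfold cosPhase
  fun_prop

lemma norm_cosPhase (s u t y : ℝ) :
    ‖cosPhase s u (t + y * Complex.I)‖ =
      Real.exp (-(2 * Real.pi * s * Real.sin (2 * Real.pi * (2 * u - t)) *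
        Real.sinh (2 * Real.pi * y))) := by
  rw [cosPhase, Complex.norm_exp]
  congr 1
  have h : (2 * Real.pi * (2 * u - (t + y * Complex.I)) : ℂ) =
      ((2 * Real.pi * (2 * u - t) : ℝ) : ℂ) + ((-(2 * Real.pi * y) : ℝ) : ℂ) * Complex.I := by
    push_cast
    ring
  rw [h, Complex.cos_add_mul_I, ← Complex.ofReal_cos, ← Complex.ofReal_sin,
    ← Complex.ofReal_cosh, ← Complex.ofReal_sinh, Real.sinh_neg, Real.cosh_neg]
  generalize Real.cos (2 * Real.pi * (2 * u - t)) = a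
  generalize Real.cosh (2 * Real.pi * y) = b
  generalize Real.sinh (2 * Real.pi * y) = d
  generalize Real.sin (2 * Real.pi * (2 * u - t)) = g
  simp
  ring

lemma norm_exp_kernel (x t y : ℝ) :
    ‖Complex.exp (2 * Real.pi * Complex.I * (t + y * Complex.I) * x)‖ =
      Real.exp (-(2 * Real.pi * x * y)) := by
  rw [Complex.norm_exp]
  congr 1
  simp
  ring

lemma norm_mul_laplaceTransform_mul_pow_le {K : ℝ} (hK : 0 < K) {C : ℕ → ℝ} {w : ℝ → ℝ}
    (hw : Admissible K C w) (n : ℕ) (p z : ℂ) {M : ℝ}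
    (hM : ∀ x ∈ Icc K (2 * K),
      ‖p‖ * ‖Complex.exp (2 * Real.pi * Complex.I * z * x)‖ ≤ M) :
    ‖p * laplaceTransform w z‖ * (2 * Real.pi * K * ‖z‖) ^ n ≤ C n * M * K := by
  have h1 := pow_mul_integral_ofReal_mul_exp (2 * Real.pi * Complex.I * z) n hw.1
    hw.hasCompactSupport
  have h2 : ‖p * laplaceTransform w z‖ * (2 * Real.pi * ‖z‖) ^ n =
      ‖∫ x : ℝ, p * (((iteratedDeriv n w x : ℝ) : ℂ) *
        Complex.exp (2 * Real.pi * Complex.I * z * x))‖ := by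
    rw [integral_const_mul, norm_mul, norm_mul, mul_assoc]
    congr 1
    have h3 := congrArg norm h1
    simp only [norm_mul, norm_pow, norm_neg, norm_one, one_pow, one_mul, Complex.norm_real,
      Complex.norm_I, mul_one, Real.norm_eq_abs, abs_of_pos Real.pi_pos, Complex.norm_ofNat] at h3
    rw [← h3, laplaceTransform]
    ring
  have hM0 : 0 ≤ M := le_trans (by positivity) (hM K ⟨le_rfl, by linarith⟩)
  have h4 : ‖∫ x : ℝ, p * (((iteratedDeriv n w x : ℝ) : ℂ) *
      Complex.exp (2 * Real.pi * Complex.I * z * x))‖ ≤ C n * K ^ (-(n : ℤ)) * M * K := by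
    rw [← setIntegral_eq_integral_of_forall_compl_eq_zero (s := Icc K (2 * K))]
    · refine (norm_setIntegral_le_of_norm_le_const (C := C n * K ^ (-(n : ℤ)) * M)
        (by simp) fun x hx => ?_).trans (le_of_eq ?_)
      · rw [norm_mul, norm_mul, mul_left_comm, Complex.norm_real, Real.norm_eq_abs]
        exact mul_le_mul (hw.2.2 n x) (hM x hx) (by positivity)
          ((abs_nonneg _).trans (hw.2.2 n x))
      · rw [Real.volume_real_Icc_of_le (by linarith)]
        ring
    · intro x hx
      have : iteratedDeriv n w x = 0 := image_eq_zero_of_notMem_tsupport fun h =>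
        hx (hw.2.1 (tsupport_iteratedDeriv_subset n w h))
      simp [this]
  rw [← h2] at h4
  calc ‖p * laplaceTransform w z‖ * (2 * Real.pi * K * ‖z‖) ^ n
      = ‖p * laplaceTransform w z‖ * (2 * Real.pi * ‖z‖) ^ n * K ^ n := by
        rw [show 2 * Real.pi * K * ‖z‖ = 2 * Real.pi * ‖z‖ * K by ring, mul_pow]
        ring
    _ ≤ C n * K ^ (-(n : ℤ)) * M * K * K ^ n := by gcongr
    _ = C n * M * K * (K ^ (-(n : ℤ)) * K ^ n) := by ring
    _ = C n * M * K := by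
        rw [zpow_neg, zpow_natCast, inv_mul_cancel₀ (by positivity), mul_one]

lemma norm_integral_Ioi_le_of_norm_mul_pow_le {h : ℝ → ℂ} {T B : ℝ} {n : ℕ} (hT : 0 < T)
    (hB : 0 ≤ B) (hn : 2 ≤ n) (hh : ∀ t, T < t → ‖h t‖ * t ^ n ≤ B) :
    ‖∫ t in Ioi T, h t‖ * T ^ n ≤ B * T := by
  have hn' : (2 : ℝ) ≤ n := by exact_mod_cast hn
  have hlt : -(n : ℝ) < -1 := by linarith
  have h1 : ‖∫ t in Ioi T, h t‖ ≤ ∫ t in Ioi T, B * t ^ (-(n : ℝ)) := by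
    refine norm_integral_le_of_norm_le ((integrableOn_Ioi_rpow_of_lt hlt hT).const_mul B) ?_
    refine (ae_restrict_iff' measurableSet_Ioi).2 (Filter.Eventually.of_forall fun t ht => ?_)
    have ht' : T < t := ht
    have ht0 : 0 < t := hT.trans ht'
    rw [Real.rpow_neg ht0.le, Real.rpow_natCast, ← div_eq_mul_inv, le_div_iff₀ (by positivity)]
    exact hh t ht'
  rw [integral_const_mul, integral_Ioi_rpow_of_lt hlt hT, Real.rpow_add hT, Real.rpow_neg hT.le,
    Real.rpow_natCast, Real.rpow_one] at h1
  have h2 : -((T ^ n)⁻¹ * T) / (-(n : ℝ) + 1) ≤ (T ^ n)⁻¹ * T := by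
    rw [neg_div, ← div_neg]
    exact div_le_self (by positivity) (by linarith)
  calc ‖∫ t in Ioi T, h t‖ * T ^ n ≤ B * ((T ^ n)⁻¹ * T) * T ^ n := by
        gcongr
        exact h1.trans (by gcongr)
    _ = B * T := by field_simp

/-- Shift `[-T, T]` to height `η` and bound the three other sides of the rectangle. -/
lemma norm_intervalIntegral_le_of_rectangle {f : ℂ → ℂ} (hf : Differentiable ℂ f) {T η H V : ℝ}
    (hT : 0 < T) (hη : |η| = 1) (hH : ∀ t ∈ Icc (-T) T, ‖f (t + η * Complex.I)‖ ≤ H)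
    (hV : ∀ t y : ℝ, |t| = T → 0 ≤ η * y → ‖f (t + y * Complex.I)‖ ≤ V) :
    ‖∫ t in (-T)..T, f t‖ ≤ H * (2 * T) + 2 * V := by
  have hrect := Complex.integral_boundary_rect_eq_zero_of_differentiableOn f
    (((-T : ℝ) : ℂ)) (((T : ℝ) : ℂ) + (η : ℂ) * Complex.I) hf.differentiableOn
  simp only [Complex.ofReal_re, Complex.ofReal_im, Complex.add_re, Complex.add_im,
    Complex.mul_re, Complex.mul_im, Complex.I_re, Complex.I_im, mul_zero, mul_one, zero_mul,
    sub_zero, add_zero, zero_add, Complex.ofReal_zero, smul_eq_mul] at hrect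
  have hside : ∀ t : ℝ, |t| = T → ‖∫ y in (0 : ℝ)..η, f (t + y * Complex.I)‖ ≤ V := by
    intro t ht
    refine (intervalIntegral.norm_integral_le_of_norm_le_const (C := V) fun y hy => ?_).trans
      (by simp [hη])
    refine hV t y ht ?_
    rcases le_total 0 η with h | h
    · rw [uIoc_of_le h] at hy
      exact mul_nonneg h hy.1.le
    · rw [uIoc_of_ge h] at hy
      exact mul_nonneg_of_nonpos_of_nonpos h hy.2
  have htop : ‖∫ t in (-T)..T, f (t + η * Complex.I)‖ ≤ H * (2 * T) := by
    refine (intervalIntegral.norm_integral_le_of_norm_le_const (C := H) fun t ht => ?_).trans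
      (le_of_eq ?_)
    · rw [uIoc_of_le (by linarith)] at ht
      exact hH t ⟨ht.1.le, ht.2⟩
    · rw [abs_of_nonneg (by linarith)]
      ring
  have hR := hside T (abs_of_pos hT)
  have hL := hside (-T) (by rw [abs_neg, abs_of_pos hT])
  have heq : ∫ t in (-T)..T, f t = (∫ t in (-T)..T, f (t + η * Complex.I)) -
      Complex.I * (∫ y in (0 : ℝ)..η, f ((T : ℝ) + y * Complex.I)) +
      Complex.I * ∫ y in (0 : ℝ)..η, f ((-T : ℝ) + y * Complex.I) := by
    linear_combination hrect
  rw [heq]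
  refine (norm_add_le _ _).trans ?_
  have := norm_sub_le (∫ t in (-T)..T, f (t + η * Complex.I))
    (Complex.I * (∫ y in (0 : ℝ)..η, f ((T : ℝ) + y * Complex.I)))
  rw [norm_mul, Complex.norm_I, one_mul] at this ⊢
  linarith

lemma Ifun_eq_integral (w : ℝ → ℝ) (α σ u : ℝ) :
    Ifun w α σ u = ∫ t : ℝ, cosPhase (σ * (2 * α)) u t * laplaceTransform w t := by
  unfold Ifun whatw e cosPhase laplaceTransform
  congr 1
  ext t
  congr 1
  · push_cast
    congr 1
    ring
  · congr 1
    ext x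
    push_cast
    congr 2
    ring

lemma norm_cosPhase_mul_kernel_le {K s u t y η : ℝ} (hK : 0 ≤ K) (hη : η = 1 ∨ η = -1)
    (hy : 0 ≤ η * y) (hs : K ≤ η * (s * Real.sin (2 * Real.pi * (2 * u - t)))) {x : ℝ}
    (hx : x ∈ Icc K (2 * K)) :
    ‖cosPhase s u (t + y * Complex.I)‖ *
      ‖Complex.exp (2 * Real.pi * Complex.I * (t + y * Complex.I) * x)‖ ≤
      Real.exp (-(K * (η * y))) := by
  rw [norm_cosPhase, norm_exp_kernel, ← Real.exp_add, Real.exp_le_exp]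
  have hpi := Real.pi_gt_three
  have key : ∀ r q : ℝ, 0 ≤ r → K ≤ q →
      K * r ≤ 2 * Real.pi * q * Real.sinh (2 * Real.pi * r) - 2 * Real.pi * (2 * K) * r := by
    intro r q hr hq
    have h1 : 2 * Real.pi * r ≤ Real.sinh (2 * Real.pi * r) :=
      Real.self_le_sinh_iff.2 (by positivity)
    have hq0 : 0 ≤ q := hK.trans hq
    have h2 : 2 * Real.pi * K * (2 * Real.pi * r) ≤
        2 * Real.pi * q * Real.sinh (2 * Real.pi * r) := by
      gcongr
    have h3 : 0 ≤ K * r := mul_nonneg hK hr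
    nlinarith [mul_nonneg h3 (by nlinarith : (0 : ℝ) ≤ 4 * Real.pi ^ 2 - 4 * Real.pi - 1)]
  have hx0 : 0 ≤ 2 * Real.pi * x * (η * y) := by
    have := hK.trans hx.1
    positivity
  have hx1 : 2 * Real.pi * x * (η * y) ≤ 2 * Real.pi * (2 * K) * (η * y) := by
    have := hx.2
    gcongr
  have h := key (η * y) _ hy hs
  rcases hη with rfl | rfl
  · simp only [one_mul] at *
    linarith
  · have h5 : 2 * Real.pi * (-1 * y) = -(2 * Real.pi * y) := by ring
    rw [h5, Real.sinh_neg] at h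
    linarith

theorem stmt8 (ε : ℝ) (hε : ε ∈ Set.Ioo (0:ℝ) (1/2)) (C : ℕ → ℝ) (hC : ∀ j, 0 < C j) :
    ∃ (Cb K₀ : ℝ), 0 < Cb ∧ 1 ≤ K₀ ∧
      ∀ K : ℝ, K₀ ≤ K → ∀ w : ℝ → ℝ, Admissible K C w →
      ∀ σ : ℝ, (σ = 1 ∨ σ = -1) →
      ∀ α : ℝ, K ^ (2 - ε) ≤ α → α ≤ K ^ (2 + ε) →
      ∀ u : ℝ, K ^ (-1 + ε) ≤ |Real.sin (4 * Real.pi * u)| →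
      ‖Ifun w α σ u‖ ≤ Cb * K ^ (-1 + ε) := by
  obtain ⟨hε0, hε2⟩ := hε
  obtain ⟨n, hn⟩ := exists_nat_ge (2 / ε)
  have hnε : 2 ≤ ε * n := by
    rw [div_le_iff₀ hε0] at hn
    linarith
  have hn2 : 2 ≤ n := by
    have : (2 : ℝ) ≤ n := by nlinarith
    exact_mod_cast this
  have hC0 := hC 0
  have hCn := hC n
  refine ⟨C 0 + 4 * (C n * 2 ^ n), 1, by positivity, le_rfl, ?_⟩
  intro K hK w hw σ hσ α hα _ u hu
  have hK0 : 0 < K := by linarith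
  have hpi := Real.pi_gt_three
  set P : ℝ := K ^ (-1 + ε) with hP
  have hP0 : 0 < P := Real.rpow_pos_of_pos hK0 _
  have hKP : K * P = K ^ ε := by
    rw [hP, Real.rpow_add hK0, Real.rpow_neg_one, mul_inv_cancel_left₀ hK0.ne']
  have hKP1 : 1 ≤ K * P := hKP ▸ Real.one_le_rpow hK hε0.le
  have hKPn : K ^ 2 ≤ (K * P) ^ n := by
    rw [hKP, ← Real.rpow_natCast (K ^ ε) n, ← Real.rpow_mul hK0.le, ← Real.rpow_natCast K 2]
    exact Real.rpow_le_rpow_of_exponent_le hK (by exact_mod_cast hnε)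
  have hαP : K ≤ α * P := by
    have h : K ^ (2 - ε) * P = K := by
      rw [hP, ← Real.rpow_add hK0]
      norm_num
    calc K = K ^ (2 - ε) * P := h.symm
      _ ≤ α * P := by gcongr
  have hα0 : 0 < α := (Real.rpow_pos_of_pos hK0 _).trans_le hα
  set T : ℝ := P / (4 * Real.pi) with hT
  have hT0 : 0 < T := by positivity
  have hTP : 4 * Real.pi * T = P := by
    rw [hT]
    field_simp
  have h2TP : 2 * T ≤ P := by nlinarith
  obtain ⟨η, hη, hησ⟩ : ∃ η : ℝ, (η = 1 ∨ η = -1) ∧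
      η * (σ * Real.sin (4 * Real.pi * u)) = |Real.sin (4 * Real.pi * u)| := by
    rcases hσ with rfl | rfl <;> rcases abs_choice (Real.sin (4 * Real.pi * u)) with h | h <;>
      rw [h]
    exacts [⟨1, by simp, by ring⟩, ⟨-1, by simp, by ring⟩, ⟨-1, by simp, by ring⟩,
      ⟨1, by simp, by ring⟩]
  have hηabs : |η| = 1 := by rcases hη with rfl | rfl <;> simp
  have hσabs : |σ| = 1 := by rcases hσ with rfl | rfl <;> simp
  set s : ℝ := σ * (2 * α) with hs
  have hphase : ∀ t : ℝ, |t| ≤ T → K ≤ η * (s * Real.sin (2 * Real.pi * (2 * u - t))) := by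
    intro t ht
    have h1 : |Real.sin (2 * Real.pi * (2 * u - t)) - Real.sin (4 * Real.pi * u)| ≤
        2 * Real.pi * T := by
      have h := Real.lipschitzWith_sin.dist_le_mul (2 * Real.pi * (2 * u - t)) (4 * Real.pi * u)
      rw [Real.dist_eq, Real.dist_eq] at h
      refine h.trans ?_
      rw [show 2 * Real.pi * (2 * u - t) - 4 * Real.pi * u = 2 * Real.pi * (-t) by ring, abs_mul,
        abs_of_pos (by positivity : 0 < 2 * Real.pi), abs_neg, NNReal.coe_one, one_mul]
      gcongr
    have h2 : |η * (σ * (Real.sin (2 * Real.pi * (2 * u - t)) - Real.sin (4 * Real.pi * u)))| ≤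
        2 * Real.pi * T := by
      rwa [abs_mul, abs_mul, hηabs, hσabs, one_mul, one_mul]
    have h3 := (abs_le.1 h2).1
    have h4 : P / 2 ≤ η * (σ * Real.sin (2 * Real.pi * (2 * u - t))) := by nlinarith
    calc K ≤ α * P := hαP
      _ = 2 * α * (P / 2) := by ring
      _ ≤ 2 * α * (η * (σ * Real.sin (2 * Real.pi * (2 * u - t)))) := by gcongr
      _ = η * (s * Real.sin (2 * Real.pi * (2 * u - t))) := by rw [hs]; ring
  rw [Ifun_eq_integral]
  set f : ℂ → ℂ := fun z => cosPhase s u z * laplaceTransform w z with hf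
  change ‖∫ t : ℝ, f t‖ ≤ _
  have hfd : Differentiable ℂ f := (differentiable_cosPhase s u).mul
    (differentiable_laplaceTransform hw.1.continuous hw.hasCompactSupport)
  have hscale : 2 * Real.pi * K * T = K * P / 2 := by
    rw [← hTP]
    ring
  -- From a bound at the scale `T` to a saving of `K ^ 2`.
  have hgain : ∀ X Y : ℝ, 0 ≤ X → X * (2 * Real.pi * K * T) ^ n ≤ C n * Y →
      X * K ^ 2 ≤ C n * 2 ^ n * Y := by
    intro X Y hX h
    rw [hscale, div_pow, ← mul_div_assoc, div_le_iff₀ (by positivity)] at h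
    nlinarith [mul_le_mul_of_nonneg_left hKPn hX]
  have hreal : ∀ t : ℝ, ‖f t‖ * |t| ^ n ≤ C n * K / (2 * Real.pi * K) ^ n := by
    intro t
    rw [le_div_iff₀ (by positivity)]
    have h := norm_mul_laplaceTransform_mul_pow_le hK0 hw n (cosPhase s u t) t (M := 1)
      (fun x _ => by
        have h1 := norm_cosPhase s u t 0
        have h2 := norm_exp_kernel x t 0
        simp only [Complex.ofReal_zero, zero_mul, add_zero, mul_zero, Real.sinh_zero, neg_zero,
          Real.exp_zero] at h1 h2
        rw [h1, h2, one_mul])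
    rw [Complex.norm_real, Real.norm_eq_abs, mul_pow, mul_one] at h
    linarith
  have htail : ∀ h : ℝ → ℂ, (∀ t, T < t → ‖h t‖ * t ^ n ≤ C n * K / (2 * Real.pi * K) ^ n) →
      ‖∫ t in Ioi T, h t‖ ≤ C n * 2 ^ n * P := by
    intro h hh
    have h1 := norm_integral_Ioi_le_of_norm_mul_pow_le hT0 (by positivity) hn2 hh
    have h2 : ‖∫ t in Ioi T, h t‖ * (2 * Real.pi * K * T) ^ n ≤ C n * (K * T) := by
      rw [div_mul_eq_mul_div, le_div_iff₀ (by positivity)] at h1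
      rw [mul_pow]
      linarith
    have h3 := hgain _ _ (norm_nonneg _) h2
    have h4 : C n * 2 ^ n * (K * T) ≤ C n * 2 ^ n * P * K ^ 2 := by
      have : K * T ≤ P * K ^ 2 := by nlinarith [mul_pos hP0 hK0]
      rw [mul_assoc _ P]
      gcongr
    exact le_of_mul_le_mul_right (h3.trans h4) (by positivity)
  have hbox := norm_intervalIntegral_le_of_rectangle hfd (T := T) (η := η) (H := C 0)
    (V := C n * 2 ^ n * P) hT0 hηabs
    (fun t ht => by
      have hη2 : η * η = 1 := by rcases hη with rfl | rfl <;> norm_num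
      have h := norm_mul_laplaceTransform_mul_pow_le hK0 hw 0
        (cosPhase s u (t + η * Complex.I)) (t + η * Complex.I)
        (fun x hx => norm_cosPhase_mul_kernel_le hK0.le hη (by rw [hη2]; exact zero_le_one)
          (hphase t (abs_le.2 ht)) hx)
      rw [pow_zero, mul_one, hη2, mul_one] at h
      refine h.trans ?_
      have h1 : Real.exp (-K) * K ≤ 1 := by
        rw [Real.exp_neg, inv_mul_le_iff₀ (Real.exp_pos K), mul_one]
        linarith [Real.add_one_le_exp K]
      nlinarith)
    (fun t y ht hy => by
      have h := norm_mul_laplaceTransform_mul_pow_le hK0 hw n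
        (cosPhase s u (t + y * Complex.I)) (t + y * Complex.I) (M := 1)
        (fun x hx => (norm_cosPhase_mul_kernel_le hK0.le hη hy (hphase t ht.le) hx).trans
          (Real.exp_le_one_iff.2 (neg_nonpos.2 (mul_nonneg hK0.le hy))))
      have hz : T ≤ ‖(t + y * Complex.I : ℂ)‖ := by
        have := Complex.abs_re_le_norm (t + y * Complex.I : ℂ)
        simpa [ht] using this
      have h2 : ‖f (t + y * Complex.I)‖ * (2 * Real.pi * K * T) ^ n ≤ C n * K := by
        rw [mul_one] at h
        refine le_trans ?_ h
        gcongr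
      have h3 := hgain _ _ (norm_nonneg _) h2
      have h4 : C n * 2 ^ n * K ≤ C n * 2 ^ n * P * K ^ 2 := by
        have : K ≤ P * K ^ 2 := by nlinarith
        rw [mul_assoc _ P]
        gcongr
      exact le_of_mul_le_mul_right (h3.trans h4) (by positivity))
  by_cases hfi : Integrable fun t : ℝ => f t
  · rw [← intervalIntegral.integral_Iic_add_Ioi (b := -T) hfi.integrableOn hfi.integrableOn,
      ← intervalIntegral.integral_interval_add_Ioi (b := T) hfi.integrableOn hfi.integrableOn]
    have hright := htail (fun t => f t) fun t ht => by
      have h := hreal t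
      rwa [abs_of_pos (hT0.trans ht)] at h
    have hleft := htail (fun t => f ((-t : ℝ) : ℂ)) fun t ht => by
      have h := hreal (-t)
      rwa [abs_neg, abs_of_pos (hT0.trans ht)] at h
    have hneg := integral_comp_neg_Iic (-T) (fun t : ℝ => f ((-t : ℝ) : ℂ))
    simp only [neg_neg] at hneg
    rw [hneg]
    refine (norm_add_le _ _).trans ?_
    have hsplit := norm_add_le (∫ t in (-T)..T, f t) (∫ t in Ioi T, f (t : ℂ))
    have hmid : C 0 * (2 * T) ≤ C 0 * P := by gcongr
    linarith
  · rw [integral_undef hfi, norm_zero]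
    positivity
end

section
/- Let α, β ∈ ℂ with αβ = 1, and let x ∈ ℂ with max(|α|, |β|)·|x| < 1. Define λ(j) = Σ_{r=0}^{j} α^r β^{j−r} for j ≥ 0. Then the series Σ_{a₁, b₁, a₂ ≥ 0} Σ_{d=0}^{1} Σ_{c=0}^{min(2a₁, 2a₂)} (−1)^d·λ(d + a₁ + 2b₁)·x^{3a₁ + 2b₁ + 4a₂ + 3d − 2c} converges absolutely and equals (1 − x⁸) / [(1 − x²)(1 − α²x²)(1 − β²x²)(1 − αx³)(1 − βx³)]. -/
open Complex

/-- `λ(j) = ∑_{r=0}^{j} α^r β^{j−r}`. -/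
noncomputable def lamSeq (α β : ℂ) (j : ℕ) : ℂ := ∑ r ∈ Finset.range (j + 1), α ^ r * β ^ (j - r)

/-- The general term of the quintuple series, set to `0` outside the index range. -/
noncomputable def term10 (α β x : ℂ) : ℕ × ℕ × ℕ × ℕ × ℕ → ℂ
  | (a₁, b₁, a₂, d, c) =>
    if d ≤ 1 ∧ c ≤ min (2 * a₁) (2 * a₂) then
      (-1 : ℂ) ^ d * lamSeq α β (d + a₁ + 2 * b₁) * x ^ (3 * a₁ + 2 * b₁ + 4 * a₂ + 3 * d - 2 * c)
    else 0

lemma HasSum.congr_both {ι : Type*} {f g : ι → ℂ} {S T : ℂ} (h : HasSum f S)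
    (hf : ∀ i, g i = f i) (hT : T = S) : HasSum g T := by
  rwa [funext hf, hT]

lemma norm_natCast_add_one (a : ℕ) : ‖(a : ℂ) + 1‖ = a + 1 := by
  exact_mod_cast Complex.norm_natCast (a + 1)

section LamSeq

variable {α β x : ℂ}

lemma lamSeq_zero : lamSeq α β 0 = 1 := by simp [lamSeq]

lemma lamSeq_succ (n : ℕ) : lamSeq α β (n + 1) = β * lamSeq α β n + α ^ (n + 1) := by
  unfold lamSeq
  rw [Finset.sum_range_succ, Finset.mul_sum]
  congr 1
  · refine Finset.sum_congr rfl fun r hr => ?_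
    have hr' : r ≤ n := Nat.lt_succ_iff.mp (Finset.mem_range.mp hr)
    rw [Nat.succ_sub hr', pow_succ]
    ring
  · simp

lemma lamSeq_one : lamSeq α β 1 = α + β := by
  rw [lamSeq_succ, lamSeq_zero]
  ring

lemma lamSeq_add_two (hαβ : α * β = 1) (n : ℕ) :
    lamSeq α β (n + 2) = (α + β) * lamSeq α β (n + 1) - lamSeq α β n := by
  rw [lamSeq_succ (n + 1), lamSeq_succ n]
  linear_combination (-lamSeq α β n) * hαβ

lemma lamSeq_add_four (hαβ : α * β = 1) (n : ℕ) :
    lamSeq α β (n + 4) = ((α + β) ^ 2 - 2) * lamSeq α β (n + 2) - lamSeq α β n := by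
  rw [lamSeq_add_two hαβ (n + 2), lamSeq_add_two hαβ (n + 1), lamSeq_add_two hαβ n]
  ring

lemma one_le_max_norm (hαβ : α * β = 1) : 1 ≤ max ‖α‖ ‖β‖ := by
  by_contra! h
  have h1 : ‖α‖ * ‖β‖ = 1 := by rw [← norm_mul, hαβ, norm_one]
  have := max_lt_iff.mp h
  nlinarith [norm_nonneg α, norm_nonneg β]

lemma norm_lamSeq_le (j : ℕ) : ‖lamSeq α β j‖ ≤ (j + 1) * max ‖α‖ ‖β‖ ^ j := by
  unfold lamSeq
  refine (norm_sum_le _ _).trans ?_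
  have key : ∀ r ∈ Finset.range (j + 1), ‖α ^ r * β ^ (j - r)‖ ≤ max ‖α‖ ‖β‖ ^ j := by
    intro r hr
    have hr' : r ≤ j := Nat.lt_succ_iff.mp (Finset.mem_range.mp hr)
    calc ‖α ^ r * β ^ (j - r)‖ = ‖α‖ ^ r * ‖β‖ ^ (j - r) := by simp
      _ ≤ max ‖α‖ ‖β‖ ^ r * max ‖α‖ ‖β‖ ^ (j - r) := by
        gcongr
        · exact le_max_left _ _
        · exact le_max_right _ _
      _ = max ‖α‖ ‖β‖ ^ j := by rw [← pow_add, Nat.add_sub_cancel' hr']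
  refine (Finset.sum_le_sum key).trans ?_
  simp

lemma summable_succ_mul_lamSeq_mul_pow {y : ℂ} (hy : max ‖α‖ ‖β‖ * ‖y‖ < 1) (k : ℕ) :
    Summable fun a : ℕ => ((a : ℂ) + 1) * lamSeq α β (a + k) * y ^ a := by
  set M := max ‖α‖ ‖β‖ with hM
  have hM0 : 0 ≤ M := le_max_of_le_left (norm_nonneg α)
  have hρ0 : 0 ≤ M * ‖y‖ := by positivity
  have hρ : ‖M * ‖y‖‖ < 1 := by rwa [Real.norm_of_nonneg hρ0]
  have hs : Summable fun a : ℕ => ((k + 1 : ℝ) * M ^ k) * (((a : ℝ) ^ 2 * (M * ‖y‖) ^ a) +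
      2 * ((a : ℝ) ^ 1 * (M * ‖y‖) ^ a) + ((a : ℝ) ^ 0 * (M * ‖y‖) ^ a)) :=
    (((summable_pow_mul_geometric_of_norm_lt_one 2 hρ).add
      ((summable_pow_mul_geometric_of_norm_lt_one 1 hρ).mul_left 2)).add
      (summable_pow_mul_geometric_of_norm_lt_one 0 hρ)).mul_left _
  refine Summable.of_norm_bounded hs fun a => ?_
  have h2 : ‖lamSeq α β (a + k)‖ ≤ ((a + 1) * (k + 1)) * M ^ (a + k) := by
    refine (norm_lamSeq_le _).trans ?_
    rw [← hM]
    gcongr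
    push_cast
    nlinarith [mul_nonneg (Nat.cast_nonneg (α := ℝ) a) (Nat.cast_nonneg (α := ℝ) k)]
  calc ‖((a : ℂ) + 1) * lamSeq α β (a + k) * y ^ a‖
      = (a + 1) * ‖lamSeq α β (a + k)‖ * ‖y‖ ^ a := by rw [norm_mul, norm_mul, norm_pow, norm_natCast_add_one]
    _ ≤ (a + 1) * (((a + 1) * (k + 1)) * M ^ (a + k)) * ‖y‖ ^ a := by gcongr
    _ = _ := by rw [pow_add, mul_pow]; ring

lemma summable_lamSeq_mul_pow {y : ℂ} (hy : max ‖α‖ ‖β‖ * ‖y‖ < 1) (k : ℕ) :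
    Summable fun a : ℕ => lamSeq α β (a + k) * y ^ a := by
  refine Summable.of_norm_bounded (summable_succ_mul_lamSeq_mul_pow hy k).norm fun a => ?_
  rw [mul_assoc, norm_mul ((a : ℂ) + 1), norm_natCast_add_one]
  have : (0 : ℝ) ≤ a := Nat.cast_nonneg a
  nlinarith [norm_nonneg (lamSeq α β (a + k) * y ^ a)]

end LamSeq

/-- The sum of a sequence satisfying a linear recurrence of order two. -/
lemma hasSum_of_linear_recurrence {u : ℕ → ℂ} {s p : ℂ} (hu : Summable u)
    (hrec : ∀ n, u (n + 2) = s * u (n + 1) - p * u n) (h0 : 1 - s + p ≠ 0) :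
    HasSum u ((u 0 + u 1 - s * u 0) / (1 - s + p)) := by
  obtain ⟨U, hU⟩ := hu
  have h1 : HasSum (fun n => u (n + 1)) (U - u 0) := by
    simpa using (hasSum_nat_add_iff' 1).mpr hU
  have h2 : HasSum (fun n => u (n + 2)) (U - (u 0 + u 1)) := by
    simpa [Finset.sum_range_succ] using (hasSum_nat_add_iff' 2).mpr hU
  have h3 := (h1.mul_left s).sub (hU.mul_left p)
  simp_rw [← hrec] at h3
  have h4 := h2.unique h3
  convert hU using 1
  rw [div_eq_iff h0]
  linear_combination -h4

/-- Summation by parts against an affine weight. -/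
lemma hasSum_affine_mul_sub {H : ℕ → ℂ} {S : ℂ} (z : ℂ) (hS : HasSum H S)
    (hw : Summable fun a : ℕ => ((a : ℂ) + 1) * H a) :
    HasSum (fun a : ℕ => ((a + 1 : ℂ) + a * z) * (H a - H (a + 1))) ((1 + z) * S - z * H 0) := by
  have hT : Summable fun a : ℕ => ((a + 1 : ℂ) + a * z) * H a := by
    have := (hw.mul_left (1 + z)).sub (hS.summable.mul_left z)
    refine this.congr fun a => ?_
    ring
  obtain ⟨T, hT⟩ := hT
  have h1 : HasSum (fun a => H (a + 1)) (S - H 0) := by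
    simpa using (hasSum_nat_add_iff' 1).mpr hS
  have h2 : HasSum (fun a : ℕ => (((a + 1 : ℕ) + 1 : ℂ) + (a + 1 : ℕ) * z) * H (a + 1))
      (T - H 0) := by
    simpa using (hasSum_nat_add_iff' 1).mpr hT
  refine ((hT.sub h2).add (h1.mul_left (1 + z))).congr_both (fun a => ?_) ?_
  · push_cast
    ring
  · ring

lemma sum_pow_parity (x : ℂ) (a : ℕ) :
    ∑ c ∈ Finset.range (2 * a + 1), x ^ (2 * (c % 2)) = (a + 1) + a * x ^ 2 := by
  induction a with
  | zero => simp
  | succ n ih =>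
    rw [show 2 * (n + 1) + 1 = (2 * n + 1) + 1 + 1 by ring, Finset.sum_range_succ,
      Finset.sum_range_succ, ih, show (2 * n + 1) % 2 = 1 by omega,
      show (2 * n + 1 + 1) % 2 = 0 by omega]
    push_cast
    ring

lemma hasSum_shifted_geometric {x : ℂ} (hx : ‖x‖ < 1) {n a c : ℕ} (hc : c ≤ 2 * a) :
    HasSum (fun m : ℕ => if c ≤ 2 * m then x ^ (n + 3 * a + 4 * m - 2 * c) else 0)
      (x ^ (n + 3 * a) * x ^ (2 * (c % 2)) / (1 - x ^ 4)) := by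
  have hx4 : ‖x ^ 4‖ < 1 := by
    rw [norm_pow]
    exact pow_lt_one₀ (norm_nonneg x) hx (by norm_num)
  have hinj : Function.Injective fun k : ℕ => k + (c + 1) / 2 := add_left_injective _
  rw [← hinj.hasSum_iff]
  · refine ((hasSum_geometric_of_norm_lt_one hx4).mul_left
      (x ^ (n + 3 * a) * x ^ (2 * (c % 2)))).congr_both (fun k => ?_) (div_eq_mul_inv _ _)
    have h : c ≤ 2 * (k + (c + 1) / 2) := by omega
    simp only [Function.comp_apply, if_pos h]
    rw [← pow_mul, ← pow_add, ← pow_add]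
    congr 1
    omega
  · intro m hm
    rw [if_neg]
    intro h
    exact hm ⟨m - (c + 1) / 2, by simp only; omega⟩

section Term

variable {α β x : ℂ}

lemma norm_lt_one_of_max_mul_lt (hαβ : α * β = 1) (hx : max ‖α‖ ‖β‖ * ‖x‖ < 1) : ‖x‖ < 1 := by
  nlinarith [one_le_max_norm hαβ, norm_nonneg x]

lemma summable_norm_term10 (hαβ : α * β = 1) (hx : max ‖α‖ ‖β‖ * ‖x‖ < 1) :
    Summable fun p => ‖term10 α β x p‖ := by
  have hx1 := norm_lt_one_of_max_mul_lt hαβ hx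
  set M := max ‖α‖ ‖β‖ with hM
  have hM0 : 0 ≤ M := le_max_of_le_left (norm_nonneg α)
  set t := √‖x‖ with ht
  have ht0 : 0 ≤ t := Real.sqrt_nonneg _
  have htx : ‖x‖ = t ^ 2 := (Real.sq_sqrt (norm_nonneg x)).symm
  have ht1 : t < 1 := by
    rw [ht, Real.sqrt_lt' one_pos]
    simpa using hx1
  have hρ0 : 0 ≤ M * ‖x‖ := by positivity
  have hA : Summable fun n : ℕ => ((n : ℝ) + 1) * (M * ‖x‖) ^ n := by
    have hρ : ‖M * ‖x‖‖ < 1 := by rwa [Real.norm_of_nonneg hρ0]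
    refine ((summable_pow_mul_geometric_of_norm_lt_one 1 hρ).add
      (summable_pow_mul_geometric_of_norm_lt_one 0 hρ)).congr fun n => ?_
    ring
  have hB : Summable fun n : ℕ => (((2 * n : ℕ) : ℝ) + 1) * (M * ‖x‖) ^ (2 * n) :=
    hA.comp_injective (i := fun n : ℕ => 2 * n) fun a b h => by simpa using h
  have hC : Summable fun n : ℕ => ‖x‖ ^ n := summable_geometric_of_lt_one (norm_nonneg x) hx1
  have hD : Summable fun n : ℕ => t ^ n := summable_geometric_of_lt_one ht0 ht1
  have hprod := hA.mul_of_nonneg (hB.mul_of_nonneg (hC.mul_of_nonneg (hA.mul_of_nonneg hD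
    (fun n => by positivity) (fun n => by positivity))
    (fun n => by positivity) (fun n => by positivity))
    (fun n => by positivity) (fun n => by positivity))
    (fun n => by positivity) (fun n => by positivity)
  refine Summable.of_nonneg_of_le (fun _ => norm_nonneg _) ?_ hprod
  rintro ⟨a, b, m, d, c⟩
  simp only [term10]
  split_ifs with h
  · have hj : ‖lamSeq α β (d + a + 2 * b)‖ ≤
        ((a + 1) * ((((2 * b : ℕ) : ℝ) + 1) * (d + 1))) * M ^ (d + a + 2 * b) := by
      refine (norm_lamSeq_le _).trans ?_
      rw [← hM]
      gcongr
      norm_cast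
      nlinarith [Nat.zero_le (a * b), Nat.zero_le (a * d), Nat.zero_le (b * d),
        Nat.zero_le (a * b * d)]
    have he : ‖x‖ ^ (3 * a + 2 * b + 4 * m + 3 * d - 2 * c) ≤
        ‖x‖ ^ (d + a + 2 * b) * ‖x‖ ^ m * t ^ c := by
      rw [htx, ← pow_mul, ← pow_mul, ← pow_mul, ← pow_add, ← pow_add]
      exact pow_le_pow_of_le_one ht0 ht1.le (by omega)
    calc _ = ‖lamSeq α β (d + a + 2 * b)‖ *
          ‖x‖ ^ (3 * a + 2 * b + 4 * m + 3 * d - 2 * c) := by simp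
      _ ≤ (((a + 1) * ((((2 * b : ℕ) : ℝ) + 1) * (d + 1))) * M ^ (d + a + 2 * b)) *
          (‖x‖ ^ (d + a + 2 * b) * ‖x‖ ^ m * t ^ c) := by gcongr
      _ = _ := by
        simp only [pow_add, mul_pow]
        ring
  · rw [norm_zero]
    positivity

lemma hasSum_term10_inner (hαβ : α * β = 1) (hx : max ‖α‖ ‖β‖ * ‖x‖ < 1) (a b : ℕ) :
    HasSum (fun q : ℕ × ℕ × ℕ => term10 α β x (a, b, q))
      (((a + 1 : ℂ) + a * x ^ 2) / (1 - x ^ 4) *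
        (x ^ (3 * a) * (lamSeq α β (a + 2 * b) * x ^ (2 * b)) -
          x ^ (3 * (a + 1)) * (lamSeq α β (a + 1 + 2 * b) * x ^ (2 * b)))) := by
  have hx1 := norm_lt_one_of_max_mul_lt hαβ hx
  have hsum : Summable fun q : ℕ × ℕ × ℕ => term10 α β x (a, b, q) :=
    ((summable_norm_term10 hαβ hx).of_norm.prod_factor a).prod_factor b
  have hfin : ∀ m : ℕ, HasSum (fun q : ℕ × ℕ => term10 α β x (a, b, m, q))
      (∑ d ∈ Finset.range 2, ∑ c ∈ Finset.range (2 * a + 1),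
        (-1 : ℂ) ^ d * lamSeq α β (d + a + 2 * b) *
          if c ≤ 2 * m then x ^ ((2 * b + 3 * d) + 3 * a + 4 * m - 2 * c) else 0) := by
    intro m
    rw [← Finset.sum_product']
    refine (hasSum_sum_of_ne_finset_zero (s := Finset.range 2 ×ˢ Finset.range (2 * a + 1))
      ?_).congr_both (fun _ => rfl) ?_
    · rintro ⟨d, c⟩ hq
      simp only [Finset.mem_product, Finset.mem_range] at hq
      simp only [term10]
      exact if_neg (by omega)
    · refine Finset.sum_congr rfl ?_
      rintro ⟨d, c⟩ hq
      simp only [Finset.mem_product, Finset.mem_range] at hq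
      simp only [term10]
      by_cases hc : c ≤ 2 * m
      · rw [if_pos hc, if_pos (by omega)]
        congr 2
        omega
      · rw [if_neg hc, if_neg (by omega), mul_zero]
  have h1 := hsum.hasSum.prod_fiberwise hfin
  have h2 : HasSum (fun m : ℕ => ∑ d ∈ Finset.range 2, ∑ c ∈ Finset.range (2 * a + 1),
        (-1 : ℂ) ^ d * lamSeq α β (d + a + 2 * b) *
          if c ≤ 2 * m then x ^ ((2 * b + 3 * d) + 3 * a + 4 * m - 2 * c) else 0)
      (∑ d ∈ Finset.range 2, ∑ c ∈ Finset.range (2 * a + 1),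
        (-1 : ℂ) ^ d * lamSeq α β (d + a + 2 * b) *
          (x ^ ((2 * b + 3 * d) + 3 * a) * x ^ (2 * (c % 2)) / (1 - x ^ 4))) :=
    hasSum_sum fun d _ => hasSum_sum fun c hc =>
      (hasSum_shifted_geometric hx1 (by have := Finset.mem_range.mp hc; omega)).mul_left _
  have h3 := hsum.hasSum
  rw [h1.unique h2] at h3
  convert h3 using 1
  simp only [← Finset.mul_sum, ← Finset.sum_div, sum_pow_parity]
  rw [Finset.sum_range_succ, Finset.sum_range_one, show 0 + a + 2 * b = a + 2 * b by ring,
    show 1 + a + 2 * b = a + 1 + 2 * b by ring]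
  ring

end Term

lemma one_sub_ne_zero_of_norm_lt_one {z : ℂ} (hz : ‖z‖ < 1) : 1 - z ≠ 0 := by
  rw [sub_ne_zero]
  rintro rfl
  simp at hz

theorem stmt10 (α β x : ℂ) (hαβ : α * β = 1) (hx : max ‖α‖ ‖β‖ * ‖x‖ < 1) :
    Summable (fun p => ‖term10 α β x p‖) ∧
    ∑' p, term10 α β x p =
      (1 - x ^ 8) /
        ((1 - x ^ 2) * (1 - α ^ 2 * x ^ 2) * (1 - β ^ 2 * x ^ 2) *
          (1 - α * x ^ 3) * (1 - β * x ^ 3)) := by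
  refine ⟨summable_norm_term10 hαβ hx, ?_⟩
  have hx1 := norm_lt_one_of_max_mul_lt hαβ hx
  have hx3 : max ‖α‖ ‖β‖ * ‖x ^ 3‖ < 1 := by
    refine lt_of_le_of_lt ?_ hx
    rw [norm_pow]
    gcongr
    exact pow_le_of_le_one (norm_nonneg x) hx1.le (by norm_num)
  have norm_mul_lt : ∀ {γ y : ℂ}, ‖γ‖ ≤ max ‖α‖ ‖β‖ → max ‖α‖ ‖β‖ * ‖y‖ < 1 → ‖γ * y‖ < 1 := by
    intro γ y hγ hy
    rw [norm_mul]
    exact (mul_le_mul_of_nonneg_right hγ (norm_nonneg y)).trans_lt hy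
  have sq_ne : ∀ {γ : ℂ}, ‖γ‖ ≤ max ‖α‖ ‖β‖ → 1 - γ ^ 2 * x ^ 2 ≠ 0 := by
    intro γ hγ
    apply one_sub_ne_zero_of_norm_lt_one
    rw [← mul_pow, norm_pow]
    exact pow_lt_one₀ (norm_nonneg _) (norm_mul_lt hγ hx) two_ne_zero
  have hx2ne : 1 - x ^ 2 ≠ 0 := by
    apply one_sub_ne_zero_of_norm_lt_one
    rw [norm_pow]
    exact pow_lt_one₀ (norm_nonneg _) hx1 two_ne_zero
  have hx4ne : 1 - x ^ 4 ≠ 0 := by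
    apply one_sub_ne_zero_of_norm_lt_one
    rw [norm_pow]
    exact pow_lt_one₀ (norm_nonneg _) hx1 four_ne_zero
  have hD2 : (1 - α ^ 2 * x ^ 2) * (1 - β ^ 2 * x ^ 2) =
      1 - ((α + β) ^ 2 - 2) * x ^ 2 + x ^ 4 := by
    linear_combination (x ^ 4 * (α * β + 1) + 2 * x ^ 2) * hαβ
  have hD3 : (1 - α * x ^ 3) * (1 - β * x ^ 3) = 1 - (α + β) * x ^ 3 + x ^ 6 := by
    linear_combination x ^ 6 * hαβ
  have hD2ne : 1 - ((α + β) ^ 2 - 2) * x ^ 2 + x ^ 4 ≠ 0 :=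
    hD2 ▸ mul_ne_zero (sq_ne (le_max_left _ _)) (sq_ne (le_max_right _ _))
  have hD3ne : 1 - (α + β) * x ^ 3 + x ^ 6 ≠ 0 :=
    hD3 ▸ mul_ne_zero (one_sub_ne_zero_of_norm_lt_one (norm_mul_lt (le_max_left _ _) hx3))
      (one_sub_ne_zero_of_norm_lt_one (norm_mul_lt (le_max_right _ _) hx3))
  set L : ℕ → ℂ := fun k => (lamSeq α β k + lamSeq α β (k + 2) * x ^ 2 -
    ((α + β) ^ 2 - 2) * x ^ 2 * lamSeq α β k) /
      (1 - ((α + β) ^ 2 - 2) * x ^ 2 + x ^ 4) with hLdef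
  have hL : ∀ k, HasSum (fun b : ℕ => lamSeq α β (k + 2 * b) * x ^ (2 * b)) (L k) := by
    intro k
    have hs : Summable fun b : ℕ => lamSeq α β (k + 2 * b) * x ^ (2 * b) := by
      refine ((summable_lamSeq_mul_pow hx k).comp_injective (i := fun n : ℕ => 2 * n)
        fun a b h => by simpa using h).congr fun b => ?_
      simp only [Function.comp_apply, add_comm]
    refine (hasSum_of_linear_recurrence hs (fun n => ?_) hD2ne).congr_both (fun _ => rfl) ?_
    · rw [show k + 2 * (n + 2) = k + 2 * n + 4 by ring, lamSeq_add_four hαβ,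
        show k + 2 * (n + 1) = k + 2 * n + 2 by ring]
      ring
    · simp [hLdef]
  set H : ℕ → ℂ := fun a => x ^ (3 * a) * L a with hHdef
  have hHw : Summable fun a : ℕ => ((a : ℂ) + 1) * H a := by
    have h0 := (summable_succ_mul_lamSeq_mul_pow hx3 0).mul_left
      ((1 - ((α + β) ^ 2 - 2) * x ^ 2) / (1 - ((α + β) ^ 2 - 2) * x ^ 2 + x ^ 4))
    have h2 := (summable_succ_mul_lamSeq_mul_pow hx3 2).mul_left
      (x ^ 2 / (1 - ((α + β) ^ 2 - 2) * x ^ 2 + x ^ 4))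
    refine (h0.add h2).congr fun a => ?_
    simp only [hHdef, hLdef, add_zero, pow_mul]
    ring
  have hHs : Summable H := by
    have h0 := (summable_lamSeq_mul_pow hx3 0).mul_left
      ((1 - ((α + β) ^ 2 - 2) * x ^ 2) / (1 - ((α + β) ^ 2 - 2) * x ^ 2 + x ^ 4))
    have h2 := (summable_lamSeq_mul_pow hx3 2).mul_left
      (x ^ 2 / (1 - ((α + β) ^ 2 - 2) * x ^ 2 + x ^ 4))
    refine (h0.add h2).congr fun a => ?_
    simp only [hHdef, hLdef, add_zero, pow_mul]
    ring
  have hHrec : ∀ n, H (n + 2) = (α + β) * x ^ 3 * H (n + 1) - x ^ 6 * H n := by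
    intro n
    simp only [hHdef, hLdef]
    rw [lamSeq_add_two hαβ (n + 2), lamSeq_add_two hαβ (n + 1), lamSeq_add_two hαβ n]
    ring
  have hHsum := hasSum_of_linear_recurrence hHs hHrec hD3ne
  have houter := (hasSum_affine_mul_sub (x ^ 2) hHsum hHw).div_const (1 - x ^ 4)
  have hsum : Summable (term10 α β x) := (summable_norm_term10 hαβ hx).of_norm
  have hmid : ∀ a : ℕ, HasSum (fun q : ℕ × ℕ × ℕ × ℕ => term10 α β x (a, q))
      (((a + 1 : ℂ) + a * x ^ 2) * (H a - H (a + 1)) / (1 - x ^ 4)) := by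
    intro a
    have h1 := (hsum.prod_factor a).hasSum
    have h2 := h1.prod_fiberwise (hasSum_term10_inner hαβ hx a)
    have h3 := (((hL a).mul_left (x ^ (3 * a))).sub
      ((hL (a + 1)).mul_left (x ^ (3 * (a + 1))))).mul_left
        (((a + 1 : ℂ) + a * x ^ 2) / (1 - x ^ 4))
    rw [h2.unique h3] at h1
    refine h1.congr_both (fun _ => rfl) ?_
    simp only [hHdef]
    ring
  rw [(hsum.hasSum.prod_fiberwise hmid).unique houter, mul_assoc (1 - x ^ 2), hD2,
    mul_assoc _ (1 - α * x ^ 3), hD3]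
  have hL0 : H 0 = (1 + x ^ 2) / (1 - ((α + β) ^ 2 - 2) * x ^ 2 + x ^ 4) := by
    simp only [hHdef, hLdef]
    rw [lamSeq_add_two hαβ 0, lamSeq_zero, zero_add, lamSeq_one]
    ring
  have hL1 : H 1 = x ^ 3 * (α + β) / (1 - ((α + β) ^ 2 - 2) * x ^ 2 + x ^ 4) := by
    simp only [hHdef, hLdef]
    rw [lamSeq_add_two hαβ 1, lamSeq_add_two hαβ 0, lamSeq_zero, zero_add, lamSeq_one]
    ring
  rw [hL0, hL1]
  clear_value H L
  generalize 1 - ((α + β) ^ 2 - 2) * x ^ 2 + x ^ 4 = D at hD2ne ⊢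
  generalize hE : 1 - (α + β) * x ^ 3 + x ^ 6 = E at hD3ne ⊢
  field_simp
  rw [← hE]
  ring
end

section
/- The series Σ_{d, a₁, a₂, b ≥ 1} Σ_{c ≥ 1, c | a₁², c | a₂²} μ(d)·μ(d·a₁)·μ(d·a₁·b)²·c / (d³·a₁³·a₂²·b³), where μ is the Möbius function and the inner sum is over positive integers c dividing both a₁² and a₂², converges absolutely and equals ζ(2)/ζ(4) = 15/π². -/
open ArithmeticFunction

/-- The general term of the series: indices `(d, a₁, a₂, b, c)`, all required to be `≥ 1`,
with `c ∣ a₁²` and `c ∣ a₂²`; the term is `μ(d)·μ(d a₁)·μ(d a₁ b)²·c / (d³ a₁³ a₂² b³)`. -/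
noncomputable def term11 : ℕ × ℕ × ℕ × ℕ × ℕ → ℝ
  | (d, a₁, a₂, b, c) =>
    if 1 ≤ d ∧ 1 ≤ a₁ ∧ 1 ≤ a₂ ∧ 1 ≤ b ∧ 1 ≤ c ∧ c ∣ a₁ ^ 2 ∧ c ∣ a₂ ^ 2 then
      ((moebius d : ℤ) : ℝ) * ((moebius (d * a₁) : ℤ) : ℝ) *
        (((moebius (d * a₁ * b) : ℤ) : ℝ)) ^ 2 * (c : ℝ) /
        ((d : ℝ) ^ 3 * (a₁ : ℝ) ^ 3 * (a₂ : ℝ) ^ 2 * (b : ℝ) ^ 3)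
    else 0

open scoped ArithmeticFunction.zeta ArithmeticFunction.Moebius
open UniqueFactorizationMonoid (radical)

/-- A nonnegative family on a product has sum `s` as soon as its iterated sum is `s`. -/
theorem hasSum_prod_of_nonneg {α β : Type*} {f : α × β → ℝ} {g : α → ℝ} {s : ℝ}
    (hf : ∀ p, 0 ≤ f p) (hfg : ∀ x, HasSum (fun y => f (x, y)) (g x)) (hg : HasSum g s) :
    HasSum f s := by
  have hsum : Summable f := by
    rw [summable_prod_of_nonneg hf]
    refine ⟨fun x => (hfg x).summable, ?_⟩
    simpa only [(hfg _).tsum_eq] using hg.summable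
  have h := hsum.hasSum.prod_fiberwise hfg
  rw [hg.unique h]
  exact hsum.hasSum

/-- A divisor of the square of a squarefree number divides the square of its radical. -/
theorem dvd_radical_sq_of_dvd_sq {a c : ℕ} (ha : Squarefree a) (hc : c ∣ a ^ 2) :
    c ∣ radical c ^ 2 := by
  have hc0 : c ≠ 0 := by
    rintro rfl
    exact pow_ne_zero 2 ha.ne_zero (zero_dvd_iff.mp hc)
  have h1 : c ∣ Nat.gcd c a ^ 2 := by
    rw [← Nat.pow_gcd_pow]
    exact Nat.dvd_gcd (Dvd.intro_left c (by ring)) hc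
  have h2 : Nat.gcd c a ∣ radical c := by
    rw [UniqueFactorizationMonoid.dvd_radical_iff
      (ha.squarefree_of_dvd (Nat.gcd_dvd_right c a)).isRadical hc0]
    exact Nat.gcd_dvd_left c a
  exact h1.trans (pow_dvd_pow_of_dvd h2 2)

theorem dvd_sq_iff_radical_dvd {a c m : ℕ} (ha : Squarefree a) (hc : c ∣ a ^ 2) :
    c ∣ m ^ 2 ↔ radical c ∣ m := by
  constructor
  · intro h
    exact (UniqueFactorizationMonoid.squarefree_radical.dvd_pow_iff_dvd two_ne_zero).mp
      (UniqueFactorizationMonoid.radical_dvd_self.trans h)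
  · intro h
    exact (dvd_radical_sq_of_dvd_sq ha hc).trans (pow_dvd_pow_of_dvd h 2)

/-- The multiplicative function `c ↦ c / rad(c)²`. -/
noncomputable def radicalWeight : ArithmeticFunction ℝ :=
  ⟨fun c => (c : ℝ) / ((radical c : ℕ) : ℝ) ^ 2, by simp⟩

theorem radicalWeight_apply (c : ℕ) :
    radicalWeight c = (c : ℝ) / ((radical c : ℕ) : ℝ) ^ 2 := rfl

theorem isMultiplicative_radicalWeight : radicalWeight.IsMultiplicative := by
  refine ⟨by simp [radicalWeight_apply], fun {m n} h => ?_⟩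
  have h' : IsRelPrime m n := Nat.coprime_iff_isRelPrime.mp h
  simp only [radicalWeight_apply, UniqueFactorizationMonoid.radical_mul h', Nat.cast_mul]
  ring

/-- The multiplicative function `a ↦ ∑_{c ∣ a²} c / rad(c)²`. -/
noncomputable def squareDivisorWeight : ArithmeticFunction ℝ :=
  ⟨fun a => ((ζ : ArithmeticFunction ℝ) * radicalWeight) (a ^ 2), by simp⟩

theorem squareDivisorWeight_eq (a : ℕ) :
    squareDivisorWeight a = ((ζ : ArithmeticFunction ℝ) * radicalWeight) (a ^ 2) := rfl

theorem squareDivisorWeight_apply (a : ℕ) :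
    squareDivisorWeight a = ∑ c ∈ (a ^ 2).divisors, (c : ℝ) / ((radical c : ℕ) : ℝ) ^ 2 := by
  rw [squareDivisorWeight_eq, coe_zeta_mul_apply]
  rfl

theorem isMultiplicative_squareDivisorWeight : squareDivisorWeight.IsMultiplicative := by
  have h : ((ζ : ArithmeticFunction ℝ) * radicalWeight).IsMultiplicative :=
    isMultiplicative_zeta.natCast.mul isMultiplicative_radicalWeight
  refine ⟨by simp [squareDivisorWeight_eq, h.map_one], fun {m n} hmn => ?_⟩
  rw [squareDivisorWeight_eq, mul_pow, h.map_mul_of_coprime (hmn.pow 2 2)]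
  rfl

theorem squareDivisorWeight_prime {p : ℕ} (hp : p.Prime) :
    squareDivisorWeight p = 2 + 1 / (p : ℝ) := by
  have hp0 : (p : ℝ) ≠ 0 := by exact_mod_cast hp.ne_zero
  rw [squareDivisorWeight_apply, Nat.sum_divisors_prime_pow hp]
  simp only [Finset.sum_range_succ, Finset.sum_range_zero]
  rw [UniqueFactorizationMonoid.radical_pow_of_prime hp.prime two_ne_zero, pow_one,
    UniqueFactorizationMonoid.radical_of_prime hp.prime]
  simp
  field_simp
  ring

theorem squareDivisorWeight_nonneg (a : ℕ) : 0 ≤ squareDivisorWeight a := by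
  rw [squareDivisorWeight_apply]
  positivity

theorem card_divisors_sq_le (a : ℕ) : (a ^ 2).divisors.card ≤ 2 * a := by
  have hsub : (a ^ 2).divisors ⊆
      Finset.Icc 1 a ∪ (Finset.Icc 1 a).image (fun k => a ^ 2 / k) := by
    intro c hc
    obtain ⟨⟨e, he⟩, h0⟩ := Nat.mem_divisors.mp hc
    have hc0 : 0 < c := Nat.pos_of_mem_divisors hc
    have he0 : 0 < e := Nat.pos_of_ne_zero (by rintro rfl; simp_all)
    rw [Finset.mem_union, Finset.mem_image]
    by_cases hca : c ≤ a
    · exact Or.inl (Finset.mem_Icc.mpr ⟨hc0, hca⟩)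
    · refine Or.inr ⟨e, Finset.mem_Icc.mpr ⟨he0, ?_⟩, ?_⟩
      · by_contra hea
        push Not at hca hea
        nlinarith
      · rw [he, Nat.mul_div_cancel _ he0]
  calc _ ≤ _ := Finset.card_le_card hsub
    _ ≤ _ := Finset.card_union_le _ _
    _ ≤ a + a := by
      gcongr
      · simp
      · exact Finset.card_image_le.trans (by simp)
    _ = 2 * a := by ring

theorem squareDivisorWeight_le {a : ℕ} (ha : Squarefree a) :
    squareDivisorWeight a ≤ 2 * a := by
  rw [squareDivisorWeight_apply]
  have h : ∀ c ∈ (a ^ 2).divisors, (c : ℝ) / ((radical c : ℕ) : ℝ) ^ 2 ≤ 1 := by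
    intro c hc
    have hr : 0 < radical c ^ 2 :=
      pow_pos (Nat.pos_of_ne_zero UniqueFactorizationMonoid.radical_ne_zero) 2
    refine div_le_one_of_le₀ ?_ (by positivity)
    exact_mod_cast Nat.le_of_dvd hr
      (dvd_radical_sq_of_dvd_sq ha (Nat.dvd_of_mem_divisors hc))
  refine (Finset.sum_le_card_nsmul _ _ _ h).trans ?_
  rw [nsmul_eq_mul, mul_one]
  exact_mod_cast card_divisors_sq_le a

/-- The factor of the general term depending on `c` and `a₂`, for given `a = a₁`. -/
noncomputable def innerTerm (a : ℕ) (q : ℕ × ℕ) : ℝ :=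
  if q.1 ∣ a ^ 2 ∧ q.1 ∣ q.2 ^ 2 then (q.1 : ℝ) / (q.2 : ℝ) ^ 2 else 0

theorem innerTerm_nonneg (a : ℕ) (q : ℕ × ℕ) : 0 ≤ innerTerm a q := by
  unfold innerTerm
  split_ifs <;> positivity

theorem hasSum_innerTerm_right {a : ℕ} (ha : Squarefree a) (c : ℕ) :
    HasSum (fun m => innerTerm a (c, m))
      (if c ∣ a ^ 2 then Real.pi ^ 2 / 6 * ((c : ℝ) / ((radical c : ℕ) : ℝ) ^ 2) else 0) := by
  split_ifs with hc
  · have hr : 0 < radical c := Nat.pos_of_ne_zero UniqueFactorizationMonoid.radical_ne_zero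
    have hinj : Function.Injective (fun k => radical c * k) :=
      fun x y h => Nat.eq_of_mul_eq_mul_left hr h
    rw [← hinj.hasSum_iff]
    · refine (hasSum_zeta_two.mul_right ((c : ℝ) / ((radical c : ℕ) : ℝ) ^ 2)).congr_fun ?_
      intro k
      have : c ∣ (radical c * k) ^ 2 :=
        (dvd_sq_iff_radical_dvd ha hc).mpr (dvd_mul_right _ _)
      simp only [Function.comp_apply, innerTerm, hc, this, and_self, if_true, Nat.cast_mul]
      rw [mul_pow, one_div_mul_eq_div, div_div]
    · intro m hm
      refine if_neg fun h => hm ?_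
      obtain ⟨k, hk⟩ := (dvd_sq_iff_radical_dvd ha hc).mp h.2
      exact ⟨k, hk.symm⟩
  · simp only [innerTerm, hc, false_and, if_false]
    exact hasSum_zero

theorem hasSum_innerTerm {a : ℕ} (ha : Squarefree a) :
    HasSum (innerTerm a) (Real.pi ^ 2 / 6 * squareDivisorWeight a) := by
  refine hasSum_prod_of_nonneg (innerTerm_nonneg a) (hasSum_innerTerm_right ha) ?_
  rw [squareDivisorWeight_apply, Finset.mul_sum]
  have h0 : a ^ 2 ≠ 0 := pow_ne_zero 2 ha.ne_zero
  have : ∑ c ∈ (a ^ 2).divisors, Real.pi ^ 2 / 6 * ((c : ℝ) / ((radical c : ℕ) : ℝ) ^ 2) =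
      ∑ c ∈ (a ^ 2).divisors,
        if c ∣ a ^ 2 then Real.pi ^ 2 / 6 * ((c : ℝ) / ((radical c : ℕ) : ℝ) ^ 2) else 0 :=
    Finset.sum_congr rfl fun c hc => (if_pos (Nat.dvd_of_mem_divisors hc)).symm
  rw [this]
  refine hasSum_sum_of_ne_finset_zero fun c hc => if_neg fun h => hc ?_
  exact Nat.mem_divisors.mpr ⟨h, h0⟩

/-- The factor of the general term depending only on the triple `(d, b, a)`. -/
noncomputable def outerCoeff (t : ℕ × ℕ × ℕ) : ℝ :=
  (μ (t.1 * (t.2.1 * t.2.2)) : ℝ) ^ 2 * (μ t.2.2 : ℝ) /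
    ((t.1 : ℝ) ^ 3 * (t.2.1 : ℝ) ^ 3 * (t.2.2 : ℝ) ^ 3)

theorem outerCoeff_eq_zero {d b a : ℕ} (h : ¬ Squarefree (d * (b * a))) :
    outerCoeff (d, b, a) = 0 := by
  simp [outerCoeff, moebius_eq_zero_of_not_squarefree h]

theorem abs_outerCoeff_le (d b a : ℕ) :
    |outerCoeff (d, b, a)| ≤ 1 / (d : ℝ) ^ 3 * (1 / (b : ℝ) ^ 3 * (1 / (a : ℝ) ^ 3)) := by
  have h (n : ℕ) : |(μ n : ℝ)| ≤ 1 := by exact_mod_cast abs_moebius_le_one (n := n)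
  have h1 : |(μ (d * (b * a)) : ℝ) ^ 2 * (μ a : ℝ)| ≤ 1 := by
    rw [abs_mul, abs_pow]
    exact mul_le_one₀ (pow_le_one₀ (abs_nonneg _) (h _)) (abs_nonneg _) (h _)
  rw [outerCoeff, abs_div, abs_of_nonneg (a := _ * _ * _) (by positivity)]
  calc _ ≤ 1 / ((d : ℝ) ^ 3 * (b : ℝ) ^ 3 * (a : ℝ) ^ 3) := by gcongr
    _ = _ := by simp only [one_div, mul_inv, mul_assoc]

theorem term11_eq (d a m b c : ℕ) :
    term11 (d, a, m, b, c) = outerCoeff (d, b, a) * innerTerm a (c, m) := by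
  by_cases hsq : Squarefree (d * (b * a))
  · have hd : Squarefree d := hsq.squarefree_of_dvd (dvd_mul_right _ _)
    have hda : Squarefree (d * a) := hsq.squarefree_of_dvd ⟨b, by ring⟩
    have hcop : d.Coprime a := Nat.coprime_of_squarefree_mul hda
    have hmu : (μ d : ℝ) * (μ (d * a) : ℝ) = (μ a : ℝ) := by
      have h2 : (μ d : ℝ) ^ 2 = 1 := by exact_mod_cast moebius_sq_eq_one_of_squarefree hd
      rw [isMultiplicative_moebius.map_mul_of_coprime hcop]
      push_cast
      linear_combination (μ a : ℝ) * h2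
    have hne := hsq.ne_zero
    simp only [mul_ne_zero_iff] at hne
    obtain ⟨hd0, hb0, ha0⟩ := hne
    have hperm : d * a * b = d * (b * a) := by ring
    simp only [term11, innerTerm, outerCoeff, hmu, hperm]
    by_cases hm : m = 0
    · simp [hm]
    by_cases hc : c = 0
    · simp [hc]
    simp only [Nat.one_le_iff_ne_zero, ne_eq, hd0, hb0, ha0, hm, hc, not_false_eq_true, true_and]
    split_ifs
    · rw [div_mul_div_comm]
      congr 1 <;> ring
    · simp
  · have hperm : d * a * b = d * (b * a) := by ring
    rw [outerCoeff_eq_zero hsq, zero_mul, term11, hperm, moebius_eq_zero_of_not_squarefree hsq]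
    simp

/-- Reordering of the indices `((d, b, a₁), (c, a₂))` as `(d, a₁, a₂, b, c)`. -/
def indexEquiv : (ℕ × ℕ × ℕ) × (ℕ × ℕ) ≃ ℕ × ℕ × ℕ × ℕ × ℕ where
  toFun x := (x.1.1, x.1.2.2, x.2.2, x.1.2.1, x.2.1)
  invFun p := ((p.1, p.2.2.2.1, p.2.1), (p.2.2.2.2, p.2.2.1))
  left_inv _ := rfl
  right_inv _ := rfl

theorem term11_indexEquiv (x : (ℕ × ℕ × ℕ) × (ℕ × ℕ)) :
    term11 (indexEquiv x) = outerCoeff x.1 * innerTerm x.1.2.2 x.2 :=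
  term11_eq _ _ _ _ _

theorem hasSum_outerCoeff_mul_innerTerm (φ : ℝ → ℝ) (hφ : φ 0 = 0) (t : ℕ × ℕ × ℕ) :
    HasSum (fun q => φ (outerCoeff t) * innerTerm t.2.2 q)
      (φ (outerCoeff t) * (Real.pi ^ 2 / 6 * squareDivisorWeight t.2.2)) := by
  obtain ⟨d, b, a⟩ := t
  by_cases hsq : Squarefree (d * (b * a))
  · exact (hasSum_innerTerm (hsq.squarefree_of_dvd ⟨d * b, by ring⟩)).mul_left _
  · simp only [outerCoeff_eq_zero hsq, hφ, zero_mul]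
    exact hasSum_zero

theorem summable_abs_outer :
    Summable fun t : ℕ × ℕ × ℕ =>
      |outerCoeff t| * (Real.pi ^ 2 / 6 * squareDivisorWeight t.2.2) := by
  have h3 : Summable fun n : ℕ => 1 / (n : ℝ) ^ 3 :=
    Real.summable_one_div_nat_pow.mpr (by norm_num)
  have h2 : Summable fun n : ℕ => 1 / (n : ℝ) ^ 2 :=
    Real.summable_one_div_nat_pow.mpr (by norm_num)
  have hprod := (h3.mul_of_nonneg
    (h3.mul_of_nonneg h2 (fun _ => by positivity) (fun _ => by positivity))
    (fun _ => by positivity) (fun _ => by simp only [Pi.zero_apply]; positivity)).mul_left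
      (Real.pi ^ 2 / 6 * 2)
  refine Summable.of_nonneg_of_le (fun t => ?_) (fun t => ?_) hprod
  · exact mul_nonneg (abs_nonneg _) (mul_nonneg (by positivity) (squareDivisorWeight_nonneg _))
  · obtain ⟨d, b, a⟩ := t
    by_cases hsq : Squarefree (d * (b * a))
    · have ha : Squarefree a := hsq.squarefree_of_dvd ⟨d * b, by ring⟩
      have ha0 : (a : ℝ) ≠ 0 := by exact_mod_cast ha.ne_zero
      calc |outerCoeff (d, b, a)| * (Real.pi ^ 2 / 6 * squareDivisorWeight a)
          ≤ (1 / (d : ℝ) ^ 3 * (1 / (b : ℝ) ^ 3 * (1 / (a : ℝ) ^ 3))) *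
            (Real.pi ^ 2 / 6 * (2 * a)) :=
            mul_le_mul (abs_outerCoeff_le d b a)
              (mul_le_mul_of_nonneg_left (squareDivisorWeight_le ha) (by positivity))
              (mul_nonneg (by positivity) (squareDivisorWeight_nonneg _)) (by positivity)
        _ = _ := by
          have : 1 / (a : ℝ) ^ 3 * a = 1 / (a : ℝ) ^ 2 := by field_simp
          simp only [← this]
          ring
    · rw [outerCoeff_eq_zero hsq, abs_zero, zero_mul]
      positivity

theorem summable_abs_term11 : Summable fun p => |term11 p| := by
  rw [← indexEquiv.summable_iff]
  have h := hasSum_prod_of_nonneg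
    (f := fun x : (ℕ × ℕ × ℕ) × (ℕ × ℕ) => |outerCoeff x.1| * innerTerm x.1.2.2 x.2)
    (fun x => mul_nonneg (abs_nonneg _) (innerTerm_nonneg _ _))
    (hasSum_outerCoeff_mul_innerTerm (fun x => |x|) abs_zero) summable_abs_outer.hasSum
  refine h.summable.congr fun x => ?_
  rw [Function.comp_apply, term11_indexEquiv, abs_mul, abs_of_nonneg (innerTerm_nonneg _ _)]

theorem hasSum_outer :
    HasSum (fun t : ℕ × ℕ × ℕ => outerCoeff t * (Real.pi ^ 2 / 6 * squareDivisorWeight t.2.2))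
      (∑' p, term11 p) := by
  have h := (indexEquiv.hasSum_iff).mpr summable_abs_term11.of_abs.hasSum
  refine h.prod_fiberwise fun t => ?_
  simpa only [Function.comp_apply, term11_indexEquiv, id] using
    hasSum_outerCoeff_mul_innerTerm id rfl t

/-- For squarefree `n`, `∑_{d b a = n} μ(a) ∏_{p ∣ a} (2 + 1/p) = μ(n) / n`. -/
theorem zeta_mul_zeta_mul_moebius_squareDivisorWeight {n : ℕ} (hn : Squarefree n) :
    ((ζ : ArithmeticFunction ℝ) * ((ζ : ArithmeticFunction ℝ) *
      (μ : ArithmeticFunction ℝ).pmul squareDivisorWeight)) n = (μ n : ℝ) / n := by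
  have hK : ((μ : ArithmeticFunction ℝ).pmul squareDivisorWeight).IsMultiplicative :=
    isMultiplicative_moebius.intCast.pmul isMultiplicative_squareDivisorWeight
  have hz : (ζ : ArithmeticFunction ℝ).IsMultiplicative := isMultiplicative_zeta.natCast
  have hF := hz.mul (hz.mul hK)
  induction n using Nat.recOnMul with
  | zero => exact absurd rfl hn.ne_zero
  | one => rw [hF.map_one]; simp
  | prime p hp =>
    have hp0 : (p : ℝ) ≠ 0 := by exact_mod_cast hp.ne_zero
    rw [coe_zeta_mul_apply, hp.sum_divisors, (hz.mul hK).map_one, coe_zeta_mul_apply,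
      hp.sum_divisors, hK.map_one, pmul_apply, squareDivisorWeight_prime hp, intCoe_apply,
      moebius_apply_prime hp]
    push_cast
    field_simp
    ring
  | mul m k hm hk =>
    have hcop := Nat.coprime_of_squarefree_mul hn
    rw [hF.map_mul_of_coprime hcop, hm hn.of_mul_left, hk hn.of_mul_right,
      isMultiplicative_moebius.map_mul_of_coprime hcop]
    push_cast
    rw [div_mul_div_comm]

theorem tsum_fiber_outer (n : ℕ) :
    ∑' t : (fun t : ℕ × ℕ × ℕ => t.1 * (t.2.1 * t.2.2)) ⁻¹' {n},
      outerCoeff t * (Real.pi ^ 2 / 6 * squareDivisorWeight t.1.2.2) =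
      Real.pi ^ 2 / 6 * ((μ n : ℝ) / (n : ℝ) ^ 4) := by
  by_cases hn : Squarefree n
  · have hn0 := hn.ne_zero
    have hset : (fun t : ℕ × ℕ × ℕ => t.1 * (t.2.1 * t.2.2)) ⁻¹' {n} =
        ↑((n.divisors ×ˢ n.divisors ×ˢ n.divisors).filter
          fun t : ℕ × ℕ × ℕ => t.1 * (t.2.1 * t.2.2) = n) := by
      ext ⟨d, b, a⟩
      simp only [Set.mem_preimage, Set.mem_singleton_iff, Finset.coe_filter, Finset.mem_product,
        Nat.mem_divisors, Set.mem_ofPred_eq]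
      refine ⟨fun h => ⟨⟨⟨⟨_, h.symm⟩, hn0⟩, ⟨⟨d * a, ?_⟩, hn0⟩, ⟨⟨d * b, ?_⟩, hn0⟩⟩, h⟩,
        fun h => h.2⟩
      · rw [← h]; ring
      · rw [← h]; ring
    have hsum : ∑ t ∈ (n.divisors ×ˢ n.divisors ×ˢ n.divisors).filter
        (fun t : ℕ × ℕ × ℕ => t.1 * (t.2.1 * t.2.2) = n),
          (μ t.2.2 : ℝ) * squareDivisorWeight t.2.2 = (μ n : ℝ) / n := by
      rw [← zeta_mul_zeta_mul_moebius_squareDivisorWeight hn, mul_apply]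
      simp only [mul_apply, Finset.mul_sum]
      rw [Finset.sum_sigma']
      refine Finset.sum_bij' (fun t _ => ⟨(t.1, t.2.1 * t.2.2), t.2⟩) (fun y _ => (y.1.1, y.2))
        ?_ ?_ ?_ ?_ ?_
      · rintro ⟨d, b, a⟩ h
        have h' := (Finset.mem_filter.mp h).2
        subst h'
        simp_all [Nat.mem_divisorsAntidiagonal]
      · rintro ⟨⟨d, m⟩, ⟨b, a⟩⟩ h
        simp only [Finset.mem_sigma, Nat.mem_divisorsAntidiagonal] at h
        obtain ⟨⟨h1, -⟩, rfl, -⟩ := h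
        rw [← Finset.mem_coe, ← hset]
        exact h1
      · rintro ⟨d, b, a⟩ -
        rfl
      · rintro ⟨⟨d, m⟩, ⟨b, a⟩⟩ h
        simp only [Finset.mem_sigma, Nat.mem_divisorsAntidiagonal] at h
        obtain ⟨-, rfl, -⟩ := h
        rfl
      · rintro ⟨d, b, a⟩ h
        have h' := (Finset.mem_filter.mp h).2
        subst h'
        simp only [mul_ne_zero_iff] at hn0
        simp [natCoe_apply, zeta_apply, hn0]
    rw [hset, Finset.tsum_subtype' _ fun t : ℕ × ℕ × ℕ =>
      outerCoeff t * (Real.pi ^ 2 / 6 * squareDivisorWeight t.2.2)]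
    have hmu : (μ n : ℝ) ^ 2 = 1 := by exact_mod_cast moebius_sq_eq_one_of_squarefree hn
    have hterm : ∀ t ∈ (n.divisors ×ˢ n.divisors ×ˢ n.divisors).filter
        (fun t : ℕ × ℕ × ℕ => t.1 * (t.2.1 * t.2.2) = n),
        outerCoeff t * (Real.pi ^ 2 / 6 * squareDivisorWeight t.2.2) =
          Real.pi ^ 2 / 6 / (n : ℝ) ^ 3 * ((μ t.2.2 : ℝ) * squareDivisorWeight t.2.2) := by
      rintro ⟨d, b, a⟩ h
      have h' : d * (b * a) = n := (Finset.mem_filter.mp h).2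
      have hden : (d : ℝ) ^ 3 * (b : ℝ) ^ 3 * (a : ℝ) ^ 3 = (n : ℝ) ^ 3 := by
        rw [← h']
        push_cast
        ring
      simp only [outerCoeff, h', hmu, hden]
      ring
    rw [Finset.sum_congr rfl hterm, ← Finset.mul_sum, hsum, div_mul_div_comm, mul_div_assoc]
    ring
  · have hz : ∀ t : (fun t : ℕ × ℕ × ℕ => t.1 * (t.2.1 * t.2.2)) ⁻¹' {n},
        outerCoeff t * (Real.pi ^ 2 / 6 * squareDivisorWeight t.1.2.2) = 0 := by
      rintro ⟨⟨d, b, a⟩, ht⟩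
      rw [outerCoeff_eq_zero, zero_mul]
      have : d * (b * a) = n := ht
      rwa [this]
    simp [hz, moebius_eq_zero_of_not_squarefree hn]

theorem hasSum_moebius_div_pow_four :
    HasSum (fun n : ℕ => (μ n : ℝ) / (n : ℝ) ^ 4) (90 / Real.pi ^ 4) := by
  have h4 : 1 < (4 : ℂ).re := by norm_num
  have h := LSeries_zeta_mul_Lseries_moebius h4
  rw [LSeries_zeta_eq_riemannZeta h4, riemannZeta_four] at h
  have hs : HasSum (fun n => LSeries.term (fun n => ((μ n : ℤ) : ℂ)) 4 n)
      (LSeries (fun n => ((μ n : ℤ) : ℂ)) 4) :=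
    (LSeriesSummable_moebius_iff.mpr h4).LSeriesHasSum
  have hpi : (Real.pi : ℂ) ≠ 0 := by exact_mod_cast Real.pi_ne_zero
  have hv : LSeries (fun n => ((μ n : ℤ) : ℂ)) 4 = ((90 / Real.pi ^ 4 : ℝ) : ℂ) := by
    push_cast
    field_simp at h ⊢
    linear_combination h
  rw [hv] at hs
  rw [← Complex.hasSum_ofReal]
  refine hs.congr_fun fun n => ?_
  rcases eq_or_ne n 0 with rfl | hn
  · simp
  · rw [LSeries.term_of_ne_zero hn]
    push_cast
    norm_cast

theorem stmt11 :
    Summable (fun p => |term11 p|) ∧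
    (∑' p, term11 p) = 15 / Real.pi ^ 2 ∧
    riemannZeta 2 / riemannZeta 4 = ((15 / Real.pi ^ 2 : ℝ) : ℂ) := by
  refine ⟨summable_abs_term11, ?_, ?_⟩
  · have h := hasSum_outer.tsum_fiberwise (fun t : ℕ × ℕ × ℕ => t.1 * (t.2.1 * t.2.2))
    simp only [tsum_fiber_outer] at h
    rw [h.unique (hasSum_moebius_div_pow_four.mul_left (Real.pi ^ 2 / 6))]
    have := Real.pi_ne_zero
    field_simp
    norm_num
  · have : (Real.pi : ℂ) ≠ 0 := by exact_mod_cast Real.pi_ne_zero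
    rw [riemannZeta_two, riemannZeta_four]
    push_cast
    field_simp
    norm_num
end
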